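/- Let n̂, n̂' ∈ C⁰(P̂). Then n̂ and n̂' are homotopic in C⁰(P̂) if and only if they have the same invariants: e^b(n̂) = e^b(n̂') for every truncated edge Ê^b, k^{ac}(n̂) = k^{ac}(n̂') for every cleaved edge B̂^{ac}, and w^a(n̂) = w^a(n̂') for every cleaved face Ĉ^a. -/

import Mathlib

open Matrix Set MeasureTheory
open scoped Classical

noncomputable section

/-- Points of `ℝ³`. -/
abbrev V3 := Fin 3 → ℝ

/-- The unit sphere `S² ⊂ ℝ³`. -/
def sphereS : Set V3 := {x | x ⬝ᵥ x = 1}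

/-- Rodrigues rotation of `v` by angle `θ` about the unit axis `F`. -/
def rot3 (F : V3) (θ : ℝ) (v : V3) : V3 :=
  Real.cos θ • v + Real.sin θ • (crossProduct F v) + ((1 - Real.cos θ) * (F ⬝ᵥ v)) • F

/-- The point at fraction `ρ` of arclength along the shortest geodesic on the
unit sphere from `p` to `a` (for `a ≠ -p`). -/
def geo (p a : V3) (ρ : ℝ) : V3 :=
  if p = a then p
  else (Real.sin ((1 - ρ) * Real.arccos (p ⬝ᵥ a)) / Real.sin (Real.arccos (p ⬝ᵥ a))) • p +
       (Real.sin (ρ * Real.arccos (p ⬝ᵥ a)) / Real.sin (Real.arccos (p ⬝ᵥ a))) • a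

/-- `ξ` is the continuous angle lift of the tangent field `n` along the path `z`
(defined on `[0,1]`), `η ∈ (-π,π)` the smallest-magnitude angle between the endpoint
values, and `κ` the resulting kink number: `2πκ = ξ(1) - η`. -/
def IsKinkAlong (Fn : V3) (n : V3 → V3) (z : ℝ → V3) (κ : ℤ) : Prop :=
  ∃ ξ : ℝ → ℝ, ContinuousOn ξ (Set.Icc 0 1) ∧ ξ 0 = 0 ∧
    (∀ t ∈ Set.Icc (0:ℝ) 1, n (z t) = rot3 Fn (ξ t) (n (z 0))) ∧
    ∃ η : ℝ, η ∈ Set.Ioo (-Real.pi) Real.pi ∧ n (z 1) = rot3 Fn η (n (z 0)) ∧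
      2 * Real.pi * (κ : ℝ) = ξ 1 - η

/-- `z` is a `2π`-periodic parameterization of a loop around the centre `ctr`, lying in the
plane through `ctr` with normal `N`, positively oriented with respect to `N` (the angle
`θ` increases by `2π` over a period). -/
def PosLoopParam (N ctr : V3) (z : ℝ → V3) : Prop :=
  Continuous z ∧ (∀ φ, z (φ + 2 * Real.pi) = z φ) ∧
  ∃ e₁ e₂ : V3, e₁ ⬝ᵥ e₁ = 1 ∧ e₂ ⬝ᵥ e₂ = 1 ∧ e₁ ⬝ᵥ e₂ = 0 ∧ crossProduct e₁ e₂ = N ∧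
    ∃ θ r : ℝ → ℝ, Continuous θ ∧ Monotone θ ∧ (∀ φ, θ (φ + 2 * Real.pi) = θ φ + 2 * Real.pi) ∧
      (∀ φ, 0 < r φ) ∧
      ∀ φ, z φ = ctr + r φ • (Real.cos (θ φ) • e₁ + Real.sin (θ φ) • e₂)

/-- The map `S² → S²` obtained by gluing, along the equator, the map
`ν(ρ,φ) = n(ρ z(φ) + (1-ρ) ctr)` (on the upper hemisphere) with the map
`ν₀(ρ,φ) = g_ρ(-s, n(z(φ)))` (on the lower hemisphere), where `(ρ,φ)` are the polar
coordinates of the first two coordinates. -/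
def wrapMap (n : V3 → V3) (z : ℝ → V3) (ctr s : V3) : V3 → V3 := fun x =>
  if 0 ≤ x 2 then
    n ((Real.sqrt ((x 0) ^ 2 + (x 1) ^ 2)) • z (Complex.arg ((x 0 : ℂ) + (x 1 : ℂ) * Complex.I))
      + (1 - Real.sqrt ((x 0) ^ 2 + (x 1) ^ 2)) • ctr)
  else
    geo (-s) (n (z (Complex.arg ((x 0 : ℂ) + (x 1 : ℂ) * Complex.I))))
      (Real.sqrt ((x 0) ^ 2 + (x 1) ^ 2))

/-- Homotopy of maps of the unit sphere `S²` to itself. -/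
def SphHomotopic (f g : V3 → V3) : Prop :=
  ∃ H : ℝ → V3 → V3,
    ContinuousOn (fun q : ℝ × V3 => H q.1 q.2) (Set.Icc (0:ℝ) 1 ×ˢ sphereS) ∧
    (∀ t ∈ Set.Icc (0:ℝ) 1, Set.MapsTo (H t) sphereS sphereS) ∧
    (∀ x ∈ sphereS, H 0 x = f x) ∧ (∀ x ∈ sphereS, H 1 x = g x)

/-- The standard degree-`k` self-map of `S²`: in cylindrical coordinates it multiplies
the azimuthal angle by `k`, fixing the vertical coordinate. -/
def powMap (k : ℤ) : V3 → V3 := fun x =>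
  if ((x 0 : ℂ) + (x 1 : ℂ) * Complex.I) = 0 then x
  else
    ![‖(x 0 : ℂ) + (x 1 : ℂ) * Complex.I‖ *
        ((((x 0 : ℂ) + (x 1 : ℂ) * Complex.I) /
          (‖(x 0 : ℂ) + (x 1 : ℂ) * Complex.I‖ : ℂ)) ^ k).re,
      ‖(x 0 : ℂ) + (x 1 : ℂ) * Complex.I‖ *
        ((((x 0 : ℂ) + (x 1 : ℂ) * Complex.I) /
          (‖(x 0 : ℂ) + (x 1 : ℂ) * Complex.I‖ : ℂ)) ^ k).im,
      x 2]

/-- `deg` is a Brouwer degree for self-maps of `S²`: it is invariant under homotopy of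
continuous self-maps of the sphere, and assigns degree `k` to the standard map `powMap k`.
(These axioms determine `deg` uniquely on continuous self-maps of `S²`, by Hopf's theorem.) -/
def DegreeTheory (deg : (V3 → V3) → ℤ) : Prop :=
  (∀ f g : V3 → V3, ContinuousOn f sphereS → Set.MapsTo f sphereS sphereS →
      ContinuousOn g sphereS → Set.MapsTo g sphereS sphereS →
      SphHomotopic f g → deg f = deg g) ∧
  (∀ k : ℤ, deg (powMap k) = k)

/-- The pullback under `u : ℝ² → S²` of the (normalized) area 2-form of `S²`,
evaluated on the standard basis of `ℝ²`: `u ⋅ (∂₁ u × ∂₂ u)`. -/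
def pullA (u : ℝ × ℝ → V3) (p : ℝ × ℝ) : ℝ :=
  u p ⬝ᵥ crossProduct (fderiv ℝ u p (1, 0)) (fderiv ℝ u p (0, 1))

/-- The integral `∫_A n*ω` of the pullback under `n` of the area form `ω` of `S²`, over a
planar region `A` lying in the plane through `o` spanned by the orthonormal pair `e₁, e₂`
(the pair orienting the plane). -/
def faceInt (n : V3 → V3) (o e₁ e₂ : V3) (A : Set V3) : ℝ :=
  ∫ p : ℝ × ℝ in {q : ℝ × ℝ | o + q.1 • e₁ + q.2 • e₂ ∈ A},
    pullA (fun q : ℝ × ℝ => n (o + q.1 • e₁ + q.2 • e₂)) p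

/-- The 1-form `γ = (1 - cos α) dβ` on `S² - {s}` (where `(α,β)` are spherical polar
coordinates with south pole at `s`, and `e₁, e₂` is an orthonormal azimuthal frame with
`e₁ ×₃ e₂ = -s`), evaluated at the point `v` on the tangent vector `w`. -/
def gammaForm (s e₁ e₂ : V3) (v w : V3) : ℝ :=
  if (v ⬝ᵥ e₁) ^ 2 + (v ⬝ᵥ e₂) ^ 2 = 0 then 0
  else (1 + v ⬝ᵥ s) *
    (((v ⬝ᵥ e₁) * (w ⬝ᵥ e₂) - (v ⬝ᵥ e₂) * (w ⬝ᵥ e₁)) / ((v ⬝ᵥ e₁) ^ 2 + (v ⬝ᵥ e₂) ^ 2))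

/-- The closed spherical geodesic triangle with vertices `a`, `b`, `c` (pairwise
non-antipodal): the radial projection to the sphere of the planar triangle with these
vertices. Its sides are the shortest geodesic arcs joining consecutive vertices. -/
def sphTri (a b c : V3) : Set V3 :=
  {x | ∃ α β γ : ℝ, 0 ≤ α ∧ 0 ≤ β ∧ 0 ≤ γ ∧ α • a + β • b + γ • c ≠ 0 ∧
    x = (Real.sqrt ((α • a + β • b + γ • c) ⬝ᵥ (α • a + β • b + γ • c)))⁻¹ •
      (α • a + β • b + γ • c)}

/-- The shortest geodesic arc on the sphere from `a` to `b` (for `a ≠ -b`). -/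
def sphArc (a b : V3) : Set V3 :=
  {x | ∃ α β : ℝ, 0 ≤ α ∧ 0 ≤ β ∧ α • a + β • b ≠ 0 ∧
    x = (Real.sqrt ((α • a + β • b) ⬝ᵥ (α • a + β • b)))⁻¹ • (α • a + β • b)}

/-- The oriented area `A(a,b,c)` of the spherical geodesic triangle with vertices
`a`, `b`, `c`: `A = 2 arg((1 + a⋅b + b⋅c + c⋅a) + i (a×b)⋅c)`, with `arg ∈ (-π, π]`. -/
def sphA (a b c : V3) : ℝ :=
  2 * Complex.arg (((1 + a ⬝ᵥ b + b ⬝ᵥ c + c ⬝ᵥ a : ℝ) : ℂ) +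
    ((crossProduct a b ⬝ᵥ c : ℝ) : ℂ) * Complex.I)

/-- `σ(a,b,c)` relative to the point `s`: equal to `sgn((a×b)⋅s)` if `s` lies in the
spherical triangle with vertices `a`, `b`, `c`, and `0` otherwise. -/
def sphSigma (s a b c : V3) : ℝ :=
  if s ∈ sphTri a b c then Real.sign (crossProduct a b ⬝ᵥ s) else 0

/-- A compact convex polyhedron `P̄ ⊂ ℝ³` with nonempty interior: its vertices `vert`,
faces `face` (with outward unit normals `Fnormal` and supporting planes
`{x | x ⋅ Fnormal c = foffset c}`), edges `edge` (segments between vertices), together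
with the truncation data: for each vertex `a` a plane through `cpt a` with outward unit
normal `Cnormal a` separating `vert a` from the other vertices, the planes being pairwise
disjoint within `P̄`.  The combinatorial data records, for each face `c`, its `m c`
vertices `fvert c 0, fvert c 1, …` and edges `fedge c i` (from `fvert c i` to
`fvert c (i+1)`) in cyclic order, positively oriented with respect to the outward normal;
and, for each vertex `a`, its `vm a` incident edges `vedge a i` and faces `vface a i`
(with `vface a i` containing the consecutive edges `vedge a i` and `vedge a (i+1)`) in
cyclic order, positively oriented with respect to the outward normal of the cleaved face. -/
structure PolyCtx where
  nv : ℕ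
  ne : ℕ
  nf : ℕ
  Pbar : Set V3
  vert : Fin nv → V3
  face : Fin nf → Set V3
  Fnormal : Fin nf → V3
  foffset : Fin nf → ℝ
  edge : Fin ne → Set V3
  esrc : Fin ne → Fin nv
  etgt : Fin ne → Fin nv
  edgeDir : Fin ne → V3
  cpt : Fin nv → V3
  Cnormal : Fin nv → V3
  m : Fin nf → ℕ
  fvert : Fin nf → ℕ → Fin nv
  fedge : Fin nf → ℕ → Fin ne
  vm : Fin nv → ℕ
  vedge : Fin nv → ℕ → Fin ne
  vface : Fin nv → ℕ → Fin nf
  compact : IsCompact Pbar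
  convex : Convex ℝ Pbar
  int_nonempty : (interior Pbar).Nonempty
  hull : Pbar = convexHull ℝ (Set.range vert)
  vert_extreme : ∀ a, vert a ∉ convexHull ℝ (Set.range vert \ {vert a})
  vert_inj : Function.Injective vert
  Fnormal_unit : ∀ c, Fnormal c ⬝ᵥ Fnormal c = 1
  face_def : ∀ c, face c = {x ∈ Pbar | x ⬝ᵥ Fnormal c = foffset c}
  face_supp : ∀ c, ∀ x ∈ Pbar, x ⬝ᵥ Fnormal c ≤ foffset c
  frontier_eq : frontier Pbar = ⋃ c, face c
  edge_def : ∀ b, edge b = segment ℝ (vert (esrc b)) (vert (etgt b))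
  edge_proper : ∀ b, esrc b ≠ etgt b
  edgeDir_unit : ∀ b, edgeDir b ⬝ᵥ edgeDir b = 1
  edgeDir_dir : ∀ b, ∃ lam : ℝ, 0 < lam ∧ vert (etgt b) - vert (esrc b) = lam • edgeDir b
  edge_two_faces : ∀ b, ∃ c c', edge b ⊆ face c ∧ edge b ⊆ face c' ∧
    crossProduct (Fnormal c) (Fnormal c') ≠ 0
  Cnormal_unit : ∀ a, Cnormal a ⬝ᵥ Cnormal a = 1
  sep_vert : ∀ a, 0 < (vert a - cpt a) ⬝ᵥ Cnormal a
  sep_other : ∀ a a', a' ≠ a → (vert a' - cpt a) ⬝ᵥ Cnormal a < 0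
  cleave_sub : ∀ a a' : Fin nv, ∀ x ∈ Pbar, (x - cpt a) ⬝ᵥ Cnormal a = 0 →
    (x - cpt a') ⬝ᵥ Cnormal a' ≤ 0
  m_ge : ∀ c, 3 ≤ m c
  fvert_per : ∀ c i, fvert c (i + m c) = fvert c i
  fedge_per : ∀ c i, fedge c (i + m c) = fedge c i
  fvert_inj : ∀ c, ∀ i j : ℕ, i < j → j < m c → fvert c i ≠ fvert c j
  fedge_seg : ∀ c i, edge (fedge c i) = segment ℝ (vert (fvert c i)) (vert (fvert c (i + 1)))
  fedge_sub : ∀ c i, edge (fedge c i) ⊆ face c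
  vm_ge : ∀ a, 3 ≤ vm a
  vedge_per : ∀ a i, vedge a (i + vm a) = vedge a i
  vface_per : ∀ a i, vface a (i + vm a) = vface a i
  vedge_inj : ∀ a, ∀ i j : ℕ, i < j → j < vm a → vedge a i ≠ vedge a j
  vedge_mem : ∀ a i, vert a ∈ edge (vedge a i)
  vface_between : ∀ a i, edge (vedge a i) ⊆ face (vface a i) ∧
    edge (vedge a (i + 1)) ⊆ face (vface a i)

namespace PolyCtx

variable (P : PolyCtx)

/-- `P`: the polyhedron `P̄` with its vertices removed. -/
def Pset : Set V3 := P.Pbar \ Set.range P.vert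

/-- The closed half-space `R^a` cut off by the cleaving plane at the vertex `a`. -/
def Rhalf (a : Fin P.nv) : Set V3 := {x | (x - P.cpt a) ⬝ᵥ P.Cnormal a ≤ 0}

/-- The intersection of all the half-spaces `R^a`. -/
def Rall : Set V3 := ⋂ a, P.Rhalf a

/-- The truncated polyhedron `P̂ = P ∩ ⋂ₐ R^a`. -/
def PhatSet : Set V3 := P.Pset ∩ P.Rall

/-- The cleaved face `Ĉ^a = C^a ∩ P`. -/
def Chat (a : Fin P.nv) : Set V3 := {x | (x - P.cpt a) ⬝ᵥ P.Cnormal a = 0} ∩ P.Pset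

/-- The truncated face `F̂^c = F^c ∩ ⋂ₐ R^a`. -/
def Fhat (c : Fin P.nf) : Set V3 := P.face c ∩ P.Rall

/-- The cleaved edge `B̂^{ac} = Ĉ^a ∩ F̂^c`. -/
def Bhat (a : Fin P.nv) (c : Fin P.nf) : Set V3 := P.Chat a ∩ P.Fhat c

/-- The truncated edge `Ê^b = E^b ∩ ⋂ₐ R^a`. -/
def Ehat (b : Fin P.ne) : Set V3 := P.edge b ∩ P.Rall

/-- The boundary `∂Ĉ^a` of the cleaved face: the union of its cleaved edges. -/
def bdChat (a : Fin P.nv) : Set V3 := ⋃ c, P.Bhat a c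

/-- The boundary `∂F̂^c` of the truncated face: its truncated edges and cleaved edges. -/
def bdFhat (c : Fin P.nf) : Set V3 :=
  (⋃ i ∈ Finset.range (P.m c), P.Ehat (P.fedge c i)) ∪
    ⋃ i ∈ Finset.range (P.m c), P.Bhat (P.fvert c i) c

/-- The boundary `∂P̂` of the truncated polyhedron: cleaved faces and truncated faces. -/
def bdPhat : Set V3 := (⋃ a, P.Chat a) ∪ ⋃ c, P.Fhat c

/-- `n ∈ C⁰(P)`: a continuous unit-vector field on `P`, tangent to each face. -/
def MemC0P (n : V3 → V3) : Prop :=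
  ContinuousOn n P.Pset ∧ (∀ x ∈ P.Pset, n x ∈ sphereS) ∧
  ∀ c, ∀ x ∈ P.face c ∩ P.Pset, n x ⬝ᵥ P.Fnormal c = 0

/-- `n ∈ C⁰(P̂)`: a continuous unit-vector field on `P̂`, tangent to each truncated
face `F̂^c` (but not necessarily to the cleaved faces). -/
def MemC0Phat (n : V3 → V3) : Prop :=
  ContinuousOn n P.PhatSet ∧ (∀ x ∈ P.PhatSet, n x ∈ sphereS) ∧
  ∀ c, ∀ x ∈ P.Fhat c, n x ⬝ᵥ P.Fnormal c = 0

/-- Homotopy in `C⁰(P)`. -/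
def HomotopicP (n n' : V3 → V3) : Prop :=
  ∃ H : ℝ → V3 → V3,
    ContinuousOn (fun q : ℝ × V3 => H q.1 q.2) (Set.Icc (0:ℝ) 1 ×ˢ P.Pset) ∧
    (∀ t ∈ Set.Icc (0:ℝ) 1, P.MemC0P (H t)) ∧
    (∀ x ∈ P.Pset, H 0 x = n x) ∧ (∀ x ∈ P.Pset, H 1 x = n' x)

/-- Homotopy in `C⁰(P̂)`. -/
def HomotopicPhat (n n' : V3 → V3) : Prop :=
  ∃ H : ℝ → V3 → V3,
    ContinuousOn (fun q : ℝ × V3 => H q.1 q.2) (Set.Icc (0:ℝ) 1 ×ˢ P.PhatSet) ∧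
    (∀ t ∈ Set.Icc (0:ℝ) 1, P.MemC0Phat (H t)) ∧
    (∀ x ∈ P.PhatSet, H 0 x = n x) ∧ (∀ x ∈ P.PhatSet, H 1 x = n' x)

/-- The edge orientation `e^b(n) = ε`: `n` has the constant value `ε` on `Ê^b`. -/
def IsEdgeOrient (b : Fin P.ne) (n : V3 → V3) (ε : V3) : Prop :=
  ∀ x ∈ P.Ehat b, n x = ε

/-- `z : [0,1] → ℝ³` is a continuous injective parameterization of the cleaved edge
`B̂^{ac}`, positively oriented with respect to the outward normal `F^c` (the face
`F̂^c` lies on the positive side of `F^c × (z 1 - z 0)`). -/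
def IsPosParamSeg (a : Fin P.nv) (c : Fin P.nf) (z : ℝ → V3) : Prop :=
  ContinuousOn z (Set.Icc 0 1) ∧ z '' Set.Icc 0 1 = P.Bhat a c ∧
  Set.InjOn z (Set.Icc 0 1) ∧
  ∀ x ∈ P.Fhat c, 0 ≤ (x - z 0) ⬝ᵥ crossProduct (P.Fnormal c) (z 1 - z 0)

/-- The kink number `k^{ac}(n) = κ`. -/
def HasKink (a : Fin P.nv) (c : Fin P.nf) (n : V3 → V3) (κ : ℤ) : Prop :=
  ∃ z : ℝ → V3, P.IsPosParamSeg a c z ∧ IsKinkAlong (P.Fnormal c) n z κ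

/-- `s ∈ S²` is admissible: not orthogonal to any face normal. -/
def AdmissibleS (s : V3) : Prop := s ∈ sphereS ∧ ∀ c, s ⬝ᵥ P.Fnormal c ≠ 0

/-- The wrapping number `w^a(n) = w`, computed (relative to a Brouwer degree `deg` and
an admissible reference point `s`) as the degree of the map `S² → S²` glued from the
restriction of `n` to the cleaved face `Ĉ^a` and the geodesic contraction of its boundary
values to `-s`, using an interior point `ctr` of `Ĉ^a` and a positively oriented
`2π`-periodic parameterization `z` of `∂Ĉ^a`. -/
def HasWrap (deg : (V3 → V3) → ℤ) (s : V3) (a : Fin P.nv) (n : V3 → V3) (w : ℤ) : Prop :=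
  ∃ ctr z, ctr ∈ P.Chat a ∧ ctr ∉ P.bdChat a ∧
    PosLoopParam (P.Cnormal a) ctr z ∧ Set.range z = P.bdChat a ∧
    deg (wrapMap n z ctr s) = w

/-- `n` and `n'` have the same invariants: equal edge orientations, kink numbers and
wrapping numbers. -/
def SameInv (deg : (V3 → V3) → ℤ) (s : V3) (n n' : V3 → V3) : Prop :=
  (∀ b : Fin P.ne, Set.EqOn n n' (P.Ehat b)) ∧
  (∀ a c, ∀ κ : ℤ, P.HasKink a c n κ ↔ P.HasKink a c n' κ) ∧
  (∀ a, ∀ w : ℤ, P.HasWrap deg s a n w ↔ P.HasWrap deg s a n' w)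

end PolyCtx


/-- Constrained homotopy over a set `X`, pointwise constraint sets `T x`. -/
def Htp {E W : Type*} [TopologicalSpace E] [TopologicalSpace W] (X : Set E) (T : E → Set W)
    (f g : E → W) : Prop :=
  ∃ H : ℝ → E → W, ContinuousOn (fun q : ℝ × E => H q.1 q.2) (Set.Icc (0:ℝ) 1 ×ˢ X) ∧
    (∀ t ∈ Set.Icc (0:ℝ) 1, ∀ x ∈ X, H t x ∈ T x) ∧
    (∀ x ∈ X, H 0 x = f x) ∧ (∀ x ∈ X, H 1 x = g x)

theorem Htp.symm {E W : Type*} [TopologicalSpace E] [TopologicalSpace W] {X : Set E}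
    {T : E → Set W} {f g : E → W} (h : Htp X T f g) : Htp X T g f := by
  obtain ⟨H, h1, h2, h3, h4⟩ := h
  refine ⟨fun t => H (1 - t), ?_, ?_, ?_, ?_⟩
  · have : ContinuousOn (fun q : ℝ × E => ((1 - q.1, q.2) : ℝ × E)) (Set.Icc (0:ℝ) 1 ×ˢ X) := by
      fun_prop
    refine h1.comp this ?_
    rintro ⟨t, x⟩ ⟨ht, hx⟩
    exact ⟨⟨by simp only; linarith [ht.2], by simp only; linarith [ht.1]⟩, hx⟩
  · intro t ht x hx
    exact h2 _ ⟨by linarith [ht.2], by linarith [ht.1]⟩ x hx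
  · intro x hx; simpa using h4 x hx
  · intro x hx; simpa using h3 x hx

theorem Htp.mono {E W : Type*} [TopologicalSpace E] [TopologicalSpace W] {X : Set E}
    {T T' : E → Set W} {f g : E → W} (h : Htp X T f g) (hT : ∀ x ∈ X, T x ⊆ T' x) :
    Htp X T' f g := by
  obtain ⟨H, h1, h2, h3, h4⟩ := h
  exact ⟨H, h1, fun t ht x hx => hT x hx (h2 t ht x hx), h3, h4⟩

theorem Htp.trans {E W : Type*} [TopologicalSpace E] [TopologicalSpace W] {X : Set E}
    {T : E → Set W} {f g k : E → W} (h : Htp X T f g) (h' : Htp X T g k) : Htp X T f k := by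
  obtain ⟨H, h1, h2, h3, h4⟩ := h
  obtain ⟨H', h1', h2', h3', h4'⟩ := h'
  refine ⟨fun t x => if t ≤ 1/2 then H (2*t) x else H' (2*t-1) x, ?_, ?_, ?_, ?_⟩
  · have c1 : ContinuousOn (fun q : ℝ × E => H (2*q.1) q.2) (Set.Icc (0:ℝ) (1/2) ×ˢ X) := by
      have : ContinuousOn (fun q : ℝ × E => ((2*q.1, q.2) : ℝ × E)) (Set.Icc (0:ℝ) (1/2) ×ˢ X) := by
        fun_prop
      refine h1.comp this ?_
      rintro ⟨t, x⟩ ⟨ht, hx⟩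
      exact ⟨⟨by simp only; linarith [ht.1], by simp only; linarith [ht.2]⟩, hx⟩
    have c2 : ContinuousOn (fun q : ℝ × E => H' (2*q.1-1) q.2) (Set.Icc (1/2:ℝ) 1 ×ˢ X) := by
      have : ContinuousOn (fun q : ℝ × E => ((2*q.1-1, q.2) : ℝ × E)) (Set.Icc (1/2:ℝ) 1 ×ˢ X) := by
        fun_prop
      refine h1'.comp this ?_
      rintro ⟨t, x⟩ ⟨ht, hx⟩
      exact ⟨⟨by simp only; linarith [ht.1], by simp only; linarith [ht.2]⟩, hx⟩
    have key : ∀ q ∈ Set.Icc (0:ℝ) 1 ×ˢ X, q.1 = 1/2 → H (2*q.1) q.2 = H' (2*q.1-1) q.2 := by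
      rintro ⟨t, x⟩ ⟨ht, hx⟩ h
      simp only at h hx ⊢
      subst h
      norm_num
      rw [h4 x hx, h3' x hx]
    refine ContinuousOn.if (p := fun q : ℝ × E => q.1 ≤ 1/2) ?_ ?_ ?_
    · rintro q ⟨hq, hf⟩
      refine key q hq ?_
      exact frontier_le_subset_eq continuous_fst continuous_const hf
    · refine c1.mono ?_
      rintro ⟨t, x⟩ ⟨⟨ht, hx⟩, hc⟩
      have : t ≤ 1/2 := by
        have hc' := closure_le_eq (f := fun q : ℝ × E => q.1) (g := fun _ => (1/2:ℝ)) continuous_fst continuous_const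
        rw [hc'] at hc
        exact hc
      exact ⟨⟨ht.1, this⟩, hx⟩
    · refine c2.mono ?_
      rintro ⟨t, x⟩ ⟨⟨ht, hx⟩, hc⟩
      have : (1/2:ℝ) ≤ t := by
        have : {a : ℝ × E | ¬ a.1 ≤ 1/2} = {a | 1/2 < a.1} := by ext; simp
        rw [this] at hc
        exact closure_lt_subset_le continuous_const continuous_fst hc
      exact ⟨⟨this, ht.2⟩, hx⟩
  · intro t ht x hx
    simp only
    split_ifs with h
    · exact h2 _ ⟨by linarith [ht.1], by linarith⟩ x hx
    · exact h2' _ ⟨by push Not at h; linarith, by linarith [ht.2]⟩ x hx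
  · intro x hx; norm_num; exact h3 x hx
  · intro x hx; norm_num; exact h4' x hx

theorem Htp.of_eqOn {E W : Type*} [TopologicalSpace E] [TopologicalSpace W] {X : Set E}
    {T : E → Set W} {f g : E → W} (hf : ContinuousOn f X) (hT : ∀ x ∈ X, f x ∈ T x)
    (h : ∀ x ∈ X, f x = g x) : Htp X T f g :=
  ⟨fun _ => f, hf.comp continuousOn_snd (fun _ hq => hq.2), fun _ _ x hx => hT x hx,
    fun _ _ => rfl, h⟩

/-- Tietze extension, function version. -/
theorem tietze_fun {E Y : Type} [TopologicalSpace E] [NormalSpace E] [TopologicalSpace Y]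
    [TietzeExtension.{0, 0} Y] {X : Set E} (hX : IsClosed X) {f : E → Y} (hf : ContinuousOn f X) :
    ∃ g : E → Y, Continuous g ∧ ∀ x ∈ X, g x = f x := by
  obtain ⟨g, hg⟩ := ContinuousMap.exists_restrict_eq hX ⟨X.domRestrict f, hf.domRestrict⟩
  refine ⟨g, g.continuous, fun x hx => ?_⟩
  have := congrArg (fun k => k ⟨x, hx⟩) hg
  exact this

/-- small steps along a homotopy -/
theorem small_steps {E W : Type*} [PseudoMetricSpace E] [PseudoMetricSpace W] {X : Set E}
    (hX : IsCompact X) {F : ℝ → E → W}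
    (hF : ContinuousOn (fun q : ℝ × E => F q.1 q.2) (Set.Icc (0:ℝ) 1 ×ˢ X)) {ε : ℝ} (hε : 0 < ε) :
    ∃ n : ℕ, 0 < n ∧ ∀ j : ℕ, j < n → ∀ x ∈ X,
      dist (F ((j:ℝ)/n) x) (F (((j+1 : ℕ):ℝ)/n) x) < ε := by
  have hc : IsCompact (Set.Icc (0:ℝ) 1 ×ˢ X) := isCompact_Icc.prod hX
  have hu := hc.uniformContinuousOn_of_continuous hF
  rw [Metric.uniformContinuousOn_iff] at hu
  obtain ⟨δ, hδ, h⟩ := hu ε hε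
  obtain ⟨n, hn⟩ := exists_nat_one_div_lt hδ
  refine ⟨n+1, Nat.succ_pos n, fun j hj x hx => ?_⟩
  have hn1 : (0:ℝ) < (n+1 : ℕ) := by positivity
  have hj' : ((j+1 : ℕ):ℝ) ≤ (n+1 : ℕ) := by exact_mod_cast hj
  have hj0 : (0:ℝ) ≤ j := by positivity
  refine h ((j:ℝ)/(n+1 : ℕ), x) ⟨⟨by positivity, ?_⟩, hx⟩ ((((j+1 : ℕ):ℝ))/(n+1 : ℕ), x)
    ⟨⟨by positivity, ?_⟩, hx⟩ ?_
  · simp only; rw [div_le_one hn1]; push_cast at hj' ⊢; linarith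
  · simp only; rw [div_le_one hn1]; exact hj'
  · rw [Prod.dist_eq]
    simp only [dist_self]
    rw [max_lt_iff]
    refine ⟨?_, hδ⟩
    rw [Real.dist_eq, ← sub_div]
    push_cast
    rw [show (j:ℝ) - (j+1) = -1 by ring, neg_div, abs_neg, abs_of_pos (by positivity)]
    exact hn

/-- Lifting through `exp` over a compact homotopy. -/
theorem exp_lift_htp {E : Type*} [PseudoMetricSpace E] {X : Set E}
    (hX : IsCompact X) {F : ℝ → E → ℂ}
    (hF : ContinuousOn (fun q : ℝ × E => F q.1 q.2) (Set.Icc (0:ℝ) 1 ×ˢ X))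
    (h0 : ∀ t ∈ Set.Icc (0:ℝ) 1, ∀ x ∈ X, F t x ≠ 0)
    (hl : ∃ ψ : E → ℂ, ContinuousOn ψ X ∧ ∀ x ∈ X, F 0 x = Complex.exp (ψ x)) :
    ∃ ψ : E → ℂ, ContinuousOn ψ X ∧ ∀ x ∈ X, F 1 x = Complex.exp (ψ x) := by
  have hc : IsCompact (Set.Icc (0:ℝ) 1 ×ˢ X) := isCompact_Icc.prod hX
  obtain ⟨ε, hε, hlb⟩ : ∃ ε : ℝ, 0 < ε ∧ ∀ t ∈ Set.Icc (0:ℝ) 1, ∀ x ∈ X, ε ≤ ‖F t x‖ := by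
    rcases (Set.Icc (0:ℝ) 1 ×ˢ X).eq_empty_or_nonempty with he | hne
    · refine ⟨1, one_pos, fun t ht x hx => ?_⟩
      have : (t, x) ∈ (Set.Icc (0:ℝ) 1 ×ˢ X) := ⟨ht, hx⟩
      rw [he] at this; exact this.elim
    · obtain ⟨q, hq, hm⟩ := hc.exists_isMinOn hne hF.norm
      exact ⟨‖F q.1 q.2‖, norm_pos_iff.2 (h0 _ hq.1 _ hq.2), fun t ht x hx => isMinOn_iff.1 hm (t, x) ⟨ht, hx⟩⟩
  obtain ⟨n, hn, hs⟩ := small_steps hX hF hε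
  have hnR : (0:ℝ) < n := by exact_mod_cast hn
  have mem : ∀ j : ℕ, j ≤ n → ((j:ℝ)/n) ∈ Set.Icc (0:ℝ) 1 := fun j hj =>
    ⟨by positivity, by rw [div_le_one hnR]; exact_mod_cast hj⟩
  have cs : ∀ t ∈ Set.Icc (0:ℝ) 1, ContinuousOn (F t) X := fun t ht =>
    hF.comp (f := fun x => (t, x)) (by fun_prop) (fun x hx => ⟨ht, hx⟩)
  have main : ∀ j : ℕ, j ≤ n → ∃ ψ : E → ℂ, ContinuousOn ψ X ∧
      ∀ x ∈ X, F ((j:ℝ)/n) x = Complex.exp (ψ x) := by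
    intro j
    induction j with
    | zero => intro _; simpa using hl
    | succ j ih =>
      intro hj
      obtain ⟨ψ, hψ, he⟩ := ih (by omega)
      have hsl : ∀ x ∈ X, F (((j+1 : ℕ):ℝ)/n) x / F ((j:ℝ)/n) x ∈ Complex.slitPlane := by
        intro x hx
        have h1 := hs j (by omega) x hx
        have h2 := hlb _ (mem j (by omega)) x hx
        have h3 : F ((j:ℝ)/n) x ≠ 0 := h0 _ (mem j (by omega)) x hx
        have h4 := Complex.mem_slitPlane_of_norm_lt_one (z := F (((j+1 : ℕ):ℝ)/n) x / F ((j:ℝ)/n) x - 1)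
        rw [add_sub_cancel] at h4
        apply h4
        rw [div_sub_one h3, norm_div, div_lt_one (norm_pos_iff.2 h3), ← dist_eq_norm, dist_comm]
        exact lt_of_lt_of_le h1 h2
      refine ⟨fun x => ψ x + Complex.log (F (((j+1 : ℕ):ℝ)/n) x / F ((j:ℝ)/n) x), ?_, ?_⟩
      · refine hψ.add (ContinuousOn.clog ?_ hsl)
        exact (cs _ (mem _ hj)).div (cs _ (mem _ (by omega))) (fun x hx => h0 _ (mem _ (by omega)) x hx)
      · intro x hx
        have h3 : F ((j:ℝ)/n) x ≠ 0 := h0 _ (mem j (by omega)) x hx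
        rw [Complex.exp_add, ← he x hx, Complex.exp_log (Complex.slitPlane_ne_zero (hsl x hx))]
        field_simp
  have := main n le_rfl
  rwa [div_self hnR.ne'] at this

/-- Lifting through `exp` over a compact convex set. -/
theorem exp_lift_convex {E : Type*} [NormedAddCommGroup E] [NormedSpace ℝ E] {X : Set E}
    (hX : IsCompact X) (hc : Convex ℝ X) {c : E → ℂ} (hcont : ContinuousOn c X)
    (h0 : ∀ x ∈ X, c x ≠ 0) :
    ∃ ψ : E → ℂ, ContinuousOn ψ X ∧ ∀ x ∈ X, c x = Complex.exp (ψ x) := by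
  rcases X.eq_empty_or_nonempty with rfl | ⟨x0, hx0⟩
  · exact ⟨0, by simp, by simp⟩
  have hm : ∀ t ∈ Set.Icc (0:ℝ) 1, ∀ x ∈ X, x0 + t • (x - x0) ∈ X := fun t ht x hx =>
    hc.add_smul_sub_mem hx0 hx ht
  have := exp_lift_htp hX (F := fun t x => c (x0 + t • (x - x0))) ?_ ?_ ?_
  · simpa using this
  · refine hcont.comp (f := fun q : ℝ × E => x0 + q.1 • (q.2 - x0)) (by fun_prop) ?_
    rintro ⟨t, x⟩ ⟨ht, hx⟩; exact hm t ht x hx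
  · intro t ht x hx; exact h0 _ (hm t ht x hx)
  · refine ⟨fun _ => Complex.log (c x0), continuousOn_const, ?_⟩
    intro x hx
    simp [Complex.exp_log (h0 _ hx0)]


/-- normalisation -/
def nrm (v : V3) : V3 := (Real.sqrt (v ⬝ᵥ v))⁻¹ • v

theorem dot_self_pos {v : V3} (h : v ≠ 0) : 0 < v ⬝ᵥ v := by
  have h1 : v ⬝ᵥ v ≠ 0 := fun h' => h (dotProduct_self_eq_zero.1 h')
  have h2 : 0 ≤ v ⬝ᵥ v := by simp only [dotProduct, Fin.sum_univ_three]; nlinarith [sq_nonneg (v 0), sq_nonneg (v 1), sq_nonneg (v 2)]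
  exact lt_of_le_of_ne h2 (Ne.symm h1)

theorem sphere_ne_zero {v : V3} (h : v ∈ sphereS) : v ≠ 0 := by
  rintro rfl
  simp [sphereS] at h

theorem nrm_mem {v : V3} (h : v ≠ 0) : nrm v ∈ sphereS := by
  have h1 := dot_self_pos h
  have h2 := Real.mul_self_sqrt h1.le
  have h3 := Real.sqrt_pos.2 h1
  show (nrm v) ⬝ᵥ (nrm v) = 1
  rw [nrm, smul_dotProduct, dotProduct_smul, smul_eq_mul, smul_eq_mul]
  field_simp
  rw [sq, h2]

theorem nrm_of_mem {v : V3} (h : v ∈ sphereS) : nrm v = v := by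
  have : v ⬝ᵥ v = 1 := h
  simp [nrm, this]

theorem continuous_dot : Continuous (fun q : V3 × V3 => q.1 ⬝ᵥ q.2) := by
  simp only [dotProduct]
  fun_prop

theorem nrm_continuousOn : ContinuousOn nrm {v | v ≠ 0} := by
  unfold nrm
  refine ContinuousOn.smul (f := fun v : V3 => (Real.sqrt (v ⬝ᵥ v))⁻¹) (g := fun v : V3 => v) (ContinuousOn.inv₀ ?_ ?_) continuousOn_id
  · refine Continuous.continuousOn ?_
    exact Real.continuous_sqrt.comp (continuous_dot.comp (continuous_id.prodMk continuous_id))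
  · intro v hv
    exact (Real.sqrt_pos.2 (dot_self_pos hv)).ne'

theorem isClosed_sphereS : IsClosed sphereS := by
  have : sphereS = (fun v : V3 => v ⬝ᵥ v) ⁻¹' {1} := rfl
  rw [this]
  exact isClosed_singleton.preimage (continuous_dot.comp (continuous_id.prodMk continuous_id))

theorem isCompact_sphereS : IsCompact sphereS := by
  refine Metric.isCompact_of_isClosed_isBounded isClosed_sphereS ?_
  refine (Metric.isBounded_closedBall (x := (0:V3)) (r := 1)).subset ?_
  intro v hv
  have hv : v ⬝ᵥ v = 1 := hv
  simp only [dotProduct, Fin.sum_univ_three] at hv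
  rw [mem_closedBall_zero_iff, pi_norm_le_iff_of_nonneg zero_le_one]
  intro i
  rw [Real.norm_eq_abs, ← sq_le_one_iff_abs_le_one]
  fin_cases i <;> simp only [Fin.zero_eta, Fin.mk_one, Fin.reduceFinMk] <;> nlinarith [sq_nonneg (v 0), sq_nonneg (v 1), sq_nonneg (v 2)]

/-- homotopy extension property -/
theorem hep {X K : Set V3} (hX : IsClosed X) (hK : IsClosed K)
    {f : V3 → V3} (hf : ContinuousOn f X) (hfS : ∀ x ∈ X, f x ∈ sphereS) {h : ℝ → V3 → V3}
    (hh : ContinuousOn (fun q : ℝ × V3 => h q.1 q.2) (Set.Icc (0:ℝ) 1 ×ˢ K))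
    (hhS : ∀ t ∈ Set.Icc (0:ℝ) 1, ∀ x ∈ K, h t x ∈ sphereS) (h0 : ∀ x ∈ K, h 0 x = f x) :
    ∃ H : ℝ → V3 → V3, ContinuousOn (fun q : ℝ × V3 => H q.1 q.2) (Set.Icc (0:ℝ) 1 ×ˢ X) ∧
      (∀ t ∈ Set.Icc (0:ℝ) 1, ∀ x ∈ X, H t x ∈ sphereS) ∧ (∀ x ∈ X, H 0 x = f x) ∧
      (∀ t ∈ Set.Icc (0:ℝ) 1, ∀ x ∈ K, H t x = h t x) := by
  have hc1 : IsClosed (({0} : Set ℝ) ×ˢ X) := isClosed_singleton.prod hX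
  have hc2 : IsClosed (Set.Icc (0:ℝ) 1 ×ˢ K) := isClosed_Icc.prod hK
  let G0 : ℝ × V3 → V3 := fun q => if q.2 ∈ K then h q.1 q.2 else f q.2
  have hG1 : ∀ q ∈ (({0} : Set ℝ) ×ˢ X), G0 q = f q.2 := by
    rintro ⟨t, x⟩ ⟨ht, hx⟩
    simp only [mem_singleton_iff] at ht
    subst ht
    simp only [G0]
    split_ifs with hxK
    · exact h0 x hxK
    · rfl
  have hG2 : ∀ q ∈ (Set.Icc (0:ℝ) 1 ×ˢ K), G0 q = h q.1 q.2 := by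
    rintro ⟨t, x⟩ ⟨ht, hx⟩
    simp only at hx
    simp [G0, hx]
  have hG0 : ContinuousOn G0 ((({0} : Set ℝ) ×ˢ X) ∪ (Set.Icc (0:ℝ) 1 ×ˢ K)) := by
    refine ContinuousOn.union_of_isClosed ?_ ?_ hc1 hc2
    · refine ContinuousOn.congr ?_ hG1
      exact hf.comp continuousOn_snd (fun q hq => hq.2)
    · exact hh.congr hG2
  obtain ⟨G, hGc, hG⟩ := tietze_fun (hc1.union hc2) hG0
  let V : Set V3 := {x | ∀ t ∈ Set.Icc (0:ℝ) 1, G (t, x) ≠ 0}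
  have hV : IsOpen V := by
    rw [isOpen_iff_eventually]
    intro x hx
    refine (isCompact_Icc (a := (0:ℝ)) (b := 1)).eventually_forall_of_forall_eventually ?_
    intro t ht
    have := hx t ht
    have h2 : ContinuousAt (fun q : V3 × ℝ => G (q.2, q.1)) (x, t) := by fun_prop
    exact h2.eventually_ne this
  have hKV : K ⊆ V := by
    intro x hx t ht
    rw [hG (t, x) (Or.inr ⟨ht, hx⟩), hG2 (t, x) ⟨ht, hx⟩]
    exact sphere_ne_zero (hhS t ht x hx)
  obtain ⟨lam, hl0, hl1, hl⟩ := exists_continuous_zero_one_of_isClosed (s := Vᶜ) (t := K)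
    hV.isClosed_compl hK (disjoint_compl_left_iff_subset.2 hKV)
  have hne : ∀ t ∈ Set.Icc (0:ℝ) 1, ∀ x ∈ X, G (lam x * t, x) ≠ 0 := by
    intro t ht x hx
    by_cases hxV : x ∈ V
    · refine hxV _ ⟨mul_nonneg (hl x).1 ht.1, ?_⟩
      exact mul_le_one₀ (hl x).2 ht.1 ht.2
    · have : lam x = 0 := hl0 hxV
      rw [this, zero_mul, hG (0, x) (Or.inl ⟨rfl, hx⟩), hG1 (0, x) ⟨rfl, hx⟩]
      exact sphere_ne_zero (hfS x hx)
  refine ⟨fun t x => nrm (G (lam x * t, x)), ?_, ?_, ?_, ?_⟩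
  · refine nrm_continuousOn.comp (f := fun q : ℝ × V3 => G (lam q.2 * q.1, q.2)) ?_ ?_
    · refine Continuous.continuousOn ?_
      fun_prop
    · rintro ⟨t, x⟩ ⟨ht, hx⟩
      exact hne t ht x hx
  · intro t ht x hx
    exact nrm_mem (hne t ht x hx)
  · intro x hx
    simp only
    rw [mul_zero, hG (0, x) (Or.inl ⟨rfl, hx⟩), hG1 (0, x) ⟨rfl, hx⟩]
    exact nrm_of_mem (hfS x hx)
  · intro t ht x hx
    have : lam x = 1 := hl1 hx
    simp only
    rw [this, one_mul, hG (t, x) (Or.inr ⟨ht, hx⟩), hG2 (t, x) ⟨ht, hx⟩]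
    exact nrm_of_mem (hhS t ht x hx)


/-- the quaternions -/
abbrev QQ := Quaternion ℝ

/-- quaternion from coordinates -/
def mkq (a b c d : ℝ) : QQ := ⟨a, b, c, d⟩
@[simp] theorem mkq_re (a b c d : ℝ) : (mkq a b c d).re = a := rfl
@[simp] theorem mkq_imI (a b c d : ℝ) : (mkq a b c d).imI = b := rfl
@[simp] theorem mkq_imJ (a b c d : ℝ) : (mkq a b c d).imJ = c := rfl
@[simp] theorem mkq_imK (a b c d : ℝ) : (mkq a b c d).imK = d := rfl
@[simp] theorem qq_re_one : (1 : QQ).re = 1 := rfl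
@[simp] theorem qq_imI_one : (1 : QQ).imI = 0 := rfl
@[simp] theorem qq_imJ_one : (1 : QQ).imJ = 0 := rfl
@[simp] theorem qq_imK_one : (1 : QQ).imK = 0 := rfl
@[simp] theorem qq_re_zero : (0 : QQ).re = 0 := rfl
@[simp] theorem qq_imI_zero : (0 : QQ).imI = 0 := rfl
@[simp] theorem qq_imJ_zero : (0 : QQ).imJ = 0 := rfl
@[simp] theorem qq_imK_zero : (0 : QQ).imK = 0 := rfl

instance instQQmul : ContinuousMul QQ := inferInstance
instance instQQadd : ContinuousAdd QQ := inferInstance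
instance instQQsub : ContinuousSub QQ := inferInstance
instance instQQsmul : ContinuousSMul ℝ QQ := inferInstance

/-- vectors as imaginary quaternions (third coordinate along `i`) -/
def qv (v : V3) : QQ := mkq 0 (v 2) (v 0) (v 1)
/-- imaginary part as a vector -/
def vq (q : QQ) : V3 := ![q.imJ, q.imK, q.imI]
/-- the unit `i` -/
def qI : QQ := mkq 0 1 0 0

theorem vq_qv (v : V3) : vq (qv v) = v := by
  ext i; fin_cases i <;> rfl

theorem continuous_vq : Continuous vq := by
  unfold vq
  refine continuous_pi (fun i => ?_)
  fin_cases i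
  · exact Quaternion.continuous_imJ
  · exact Quaternion.continuous_imK
  · exact Quaternion.continuous_imI

theorem qv_eq (v : V3) : qv v = (v 2) • mkq 0 1 0 0 + (v 0) • mkq 0 0 1 0 + (v 1) • mkq 0 0 0 1 := by
  ext <;> simp [qv]

theorem continuous_qv : Continuous qv := by
  have : qv = fun v : V3 => (v 2) • mkq 0 1 0 0 + (v 0) • mkq 0 0 1 0 + (v 1) • mkq 0 0 0 1 := funext qv_eq
  rw [this]
  fun_prop

theorem mem_sphereS_iff {v : V3} : v ∈ sphereS ↔ v 0 * v 0 + v 1 * v 1 + v 2 * v 2 = 1 := by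
  simp [sphereS, dotProduct, Fin.sum_univ_three]

theorem qv_sq {v : V3} (h : v ∈ sphereS) : qv v * qv v = -1 := by
  rw [mem_sphereS_iff] at h
  ext <;> simp [qv]
  · linarith
  · ring
  · ring
  · ring

theorem qI_sq : qI * qI = -1 := by
  ext <;> simp [qI]

theorem qI_ne : qI ≠ 0 := by
  intro h
  have := congrArg QuaternionAlgebra.imI h
  simp [qI] at this

theorem of_sq_neg_one {a : QQ} (h : a * a = -1) : qv (vq a) = a ∧ vq a ∈ sphereS := by
  have h0 := congrArg QuaternionAlgebra.re h
  have h1 := congrArg QuaternionAlgebra.imI h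
  have h2 := congrArg QuaternionAlgebra.imJ h
  have h3 := congrArg QuaternionAlgebra.imK h
  simp at h0 h1 h2 h3
  have hr : a.re = 0 := by
    by_contra hne
    have e1 : a.imI = 0 := by
      have : a.re * a.imI = 0 := by linarith
      exact (mul_eq_zero.1 this).resolve_left hne
    have e2 : a.imJ = 0 := by
      have : a.re * a.imJ = 0 := by linarith
      exact (mul_eq_zero.1 this).resolve_left hne
    have e3 : a.imK = 0 := by
      have : a.re * a.imK = 0 := by linarith
      exact (mul_eq_zero.1 this).resolve_left hne
    rw [e1, e2, e3] at h0
    nlinarith [sq_nonneg a.re]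
  constructor
  · ext <;> simp [qv, vq, hr]
  · rw [mem_sphereS_iff]
    simp [vq]
    rw [hr] at h0
    linarith

/-- conjugation action -/
def qact (h : QQ) (v : V3) : V3 := vq (h * qv v * h⁻¹)

theorem qact_spec {h : QQ} (h0 : h ≠ 0) {v : V3} (hv : v ∈ sphereS) :
    qv (qact h v) = h * qv v * h⁻¹ ∧ qact h v ∈ sphereS := by
  have : (h * qv v * h⁻¹) * (h * qv v * h⁻¹) = -1 := by
    calc (h * qv v * h⁻¹) * (h * qv v * h⁻¹) = h * qv v * (h⁻¹ * h) * qv v * h⁻¹ := by simp only [mul_assoc]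
      _ = h * (qv v * qv v) * h⁻¹ := by rw [inv_mul_cancel₀ h0]; simp only [mul_assoc, mul_one]
      _ = -1 := by rw [qv_sq hv]; simp [mul_inv_cancel₀ h0]
  exact of_sq_neg_one this

theorem qact_one (v : V3) : qact 1 v = v := by simp [qact, vq_qv]

theorem qact_continuousOn : ContinuousOn (fun q : QQ × V3 => qact q.1 q.2) {q | q.1 ≠ 0} := by
  unfold qact
  refine continuous_vq.comp_continuousOn ?_
  refine ContinuousOn.mul (ContinuousOn.mul continuousOn_fst (continuous_qv.comp_continuousOn continuousOn_snd)) ?_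
  exact continuousOn_fst.inv₀ (fun q hq => hq)

/-- the step quaternion from `u` to `v` -/
def qstep (u v : V3) : QQ := 1 - qv v * qv u

theorem continuous_qstep : Continuous (fun q : V3 × V3 => qstep q.1 q.2) := by
  unfold qstep
  have := continuous_qv
  fun_prop

theorem qstep_spec {u v : V3} (hu : u ∈ sphereS) (hv : v ∈ sphereS) :
    qv v * qstep u v = qstep u v * qv u := by
  unfold qstep
  rw [mul_sub, sub_mul, ← mul_assoc, qv_sq hv, mul_assoc (qv v), qv_sq hu]
  simp
  abel

theorem qstep_ne {u v : V3} (hv : v ∈ sphereS) (h : u ≠ -v) : qstep u v ≠ 0 := by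
  intro h0
  apply h
  have h1 : qv v * qv u = 1 := (sub_eq_zero.1 h0).symm
  have h2 : qv u = - qv v := by
    have : qv v * (qv v * qv u) = qv v := by rw [h1, mul_one]
    rw [← mul_assoc, qv_sq hv] at this
    rw [← this]; simp
  rw [← vq_qv u, h2]
  ext i; fin_cases i <;> simp [vq, qv]

/-- Lift of a sphere-valued map to the quaternions. -/
def IsLift {E : Type*} [TopologicalSpace E] (f : E → V3) (X : Set E) (U : E → QQ) : Prop :=
  ContinuousOn U X ∧ ∀ x ∈ X, U x ≠ 0 ∧ qv (f x) * U x = U x * qI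

theorem IsLift.eq {E : Type*} [TopologicalSpace E] {f : E → V3} {X : Set E} {U : E → QQ}
    (h : IsLift f X U) {x : E} (hx : x ∈ X) : qv (f x) = U x * qI * (U x)⁻¹ := by
  rw [← (h.2 x hx).2, mul_assoc, mul_inv_cancel₀ (h.2 x hx).1, mul_one]

theorem exists_lift_pt {v : V3} (hv : v ∈ sphereS) : ∃ q : QQ, q ≠ 0 ∧ qv v * q = q * qI := by
  have he : (![0,0,1] : V3) ∈ sphereS := by rw [mem_sphereS_iff]; simp
  have hq : qv ![0,0,1] = qI := by ext <;> simp [qv, qI]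
  by_cases h : (![0,0,1] : V3) = -v
  · refine ⟨mkq 0 0 1 0, ?_, ?_⟩
    · intro h
      have := congrArg QuaternionAlgebra.imJ h
      simp at this
    · have : v = ![0,0,-1] := by
        rw [← neg_neg v, ← h]; ext i; fin_cases i <;> simp
      rw [this]
      ext <;> simp [qv, qI]
  · refine ⟨qstep ![0,0,1] v, qstep_ne hv h, ?_⟩
    rw [qstep_spec he hv, hq]

theorem ne_neg_of_dist {u v : V3} (hu : u ∈ sphereS) (h : dist u v < 1) : u ≠ -v := by
  intro he
  have hv : v = -u := by rw [he, neg_neg]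
  rw [hv, dist_eq_norm, sub_neg_eq_add] at h
  have hb : ∀ i, |u i + u i| < 1 := fun i => lt_of_le_of_lt (norm_le_pi_norm (u+u) i) h
  rw [mem_sphereS_iff] at hu
  have := fun i => abs_lt.1 (hb i)
  nlinarith [this 0, this 1, this 2]

theorem lift_htp {E : Type*} [PseudoMetricSpace E] {X : Set E}
    (hX : IsCompact X) {F : ℝ → E → V3}
    (hF : ContinuousOn (fun q : ℝ × E => F q.1 q.2) (Set.Icc (0:ℝ) 1 ×ˢ X))
    (h0 : ∀ t ∈ Set.Icc (0:ℝ) 1, ∀ x ∈ X, F t x ∈ sphereS)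
    (hl : ∃ U : E → QQ, IsLift (F 0) X U) : ∃ U : E → QQ, IsLift (F 1) X U := by
  obtain ⟨n, hn, hs⟩ := small_steps hX hF one_pos
  have hnR : (0:ℝ) < n := by exact_mod_cast hn
  have mem : ∀ j : ℕ, j ≤ n → ((j:ℝ)/n) ∈ Set.Icc (0:ℝ) 1 := fun j hj =>
    ⟨by positivity, by rw [div_le_one hnR]; exact_mod_cast hj⟩
  have cs : ∀ t ∈ Set.Icc (0:ℝ) 1, ContinuousOn (F t) X := fun t ht =>
    hF.comp (f := fun x => (t, x)) (by fun_prop) (fun x hx => ⟨ht, hx⟩)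
  have main : ∀ j : ℕ, j ≤ n → ∃ U : E → QQ, IsLift (F ((j:ℝ)/n)) X U := by
    intro j
    induction j with
    | zero => intro _; simpa using hl
    | succ j ih =>
      intro hj
      obtain ⟨U, hU, he⟩ := ih (by omega)
      have mj := mem j (by omega)
      have mj' := mem (j+1) hj
      refine ⟨fun x => qstep (F ((j:ℝ)/n) x) (F (((j+1 : ℕ):ℝ)/n) x) * U x, ?_, ?_⟩
      · refine ContinuousOn.mul ?_ hU
        exact continuous_qstep.comp_continuousOn (f := fun x => (F ((j:ℝ)/n) x, F (((j+1 : ℕ):ℝ)/n) x))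
          ((cs _ mj).prodMk (cs _ mj'))
      · intro x hx
        have h1 := hs j (by omega) x hx
        have s1 := h0 _ mj x hx
        have s2 := h0 _ mj' x hx
        refine ⟨mul_ne_zero (qstep_ne s2 (ne_neg_of_dist s1 h1)) (he x hx).1, ?_⟩
        rw [← mul_assoc, qstep_spec s1 s2, mul_assoc, (he x hx).2, mul_assoc]
  have := main n le_rfl
  rwa [div_self hnR.ne'] at this

theorem lift_convex {E : Type*} [NormedAddCommGroup E] [NormedSpace ℝ E] {X : Set E}
    (hX : IsCompact X) (hc : Convex ℝ X) {f : E → V3} (hcont : ContinuousOn f X)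
    (h0 : ∀ x ∈ X, f x ∈ sphereS) : ∃ U : E → QQ, IsLift f X U := by
  rcases X.eq_empty_or_nonempty with rfl | ⟨x0, hx0⟩
  · exact ⟨0, by simp, by simp⟩
  have hm : ∀ t ∈ Set.Icc (0:ℝ) 1, ∀ x ∈ X, x0 + t • (x - x0) ∈ X := fun t ht x hx =>
    hc.add_smul_sub_mem hx0 hx ht
  have := lift_htp hX (F := fun t x => f (x0 + t • (x - x0))) ?_ ?_ ?_
  · simpa using this
  · refine hcont.comp (f := fun q : ℝ × E => x0 + q.1 • (q.2 - x0)) (by fun_prop) ?_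
    rintro ⟨t, x⟩ ⟨ht, hx⟩; exact hm t ht x hx
  · intro t ht x hx; exact h0 _ (hm t ht x hx)
  · obtain ⟨q, hq, hq'⟩ := exists_lift_pt (h0 x0 hx0)
    refine ⟨fun _ => q, continuousOn_const, ?_⟩
    intro x hx
    simp [hq, hq']

/-- complex numbers inside the quaternions -/
theorem commute_qI {q : QQ} (h : q * qI = qI * q) : ∃ c : ℂ, q = Quaternion.coeComplex c := by
  have h2 := congrArg QuaternionAlgebra.imJ h
  have h3 := congrArg QuaternionAlgebra.imK h
  simp [qI] at h2 h3
  refine ⟨⟨q.re, q.imI⟩, ?_⟩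
  ext <;> simp
  · linarith
  · linarith

theorem coeComplex_comm (c : ℂ) : Quaternion.coeComplex c * qI = qI * Quaternion.coeComplex c := by
  ext <;> simp [qI]

theorem continuous_coeComplex : Continuous Quaternion.coeComplex := by
  have : Quaternion.coeComplex = fun c : ℂ => c.re • (1:QQ) + c.im • qI := by
    funext c; ext <;> simp [qI]
  rw [this]
  fun_prop

/-- complex ratio of two quaternions -/
def qrat (L U : QQ) : ℂ := ⟨(L⁻¹ * U).re, (L⁻¹ * U).imI⟩

theorem qrat_spec {v : V3} {L U : QQ} (hL : L ≠ 0) (hU : U ≠ 0) (h1 : qv v * L = L * qI)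
    (h2 : qv v * U = U * qI) : U = L * Quaternion.coeComplex (qrat L U) ∧ qrat L U ≠ 0 := by
  have : (L⁻¹ * U) * qI = qI * (L⁻¹ * U) := by
    rw [mul_assoc, ← h2, ← mul_assoc, ← mul_assoc]
    congr 1
    rw [← mul_right_inj' hL, ← mul_assoc, ← mul_assoc, mul_inv_cancel₀ hL, one_mul, ← h1]
    rw [mul_assoc, mul_inv_cancel₀ hL, mul_one]
  obtain ⟨c, hc⟩ := commute_qI this
  have hq : qrat L U = c := by
    apply Complex.ext <;> simp [qrat, hc]
  have hU' : U = L * Quaternion.coeComplex c := by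
    rw [← hc, ← mul_assoc, mul_inv_cancel₀ hL, one_mul]
  refine ⟨by rw [hq]; exact hU', ?_⟩
  rw [hq]
  rintro rfl
  apply hU
  rw [hU']; simp

theorem qrat_continuousOn {E : Type*} [TopologicalSpace E] {X : Set E} {L U : E → QQ}
    (hL : ContinuousOn L X) (hU : ContinuousOn U X) (h0 : ∀ x ∈ X, L x ≠ 0) :
    ContinuousOn (fun x => qrat (L x) (U x)) X := by
  have h1 : ContinuousOn (fun x => (L x)⁻¹ * U x) X := (hL.inv₀ h0).mul hU
  have h2 : Continuous (fun q : QQ => (⟨q.re, q.imI⟩ : ℂ)) := by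
    have : (fun q : QQ => (⟨q.re, q.imI⟩ : ℂ)) = fun q : QQ => (q.re : ℂ) + (q.imI : ℂ) * Complex.I := by
      funext q; apply Complex.ext <;> simp
    rw [this]
    have := Quaternion.continuous_re
    have := Quaternion.continuous_imI
    fun_prop
  exact h2.comp_continuousOn h1


theorem smooth_approx {X : Set V3} (hX : IsCompact X) {h : V3 → QQ} (hh : ContinuousOn h X)
    {ε : ℝ} (hε : 0 < ε) : ∃ g : V3 → QQ, ContDiff ℝ 1 g ∧ ∀ x ∈ X, ‖g x - h x‖ < ε := by
  have : TietzeExtension.{0,0} QQ := TietzeExtension.of_tvs ℝ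
  obtain ⟨f, hf, hfX⟩ := tietze_fun hX.isClosed hh
  have h1 : UniformContinuousOn f (Metric.cthickening 1 X) :=
    hX.cthickening.uniformContinuousOn_of_continuous hf.continuousOn
  rcases Metric.uniformContinuousOn_iff.mp h1 (ε / 2) (half_pos hε) with ⟨δ, hδ, hfδ⟩
  rcases hf.exists_contDiff_dist_le_of_forall_mem_ball_dist_le (lt_min one_pos hδ) with ⟨g, hgc, hg⟩
  refine ⟨g, hgc.of_le (by exact_mod_cast le_top), fun x hx => ?_⟩
  rw [← hfX x hx, ← dist_eq_norm]
  refine (hg _ _ fun y hy ↦ ?_).trans_lt (half_lt_self hε)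
  rw [Metric.mem_ball, lt_min_iff] at hy
  exact hfδ _ (Metric.mem_cthickening_of_dist_le _ x _ _ hx hy.1.le) _ (Metric.self_subset_cthickening _ hx) hy.2 |>.le

theorem null_htp {X : Set V3} (hX : IsCompact X) {Φ : ℝ × ℝ → V3} (hΦ : ContDiff ℝ 1 Φ)
    (hr : X ⊆ Set.range Φ) {h : V3 → QQ} (hh : ContinuousOn h X) (h0 : ∀ x ∈ X, h x ≠ 0) :
    Htp X (fun x => {q : QQ | q ≠ 0 ∧ (h x = 1 → q = 1)}) h (fun _ => 1) := by
  obtain ⟨ε0, hε0, hlb⟩ : ∃ ε : ℝ, 0 < ε ∧ ∀ x ∈ X, ε ≤ ‖h x‖ := by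
    rcases X.eq_empty_or_nonempty with he | hne
    · refine ⟨1, one_pos, fun x hx => ?_⟩
      rw [he] at hx; exact hx.elim
    · obtain ⟨q, hq, hm⟩ := hX.exists_isMinOn hne hh.norm
      exact ⟨‖h q‖, norm_pos_iff.2 (h0 _ hq), fun x hx => isMinOn_iff.1 hm x hx⟩
  obtain ⟨g, hg, hgh⟩ := smooth_approx hX hh (ε := min ε0 (1/4)) (lt_min hε0 (by norm_num))
  let lam : V3 → ℝ := fun x => min 1 (4 * ‖h x - 1‖)
  have hlamc : ContinuousOn lam X := by
    refine ContinuousOn.inf continuousOn_const ?_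
    exact continuousOn_const.mul (hh.sub continuousOn_const).norm
  have hlam0 : ∀ x, 0 ≤ lam x := fun x => le_min zero_le_one (by positivity)
  have hlam1 : ∀ x, lam x ≤ 1 := fun x => min_le_left _ _
  have hgc : ContinuousOn g X := hg.continuous.continuousOn
  let h1 : V3 → QQ := fun x => h x + lam x • (g x - h x)
  have hh1 : ContinuousOn h1 X := hh.add (hlamc.smul (hgc.sub hh))
  have e1 : ∀ x, h x = 1 → lam x = 0 := by
    intro x hx; simp [lam, hx]
  have small : ∀ t ∈ Set.Icc (0:ℝ) 1, ∀ x ∈ X, h x + (t * lam x) • (g x - h x) ≠ 0 := by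
    intro t ht x hx he
    have a1 := hlb x hx
    have a2 := lt_of_lt_of_le (hgh x hx) (min_le_left _ _)
    have a3 : h x = -((t * lam x) • (g x - h x)) := eq_neg_of_add_eq_zero_left he
    have a4 : ‖h x‖ ≤ ‖g x - h x‖ := by
      rw [a3, norm_neg, norm_smul, Real.norm_eq_abs, abs_of_nonneg (mul_nonneg ht.1 (hlam0 x)), ← a3]
      exact mul_le_of_le_one_left (norm_nonneg _) (mul_le_one₀ ht.2 (hlam0 x) (hlam1 x))
    linarith
  -- stage 1
  have st1 : Htp X (fun x => {q : QQ | q ≠ 0 ∧ (h x = 1 → q = 1)}) h h1 := by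
    refine ⟨fun t x => h x + (t * lam x) • (g x - h x), ?_, ?_, ?_, ?_⟩
    · have s2 : MapsTo (fun q : ℝ × V3 => q.2) (Set.Icc (0:ℝ) 1 ×ˢ X) X := fun q hq => hq.2
      have b1 := hh.comp (continuousOn_snd (s := Set.Icc (0:ℝ) 1 ×ˢ X)) s2
      have b2 := hgc.comp (continuousOn_snd (s := Set.Icc (0:ℝ) 1 ×ˢ X)) s2
      have b3 := hlamc.comp (continuousOn_snd (s := Set.Icc (0:ℝ) 1 ×ˢ X)) s2
      exact b1.add ((continuousOn_fst.mul b3).smul (b2.sub b1))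
    · intro t ht x hx
      refine ⟨small t ht x hx, fun he => ?_⟩
      simp [e1 x he, he]
    · intro x hx; simp
    · intro x hx; simp [h1]
  -- choose b
  have hd : Dense (Set.range (fun p : (ℝ × ℝ) × ℝ => p.2 • g (Φ p.1)))ᶜ := by
    refine ContDiff.dense_compl_range_of_finrank_lt_finrank ?_ ?_
    · exact contDiff_snd.smul (hg.comp (hΦ.comp contDiff_fst))
    · rw [Quaternion.finrank_eq_four]; simp
  obtain ⟨b, hb, hbr⟩ := hd.inter_open_nonempty (Metric.ball (1:QQ) (1/2)) Metric.isOpen_ball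
    ⟨1, Metric.mem_ball_self (by norm_num)⟩
  rw [Metric.mem_ball, dist_eq_norm] at hb
  let N : ℝ → QQ → QQ := fun t u => (1 - t) • u + t • b
  have Nnear : ∀ t ∈ Set.Icc (0:ℝ) 1, ∀ u : QQ, ‖u - 1‖ ≤ 1/2 → N t u ≠ 0 := by
    intro t ht u hu he
    have c1 : N t u - 1 = (1 - t) • (u - 1) + t • (b - 1) := by
      simp only [N]; module
    have c2 : ‖N t u - 1‖ ≤ (1-t) * (1/2) + t * (1/2) := by
      rw [c1]
      refine (norm_add_le _ _).trans ?_
      rw [norm_smul, norm_smul, Real.norm_eq_abs, Real.norm_eq_abs, abs_of_nonneg ht.1, abs_of_nonneg (by linarith [ht.2] : 0 ≤ 1 - t)]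
      have := ht.1; have := ht.2
      gcongr
    rw [he, zero_sub, norm_neg, norm_one] at c2
    linarith
  have Nne : ∀ t ∈ Set.Icc (0:ℝ) 1, ∀ x ∈ X, N t (h1 x) ≠ 0 := by
    intro t ht x hx
    by_cases hc : ‖h x - 1‖ < 1/4
    · refine Nnear t ht _ ?_
      have d1 : h1 x - 1 = (h x - 1) + lam x • (g x - h x) := by simp only [h1]; abel
      have d2 := lt_of_lt_of_le (hgh x hx) (min_le_right _ _)
      have d3 : ‖lam x • (g x - h x)‖ ≤ ‖g x - h x‖ := by
        rw [norm_smul, Real.norm_eq_abs, abs_of_nonneg (hlam0 x)]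
        exact mul_le_of_le_one_left (norm_nonneg _) (hlam1 x)
      rw [d1]
      refine (norm_add_le _ _).trans ?_
      linarith
    · push Not at hc
      have d1 : lam x = 1 := min_eq_left (by linarith)
      have d2 : h1 x = g x := by simp [h1, d1]
      intro he
      rw [d2] at he
      simp only [N] at he
      have hg0 : g x ≠ 0 := by
        have := small 1 (by simp) x hx
        simpa [d1] using this
      by_cases ht0 : t = 0
      · rw [ht0] at he; simp at he; exact hg0 he
      · obtain ⟨p, hp⟩ := hr hx
        apply hbr
        refine ⟨(p, -((1-t)/t)), ?_⟩
        simp only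
        rw [hp]
        have : t • b = -((1-t) • g x) := eq_neg_of_add_eq_zero_right he
        rw [← smul_right_inj ht0, this, smul_smul, ← neg_smul]
        congr 1
        field_simp
  have N1 : ∀ t ∈ Set.Icc (0:ℝ) 1, N t 1 ≠ 0 := fun t ht => Nnear t ht 1 (by simp)
  have hNc : Continuous (fun q : ℝ × QQ => N q.1 q.2) := by
    simp only [N]; fun_prop
  have st2 : Htp X (fun x => {q : QQ | q ≠ 0 ∧ (h x = 1 → q = 1)}) h1 (fun _ => 1) := by
    refine ⟨fun t x => N t (h1 x) * (N t 1)⁻¹, ?_, ?_, ?_, ?_⟩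
    · have s2 : MapsTo (fun q : ℝ × V3 => q.2) (Set.Icc (0:ℝ) 1 ×ˢ X) X := fun q hq => hq.2
      have b1 := hh1.comp (continuousOn_snd (s := Set.Icc (0:ℝ) 1 ×ˢ X)) s2
      refine ContinuousOn.mul ?_ (ContinuousOn.inv₀ ?_ ?_)
      · exact hNc.comp_continuousOn (f := fun q : ℝ × V3 => (q.1, h1 q.2)) (continuousOn_fst.prodMk b1)
      · exact hNc.comp_continuousOn (f := fun q : ℝ × V3 => (q.1, (1:QQ))) (continuousOn_fst.prodMk continuousOn_const)
      · intro q hq; exact N1 _ hq.1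
    · intro t ht x hx
      refine ⟨mul_ne_zero (Nne t ht x hx) (inv_ne_zero (N1 t ht)), fun he => ?_⟩
      have : h1 x = 1 := by simp [h1, e1 x he, he]
      simp only
      rw [this, mul_inv_cancel₀ (N1 t ht)]
    · intro x hx; simp [N]
    · intro x hx
      have := N1 1 (by simp)
      simp only [N] at this ⊢
      simp at this ⊢
      rw [mul_inv_cancel₀ this]
  exact st1.trans st2


theorem periodic_arg {Y : Type*} [TopologicalSpace Y] {f : ℝ → Y} (hf : Continuous f)
    (hp : ∀ φ, f (φ + 2 * Real.pi) = f φ) :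
    ContinuousOn (fun ζ : ℂ => f (Complex.arg ζ)) {ζ | ζ ≠ 0} := by
  have hp' : Function.Periodic f (2 * Real.pi) := hp
  have hc : Continuous (hp'.lift : Real.Angle → Y) := by
    refine continuous_coinduced_dom.mpr ?_
    exact hf
  intro ζ hζ
  have h1 := Complex.continuousAt_arg_coe_angle hζ
  have h2 : ContinuousAt (fun ζ : ℂ => (hp'.lift : Real.Angle → Y) ((Complex.arg ζ : ℝ) : Real.Angle)) ζ :=
    hc.continuousAt.comp h1
  exact h2.continuousWithinAt

/-- Winding decomposition on the circle. -/
theorem winding_circle {c : ℂ → ℂ} (hc : ContinuousOn c {ζ | ‖ζ‖ = 1}) (h0 : ∀ ζ, ‖ζ‖ = 1 → c ζ ≠ 0) :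
    ∃ (m : ℤ) (ψ : ℂ → ℂ), ContinuousOn ψ {ζ | ‖ζ‖ = 1} ∧
      ∀ ζ, ‖ζ‖ = 1 → c ζ = Complex.exp (ψ ζ) * ζ ^ m := by
  have hpi := Real.pi_pos
  have hn : ∀ θ : ℝ, ‖Complex.exp (θ * Complex.I)‖ = 1 := fun θ => Complex.norm_exp_ofReal_mul_I θ
  have hcc : ContinuousOn (fun θ : ℝ => c (Complex.exp (θ * Complex.I))) (Set.Icc (-Real.pi) Real.pi) := by
    refine hc.comp (f := fun θ : ℝ => Complex.exp (θ * Complex.I)) ?_ (fun θ _ => hn θ)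
    fun_prop
  obtain ⟨ψ0, hψ0, he⟩ := exp_lift_convex isCompact_Icc (convex_Icc _ _) hcc
    (fun θ _ => h0 _ (hn θ))
  have e1 : Complex.exp (ψ0 Real.pi) = Complex.exp (ψ0 (-Real.pi)) := by
    rw [← he _ ⟨by linarith, le_rfl⟩, ← he _ ⟨le_rfl, by linarith⟩]
    congr 1
    push_cast
    rw [neg_mul, Complex.exp_neg, Complex.exp_pi_mul_I]
    norm_num
  obtain ⟨m, hm⟩ := Complex.exp_eq_exp_iff_exists_int.1 e1
  let ψ1 : ℝ → ℂ := fun θ => ψ0 θ - m * θ * Complex.I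
  have hψ1 : ContinuousOn ψ1 (Set.Icc (-Real.pi) (-Real.pi + 2 * Real.pi)) := by
    rw [show -Real.pi + 2 * Real.pi = Real.pi by ring]
    refine hψ0.sub ?_
    fun_prop
  have hend : ψ1 (-Real.pi) = ψ1 (-Real.pi + 2 * Real.pi) := by
    rw [show -Real.pi + 2 * Real.pi = Real.pi by ring]
    simp only [ψ1]
    rw [hm]; push_cast; ring
  have : Fact (0 < 2 * Real.pi) := ⟨by positivity⟩
  have hlc := AddCircle.liftIco_continuous (p := 2 * Real.pi) (a := -Real.pi) hend hψ1
  refine ⟨m, fun ζ => AddCircle.liftIco (2 * Real.pi) (-Real.pi) ψ1 ((Complex.arg ζ : ℝ) : Real.Angle), ?_, ?_⟩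
  · intro ζ hζ
    have hz : ζ ≠ 0 := by rintro rfl; simp at hζ
    exact (ContinuousAt.comp (g := AddCircle.liftIco (2 * Real.pi) (-Real.pi) ψ1)
      hlc.continuousAt (Complex.continuousAt_arg_coe_angle hz)).continuousWithinAt
  · intro ζ hζ
    obtain ⟨θ, hθ, hθa⟩ : ∃ θ ∈ Set.Ico (-Real.pi) (-Real.pi + 2 * Real.pi),
        ((θ : ℝ) : Real.Angle) = (Complex.arg ζ : ℝ) ∧ Complex.exp (θ * Complex.I) = ζ := by
      have hz : Complex.exp (Complex.arg ζ * Complex.I) = ζ := by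
        have := Complex.norm_mul_exp_arg_mul_I ζ
        rwa [hζ, Complex.ofReal_one, one_mul] at this
      rcases eq_or_lt_of_le (Complex.arg_le_pi ζ) with h | h
      · refine ⟨-Real.pi, ⟨le_rfl, by linarith⟩, ?_, ?_⟩
        · rw [h]; exact Real.Angle.neg_coe_pi
        · rw [← hz, h]; push_cast
          rw [neg_mul, Complex.exp_neg, Complex.exp_pi_mul_I]
          norm_num
      · exact ⟨Complex.arg ζ, ⟨(Complex.neg_pi_lt_arg ζ).le, by linarith⟩, rfl, hz⟩
    simp only
    rw [← hθa.1]
    have l1 : AddCircle.liftIco (2 * Real.pi) (-Real.pi) ψ1 ((θ : ℝ) : Real.Angle) = ψ1 θ :=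
      AddCircle.liftIco_coe_apply hθ
    rw [l1]
    have h3 := he θ ⟨hθ.1, by linarith [hθ.2]⟩
    simp only [hθa.2] at h3
    have h4 : ζ ^ m = Complex.exp (m * θ * Complex.I) := by
      rw [← hθa.2, ← Complex.exp_int_mul]; congr 1; ring
    rw [h3, h4, ← Complex.exp_add]
    simp only [ψ1]
    congr 1; ring

/-- The planar complex coordinate. -/
def zeta (x : V3) : ℂ := (x 0 : ℂ) + (x 1 : ℂ) * Complex.I

theorem continuous_zeta : Continuous zeta := by
  unfold zeta; fun_prop

/-- power keeping the norm -/
def zpw (k : ℤ) (ζ : ℂ) : ℂ := if ζ = 0 then 0 else (‖ζ‖ : ℂ) * (ζ / (‖ζ‖ : ℂ)) ^ k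

theorem norm_zpw (k : ℤ) (ζ : ℂ) : ‖zpw k ζ‖ = ‖ζ‖ := by
  unfold zpw
  split_ifs with h
  · simp [h]
  · have : ‖ζ‖ ≠ 0 := norm_ne_zero_iff.2 h
    simp [norm_zpow, this]

theorem continuous_zpw (k : ℤ) : Continuous (zpw k) := by
  rw [continuous_iff_continuousAt]
  intro ζ
  by_cases h : ζ = 0
  · subst h
    have h0 : zpw k 0 = 0 := by simp [zpw]
    rw [ContinuousAt, h0, tendsto_zero_iff_norm_tendsto_zero]
    simp only [norm_zpw]
    have : Filter.Tendsto (fun z : ℂ => ‖z‖) (nhds 0) (nhds ‖(0:ℂ)‖) := continuous_norm.continuousAt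
    simpa using this
  · have hn : (‖ζ‖ : ℂ) ≠ 0 := by exact_mod_cast norm_ne_zero_iff.2 h
    have h1 : ContinuousAt (fun ζ : ℂ => (‖ζ‖ : ℂ) * (ζ / (‖ζ‖ : ℂ)) ^ k) ζ := by
      have a : ContinuousAt (fun ζ : ℂ => (‖ζ‖ : ℂ)) ζ := by fun_prop
      refine a.mul (ContinuousAt.zpow₀ (continuousAt_id.div a hn) k (Or.inl (div_ne_zero h hn)))
    refine h1.congr ?_
    filter_upwards [isOpen_ne.mem_nhds h] with z hz
    simp [zpw, hz]

theorem powMap_eq (k : ℤ) (x : V3) : powMap k x = ![(zpw k (zeta x)).re, (zpw k (zeta x)).im, x 2] := by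
  unfold powMap zpw zeta
  split_ifs with h
  · have h0 := congrArg Complex.re h
    have h1 := congrArg Complex.im h
    simp at h0 h1
    ext i; fin_cases i <;> simp [h0, h1]
  · ext i; fin_cases i <;> simp

theorem zeta_norm_sq (x : V3) : ‖zeta x‖ ^ 2 = x 0 * x 0 + x 1 * x 1 := by
  rw [← Complex.normSq_eq_norm_sq]; simp [zeta, Complex.normSq_apply]

/-- sphere parametrization -/
def sphPhi (p : ℝ × ℝ) : V3 := ![Real.cos p.1 * Real.cos p.2, Real.cos p.1 * Real.sin p.2, Real.sin p.1]

theorem contDiff_sphPhi : ContDiff ℝ 1 sphPhi := by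
  rw [contDiff_pi]
  intro i
  fin_cases i
  · show ContDiff ℝ 1 (fun p : ℝ × ℝ => Real.cos p.1 * Real.cos p.2)
    fun_prop
  · show ContDiff ℝ 1 (fun p : ℝ × ℝ => Real.cos p.1 * Real.sin p.2)
    fun_prop
  · show ContDiff ℝ 1 (fun p : ℝ × ℝ => Real.sin p.1)
    fun_prop

theorem sphereS_subset_range : sphereS ⊆ Set.range sphPhi := by
  intro x hx
  have hx' := mem_sphereS_iff.1 hx
  have hz := zeta_norm_sq x
  have hb1 : -1 ≤ x 2 := by nlinarith [mul_self_nonneg (x 0), mul_self_nonneg (x 1)]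
  have hb2 : x 2 ≤ 1 := by nlinarith [mul_self_nonneg (x 0), mul_self_nonneg (x 1)]
  have h2 : Real.cos (Real.arcsin (x 2)) = ‖zeta x‖ := by
    rw [Real.cos_arcsin, ← Real.sqrt_sq (norm_nonneg (zeta x)), hz]
    congr 1; linarith
  refine ⟨(Real.arcsin (x 2), Complex.arg (zeta x)), ?_⟩
  have e1 := Complex.norm_mul_cos_arg (zeta x)
  have e2 := Complex.norm_mul_sin_arg (zeta x)
  have e3 := Real.sin_arcsin hb1 hb2
  unfold sphPhi
  simp only [h2, e1, e2, e3]
  ext i; fin_cases i <;> simp [zeta]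

theorem deg_of_lifts {deg : (V3 → V3) → ℤ} (hdeg : DegreeTheory deg) {F : V3 → V3}
    (hF : ContinuousOn F sphereS) (hFS : Set.MapsTo F sphereS sphereS) {U L : V3 → QQ}
    (hU : IsLift F (sphereS ∩ {x | 0 ≤ x 2}) U) (hL : IsLift F (sphereS ∩ {x | x 2 ≤ 0}) L)
    {ψ : V3 → ℂ} (hψ : ContinuousOn ψ (sphereS ∩ {x | x 2 = 0})) {m : ℤ}
    (hUL : ∀ x ∈ sphereS ∩ {x | x 2 = 0},
      U x = L x * Quaternion.coeComplex (Complex.exp (ψ x) * (zeta x) ^ m)) :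
    deg F = -m := by
  have c2 : Continuous (fun x : V3 => x 2) := by fun_prop
  have clU : IsClosed (sphereS ∩ {x : V3 | 0 ≤ x 2}) := isClosed_sphereS.inter (isClosed_le continuous_const c2)
  have clL : IsClosed (sphereS ∩ {x : V3 | x 2 ≤ 0}) := isClosed_sphereS.inter (isClosed_le c2 continuous_const)
  have clE : IsClosed (sphereS ∩ {x : V3 | x 2 = 0}) := isClosed_sphereS.inter (isClosed_eq c2 continuous_const)
  obtain ⟨ψ', hψ', hψe⟩ := tietze_fun clE hψ
  let a : V3 → ℝ := fun x => (zpw (-m) (zeta x)).re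
  let b : V3 → ℝ := fun x => (zpw (-m) (zeta x)).im
  have hab : ∀ x ∈ sphereS, a x * a x + b x * b x + x 2 * x 2 = 1 := by
    intro x hx
    have h1 := norm_zpw (-m) (zeta x)
    have h2 := zeta_norm_sq x
    rw [← h1, ← Complex.normSq_eq_norm_sq, Complex.normSq_apply] at h2
    have := mem_sphereS_iff.1 hx
    simp only [a, b]; linarith
  have hca : Continuous a := Complex.continuous_re.comp ((continuous_zpw _).comp continuous_zeta)
  have hcb : Continuous b := Complex.continuous_im.comp ((continuous_zpw _).comp continuous_zeta)
  have hmk : ∀ p q r s : V3 → ℝ, Continuous p → Continuous q → Continuous r → Continuous s →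
      Continuous (fun x => mkq (p x) (q x) (r x) (s x)) := by
    intro p q r s hp hq hr hs
    have : (fun x => mkq (p x) (q x) (r x) (s x)) = fun x => p x • mkq 1 0 0 0 + q x • mkq 0 1 0 0 +
        r x • mkq 0 0 1 0 + s x • mkq 0 0 0 1 := by
      funext x; ext <;> simp
    rw [this]; fun_prop
  let uG : V3 → QQ := fun x => mkq (1 + x 2) 0 (-(b x)) (a x)
  let lG : V3 → QQ := fun x => mkq (-(b x)) (a x) (1 - x 2) 0
  have huGc : Continuous uG := hmk _ _ _ _ (by fun_prop) continuous_const hcb.neg hca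
  have hlGc : Continuous lG := hmk _ _ _ _ hcb.neg hca (by fun_prop) continuous_const
  let G : V3 → V3 := powMap (-m)
  have hG : ∀ x, G x = ![a x, b x, x 2] := fun x => powMap_eq _ x
  have huG : ∀ x ∈ sphereS, qv (G x) * uG x = uG x * qI := by
    intro x hx
    have := hab x hx
    rw [hG]
    ext <;> simp [qv, uG, qI] <;> first | ring1 | linear_combination this | linear_combination -this
  have hlG : ∀ x ∈ sphereS, qv (G x) * lG x = lG x * qI := by
    intro x hx
    have := hab x hx
    rw [hG]
    ext <;> simp [qv, lG, qI] <;> first | ring1 | linear_combination this | linear_combination -this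
  have huG0 : ∀ x, 0 ≤ x 2 → uG x ≠ 0 := by
    intro x hx h
    have := congrArg (fun q : QQ => q.re) h
    simp [uG] at this; linarith
  have hlG0 : ∀ x, x 2 ≤ 0 → lG x ≠ 0 := by
    intro x hx h
    have := congrArg (fun q : QQ => q.imJ) h
    simp [lG] at this; linarith
  have hE : ∀ x ∈ sphereS ∩ {x | x 2 = 0}, uG x = lG x * Quaternion.coeComplex (-Complex.I * (zeta x) ^ m) := by
    rintro x ⟨hx, hx2⟩
    have hx2 : x 2 = 0 := hx2
    have h2 := zeta_norm_sq x
    have := mem_sphereS_iff.1 hx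
    rw [hx2] at this
    have hn : ‖zeta x‖ = 1 := by
      have : ‖zeta x‖ ^ 2 = 1 := by linarith
      nlinarith [norm_nonneg (zeta x)]
    have hz : zeta x ≠ 0 := by intro h; simp [h] at hn
    have hzp : zpw (-m) (zeta x) = ((zeta x) ^ m)⁻¹ := by simp [zpw, hz, hn]
    have hnm : ‖(zeta x) ^ m‖ = 1 := by simp [norm_zpow, hn]
    rw [Complex.inv_eq_conj hnm] at hzp
    have ha : ((zeta x) ^ m).re = a x := by simp only [a, hzp]; exact (Complex.conj_re _).symm
    have hb : ((zeta x) ^ m).im = -b x := by simp only [b, hzp]; rw [Complex.conj_im, neg_neg]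
    have hc : Quaternion.coeComplex (-Complex.I * (zeta x) ^ m) = mkq (-b x) (-a x) 0 0 := by
      ext <;> simp [ha, hb]
    have h3 := hab x hx
    rw [hc]
    ext <;> simp [uG, lG, hx2] <;> first | ring1 | (rw [hx2] at h3; linear_combination h3) | (rw [hx2] at h3; linear_combination -h3)
  let h : V3 → QQ := fun x => if 0 ≤ x 2 then
    uG x * Quaternion.coeComplex (Complex.I * Complex.exp (ψ' x)) * (U x)⁻¹ else lG x * (L x)⁻¹
  have hup : ∀ x, 0 ≤ x 2 → h x = uG x * Quaternion.coeComplex (Complex.I * Complex.exp (ψ' x)) * (U x)⁻¹ :=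
    fun x hx => if_pos hx
  have hlow : ∀ x ∈ sphereS, x 2 ≤ 0 → h x = lG x * (L x)⁻¹ := by
    intro x hxs hx
    by_cases h0 : 0 ≤ x 2
    · have h0 : x 2 = 0 := le_antisymm hx h0
      have hm : x ∈ sphereS ∩ {x : V3 | x 2 = 0} := ⟨hxs, h0⟩
      rw [hup x h0.ge, hUL x hm, hE x hm, hψe x hm, _root_.mul_inv_rev]
      have hz : zeta x ≠ 0 := by
        intro hz
        have h2 := zeta_norm_sq x
        have := mem_sphereS_iff.1 hxs
        rw [hz, norm_zero] at h2; rw [h0] at this; linarith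
      have hc0 : Complex.exp (ψ x) * zeta x ^ m ≠ 0 := mul_ne_zero (Complex.exp_ne_zero _) (zpow_ne_zero _ hz)
      have hq0 : Quaternion.coeComplex (Complex.exp (ψ x) * zeta x ^ m) ≠ 0 := by
        intro hh; apply hc0
        have e1 := congrArg (fun q : QQ => q.re) hh
        have e2 := congrArg (fun q : QQ => q.imI) hh
        apply Complex.ext
        · simpa using e1
        · simpa using e2
      have : Quaternion.coeComplex (-Complex.I * (zeta x) ^ m) * Quaternion.coeComplex (Complex.I * Complex.exp (ψ x))
          = Quaternion.coeComplex (Complex.exp (ψ x) * zeta x ^ m) := by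
        rw [← Quaternion.coeComplex_mul]; congr 1
        linear_combination (-(zeta x ^ m) * Complex.exp (ψ x)) * Complex.I_mul_I
      rw [mul_assoc (lG x), this, mul_assoc (lG x), mul_inv_cancel_left₀ hq0]
    · exact if_neg h0
  have hcc : ∀ c : ℂ, c ≠ 0 → (Quaternion.coeComplex c : QQ) ≠ 0 := by
    intro c hc hh; apply hc
    have e1 := congrArg (fun q : QQ => q.re) hh
    have e2 := congrArg (fun q : QQ => q.imI) hh
    apply Complex.ext
    · simpa using e1
    · simpa using e2
  have hun : sphereS = (sphereS ∩ {x : V3 | 0 ≤ x 2}) ∪ (sphereS ∩ {x : V3 | x 2 ≤ 0}) := by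
    ext x; constructor
    · intro hx; rcases le_total 0 (x 2) with h | h
      · exact Or.inl ⟨hx, h⟩
      · exact Or.inr ⟨hx, h⟩
    · rintro (h | h) <;> exact h.1
  have hhc : ContinuousOn h sphereS := by
    rw [hun]
    refine ContinuousOn.union_of_isClosed ?_ ?_ clU clL
    · refine ContinuousOn.congr ?_ (fun x hx => hup x hx.2)
      refine ContinuousOn.mul (ContinuousOn.mul huGc.continuousOn ?_) ?_
      · exact (continuous_coeComplex.comp (continuous_const.mul (Complex.continuous_exp.comp hψ'))).continuousOn
      · exact hU.1.inv₀ (fun x hx => (hU.2 x hx).1)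
    · refine ContinuousOn.congr ?_ (fun x hx => hlow x hx.1 hx.2)
      exact hlGc.continuousOn.mul (hL.1.inv₀ (fun x hx => (hL.2 x hx).1))
  have hprop : ∀ x ∈ sphereS, h x ≠ 0 ∧ h x * qv (F x) = qv (G x) * h x := by
    intro x hx
    rcases le_total 0 (x 2) with h2 | h2
    · obtain ⟨u0, u1⟩ := hU.2 x ⟨hx, h2⟩
      have u2 := IsLift.eq hU (x := x) ⟨hx, h2⟩
      rw [hup x h2]
      have hc0 := hcc (Complex.I * Complex.exp (ψ' x)) (mul_ne_zero Complex.I_ne_zero (Complex.exp_ne_zero _))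
      refine ⟨mul_ne_zero (mul_ne_zero (huG0 x h2) hc0) (inv_ne_zero u0), ?_⟩
      rw [u2]
      have e := huG x hx
      have c := coeComplex_comm (Complex.I * Complex.exp (ψ' x))
      generalize Quaternion.coeComplex (Complex.I * Complex.exp (ψ' x)) = k at *
      calc uG x * k * (U x)⁻¹ * (U x * qI * (U x)⁻¹) = uG x * k * ((U x)⁻¹ * U x) * qI * (U x)⁻¹ := by
            simp only [mul_assoc]
        _ = uG x * (k * qI) * (U x)⁻¹ := by rw [inv_mul_cancel₀ u0]; simp only [mul_assoc, one_mul, mul_one]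
        _ = (uG x * qI) * k * (U x)⁻¹ := by rw [c]; simp only [mul_assoc]
        _ = _ := by rw [← e]; simp only [mul_assoc]
    · obtain ⟨u0, u1⟩ := hL.2 x ⟨hx, h2⟩
      have u2 := IsLift.eq hL (x := x) ⟨hx, h2⟩
      rw [hlow x hx h2]
      refine ⟨mul_ne_zero (hlG0 x h2) (inv_ne_zero u0), ?_⟩
      rw [u2]
      have e := hlG x hx
      calc lG x * (L x)⁻¹ * (L x * qI * (L x)⁻¹) = lG x * ((L x)⁻¹ * L x) * qI * (L x)⁻¹ := by
            simp only [mul_assoc]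
        _ = (lG x * qI) * (L x)⁻¹ := by rw [inv_mul_cancel₀ u0]; simp only [mul_assoc, mul_one]
        _ = _ := by rw [← e]; simp only [mul_assoc]
  have hGc : Continuous G := by
    have : G = fun x => ![a x, b x, x 2] := funext hG
    rw [this]
    refine continuous_pi fun i => ?_
    fin_cases i
    · exact hca
    · exact hcb
    · exact c2
  have hGS : Set.MapsTo G sphereS sphereS := by
    intro x hx
    rw [mem_sphereS_iff, hG]
    simpa using hab x hx
  obtain ⟨K, hK, hKT, hK0, hK1⟩ := null_htp isCompact_sphereS contDiff_sphPhi sphereS_subset_range hhc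
    (fun x hx => (hprop x hx).1)
  have hsph : SphHomotopic G F := by
    refine ⟨fun t x => qact (K t x) (F x), ?_, ?_, ?_, ?_⟩
    · refine qact_continuousOn.comp (f := fun q : ℝ × V3 => (K q.1 q.2, F q.2)) ?_ ?_
      · exact hK.prodMk (hF.comp continuousOn_snd (fun q hq => hq.2))
      · intro q hq
        exact (hKT q.1 hq.1 q.2 hq.2).1
    · intro t ht x hx
      exact (qact_spec (hKT t ht x hx).1 (hFS hx)).2
    · intro x hx
      simp only
      rw [hK0 x hx, qact]
      rw [(hprop x hx).2, mul_assoc, mul_inv_cancel₀ (hprop x hx).1, mul_one, vq_qv]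
    · intro x hx
      simp only
      rw [hK1 x hx, qact_one]
  rw [← hdeg.1 G F hGc.continuousOn hGS hF hFS hsph, hdeg.2]


namespace PolyCtx
variable (P : PolyCtx)

/-- The affine function defining the cleaving plane. -/
def cf (a : Fin P.nv) (x : V3) : ℝ := (x - P.cpt a) ⬝ᵥ P.Cnormal a

theorem continuous_cf (a) : Continuous (P.cf a) := by
  unfold cf; simp only [dotProduct, Fin.sum_univ_three]; fun_prop

theorem continuous_dotc (N : V3) : Continuous (fun x : V3 => x ⬝ᵥ N) := by
  simp only [dotProduct, Fin.sum_univ_three]; fun_prop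

theorem cf_comb (a) (x y : V3) (t : ℝ) : P.cf a (x + t • (y - x)) = P.cf a x + t * (P.cf a y - P.cf a x) := by
  simp [cf, dotProduct, Fin.sum_univ_three]; ring

theorem vert_mem (a) : P.vert a ∈ P.Pbar := by
  rw [P.hull]; exact subset_convexHull _ _ ⟨a, rfl⟩

theorem cf_self (a) : 0 < P.cf a (P.vert a) := P.sep_vert a
theorem cf_other {a a'} (h : a' ≠ a) : P.cf a (P.vert a') < 0 := P.sep_other a a' h

theorem mem_Rall {x} : x ∈ P.Rall ↔ ∀ a, P.cf a x ≤ 0 := by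
  simp [Rall, Rhalf, cf]

theorem vert_not_Rall (a) : P.vert a ∉ P.Rall := by
  rw [mem_Rall]; push Not; exact ⟨a, P.cf_self a⟩

theorem Phat_eq : P.PhatSet = P.Pbar ∩ P.Rall := by
  ext x; constructor
  · rintro ⟨h1, h2⟩; exact ⟨h1.1, h2⟩
  · rintro ⟨h1, h2⟩
    refine ⟨⟨h1, ?_⟩, h2⟩
    rintro ⟨a, rfl⟩; exact P.vert_not_Rall a h2

theorem mem_Chat {a x} : x ∈ P.Chat a ↔ x ∈ P.Pbar ∧ P.cf a x = 0 := by
  constructor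
  · rintro ⟨h1, h2⟩; exact ⟨h2.1, h1⟩
  · rintro ⟨h1, h2⟩
    refine ⟨h2, h1, ?_⟩
    rintro ⟨a', rfl⟩
    by_cases h : a' = a
    · subst h; exact (P.cf_self a').ne' h2
    · exact (P.cf_other h).ne h2

theorem Chat_Rall {a x} (h : x ∈ P.Chat a) : x ∈ P.Rall := by
  rw [mem_Rall]; intro a'
  rw [mem_Chat] at h
  exact P.cleave_sub a a' x h.1 h.2

theorem Chat_sub (a) : P.Chat a ⊆ P.PhatSet := by
  intro x h; rw [Phat_eq]; exact ⟨(P.mem_Chat.1 h).1, P.Chat_Rall h⟩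

theorem face_sub (c) : P.face c ⊆ P.Pbar := by rw [P.face_def]; exact fun x h => h.1

theorem mem_face {c x} : x ∈ P.face c ↔ x ∈ P.Pbar ∧ x ⬝ᵥ P.Fnormal c = P.foffset c := by
  rw [P.face_def]; rfl

theorem Fhat_sub (c) : P.Fhat c ⊆ P.PhatSet := by
  intro x h; rw [Phat_eq]; exact ⟨P.face_sub c h.1, h.2⟩

theorem isClosed_Rall : IsClosed P.Rall := by
  have : P.Rall = ⋂ a, {x | P.cf a x ≤ 0} := rfl
  rw [this]
  exact isClosed_iInter fun a => isClosed_le (P.continuous_cf a) continuous_const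

theorem convex_Rall : Convex ℝ P.Rall := by
  intro x hx y hy s t hs ht hst
  rw [mem_Rall] at *
  intro a
  have : s • x + t • y = x + t • (y - x) := by
    rw [show s = 1 - t by linarith]; module
  rw [this, cf_comb]
  nlinarith [hx a, hy a]

theorem isCompact_Phat : IsCompact P.PhatSet := by
  rw [Phat_eq]; exact P.compact.inter_right P.isClosed_Rall

theorem convex_Phat : Convex ℝ P.PhatSet := by
  rw [Phat_eq]; exact P.convex.inter P.convex_Rall

theorem isCompact_face (c) : IsCompact (P.face c) := by
  have : P.face c = P.Pbar ∩ {x | x ⬝ᵥ P.Fnormal c = P.foffset c} := by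
    ext x; exact P.mem_face
  rw [this]
  exact P.compact.inter_right (isClosed_eq (continuous_dotc _) continuous_const)

theorem convex_face (c) : Convex ℝ (P.face c) := by
  intro x hx y hy s t hs ht hst
  rw [mem_face] at *
  refine ⟨P.convex hx.1 hy.1 hs ht hst, ?_⟩
  rw [add_dotProduct, smul_dotProduct, smul_dotProduct, hx.2, hy.2, ← add_smul, hst, one_smul]

theorem isCompact_Fhat (c) : IsCompact (P.Fhat c) := (P.isCompact_face c).inter_right P.isClosed_Rall
theorem convex_Fhat (c) : Convex ℝ (P.Fhat c) := (P.convex_face c).inter P.convex_Rall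

theorem Chat_eq (a) : P.Chat a = P.Pbar ∩ {x | P.cf a x = 0} := by
  ext x; exact P.mem_Chat

theorem isCompact_Chat (a) : IsCompact (P.Chat a) := by
  rw [Chat_eq]
  exact P.compact.inter_right (isClosed_eq (P.continuous_cf a) continuous_const)

theorem convex_Chat (a) : Convex ℝ (P.Chat a) := by
  intro x hx y hy s t hs ht hst
  rw [mem_Chat] at *
  refine ⟨P.convex hx.1 hy.1 hs ht hst, ?_⟩
  have : s • x + t • y = x + t • (y - x) := by
    rw [show s = 1 - t by linarith]; module
  rw [this, cf_comb, hx.2, hy.2]; ring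

theorem mem_bdChat {a x} : x ∈ P.bdChat a ↔ x ∈ P.Chat a ∧ x ∈ frontier P.Pbar := by
  rw [P.frontier_eq]
  simp only [bdChat, Bhat, Fhat, mem_iUnion]
  constructor
  · rintro ⟨c, h1, h2⟩; exact ⟨h1, c, h2.1⟩
  · rintro ⟨h1, c, h2⟩; exact ⟨c, h1, h2, P.Chat_Rall h1⟩

theorem isCompact_bdChat (a) : IsCompact (P.bdChat a) := by
  have : P.bdChat a = P.Chat a ∩ frontier P.Pbar := by ext x; exact P.mem_bdChat
  rw [this]; exact (P.isCompact_Chat a).inter_right isClosed_frontier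

theorem bdChat_sub (a) : P.bdChat a ⊆ P.Chat a := fun _ h => (P.mem_bdChat.1 h).1

theorem mem_interior_of {x} (h : x ∈ P.Pbar) (h2 : x ∉ frontier P.Pbar) : x ∈ interior P.Pbar := by
  by_contra h3
  exact h2 ⟨subset_closure h, h3⟩

theorem not_frontier {x} (h : x ∈ interior P.Pbar) : x ∉ frontier P.Pbar := fun h2 => h2.2 h

theorem ctr_interior {a x} (h : x ∈ P.Chat a) (h2 : x ∉ P.bdChat a) : x ∈ interior P.Pbar :=
  P.mem_interior_of (P.mem_Chat.1 h).1 fun h3 => h2 (P.mem_bdChat.2 ⟨h, h3⟩)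

theorem closure_interior : closure (interior P.Pbar) = P.Pbar := by
  rw [P.convex.closure_interior_eq_closure_of_nonempty_interior P.int_nonempty, P.compact.isClosed.closure_eq]

/-- interior point near the vertex -/
theorem near_vert (a) : ∃ x ∈ interior P.Pbar, 0 < P.cf a x ∧ ∀ a', a' ≠ a → P.cf a' x < 0 := by
  have h : P.vert a ∈ closure (interior P.Pbar) := by rw [closure_interior]; exact P.vert_mem a
  rw [mem_closure_iff] at h
  have ho : IsOpen ({x | 0 < P.cf a x} ∩ ⋂ a' : {a' // a' ≠ a}, {x | P.cf a'.1 x < 0}) :=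
    (isOpen_lt continuous_const (P.continuous_cf a)).inter
      (isOpen_iInter_of_finite fun a' => isOpen_lt (P.continuous_cf _) continuous_const)
  obtain ⟨x, hx1, hx2⟩ := h _ ho ⟨P.cf_self a, mem_iInter.2 fun a' => P.cf_other (Ne.symm a'.2)⟩
  exact ⟨x, hx2, hx1.1, fun a' ha' => mem_iInter.1 hx1.2 ⟨a', ha'⟩⟩

theorem nv_pos : 0 < P.nv := by
  by_contra h
  obtain ⟨x, hx⟩ := P.int_nonempty
  have h1 := interior_subset hx
  rw [P.hull] at h1
  have : IsEmpty (Fin P.nv) := by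
    have : P.nv = 0 := by omega
    rw [this]; infer_instance
  rw [Set.range_eq_empty, convexHull_empty] at h1; exact h1

theorem fvert_distinct (c i) : P.fvert c i ≠ P.fvert c (i+1) ∧ P.fvert c (i+1) ≠ P.fvert c (i+2) ∧
    P.fvert c i ≠ P.fvert c (i+2) := by
  have hm := P.m_ge c
  have hmod : ∀ j, P.fvert c j = P.fvert c (j % P.m c) := by
    intro j
    have hp : Function.Periodic (P.fvert c) (P.m c) := P.fvert_per c
    exact (hp.map_mod_nat j).symm
  have key : ∀ j k, j % P.m c ≠ k % P.m c → P.fvert c j ≠ P.fvert c k := by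
    intro j k h
    rw [hmod j, hmod k]
    rcases lt_or_gt_of_ne h with h | h
    · exact P.fvert_inj c _ _ h (Nat.mod_lt _ (by omega))
    · exact (P.fvert_inj c _ _ h (Nat.mod_lt _ (by omega))).symm
  have aux : ∀ j d, 0 < d → d < P.m c → j % P.m c ≠ (j + d) % P.m c := by
    intro j d h0 h1 h
    have : (j + 0) ≡ (j + d) [MOD P.m c] := h
    have := Nat.ModEq.add_left_cancel' j this
    have := (Nat.modEq_iff_dvd' (Nat.zero_le d)).1 this
    have := Nat.le_of_dvd (by omega) this
    omega
  exact ⟨key _ _ (aux i 1 (by omega) (by omega)), key _ _ (aux (i+1) 1 (by omega) (by omega)),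
    key _ _ (aux i 2 (by omega) (by omega))⟩

theorem third_vert (a a' : Fin P.nv) : ∃ b, b ≠ a ∧ b ≠ a' := by
  let c := P.vface a 0
  obtain ⟨h1, h2, h3⟩ := P.fvert_distinct c 0
  by_contra h
  push Not at h
  simp only [zero_add] at *
  have e0 := h (P.fvert c 0)
  have e1 := h (P.fvert c 1)
  have e2 := h (P.fvert c 2)
  grind

theorem plane_point (a) : ∃ x ∈ interior P.Pbar, P.cf a x = 0 := by
  obtain ⟨b, hb, _⟩ := P.third_vert a a
  obtain ⟨x, hx, hx1, _⟩ := P.near_vert a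
  obtain ⟨y, hy, _, hy2⟩ := P.near_vert b
  have hy2 := hy2 a (Ne.symm hb)
  refine ⟨x + (P.cf a x / (P.cf a x - P.cf a y)) • (y - x), ?_, ?_⟩
  · refine P.convex.interior.add_smul_sub_mem hx hy ⟨div_nonneg hx1.le (by linarith), ?_⟩
    rw [div_le_one (by linarith)]; linarith
  · rw [cf_comb]
    have : P.cf a x - P.cf a y ≠ 0 := by linarith
    field_simp; ring

theorem touching {a a' : Fin P.nv} (h : a ≠ a') {x} (hx : x ∈ P.Chat a) (hx' : x ∈ P.Chat a') :
    x ∈ frontier P.Pbar := by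
  by_contra hf
  have hi := P.mem_interior_of (P.mem_Chat.1 hx).1 hf
  have h0 := (P.mem_Chat.1 hx).2
  have h0' := (P.mem_Chat.1 hx').2
  -- the third vertex
  obtain ⟨b, hb1, hb2⟩ := P.third_vert a a'
  have e1 := P.cf_other hb1
  have e2 := P.cf_other hb2
  have e3 := P.cf_self a
  have e4 := P.cf_other h
  have e5 := P.cf_self a'
  have e6 := P.cf_other (Ne.symm h)
  -- combination point with cf a = cf a x direction zero: push x by direction d with cf a zero
  -- along d, cf a' must vanish
  have key : ∀ d : V3, d ⬝ᵥ P.Cnormal a = 0 → d ⬝ᵥ P.Cnormal a' ≤ 0 := by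
    intro d hd
    have hc : Continuous (fun t : ℝ => x + t • d) := by fun_prop
    have hmem : (fun t : ℝ => x + t • d) ⁻¹' interior P.Pbar ∈ nhds (0:ℝ) :=
      hc.continuousAt.preimage_mem_nhds (by simpa using isOpen_interior.mem_nhds hi)
    obtain ⟨ε, hε, hb⟩ := Metric.mem_nhds_iff.1 hmem
    have h1 : x + (ε/2) • d ∈ interior P.Pbar := hb (by simp [abs_of_pos hε]; linarith)
    have hz : P.cf a (x + (ε/2) • d) = 0 := by
      have : P.cf a (x + (ε/2) • d) = P.cf a x + (ε/2) * (d ⬝ᵥ P.Cnormal a) := by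
        simp [cf, dotProduct, Fin.sum_univ_three]; ring
      rw [this, h0, hd]; ring
    have h2 := P.cleave_sub a a' _ (interior_subset h1) hz
    have : P.cf a' (x + (ε/2) • d) = P.cf a' x + (ε/2) * (d ⬝ᵥ P.Cnormal a') := by
      simp [cf, dotProduct, Fin.sum_univ_three]; ring
    change P.cf a' _ ≤ 0 at h2
    rw [this, h0'] at h2
    nlinarith
  have key2 : ∀ d : V3, d ⬝ᵥ P.Cnormal a = 0 → d ⬝ᵥ P.Cnormal a' = 0 := by
    intro d hd
    refine le_antisymm (key d hd) ?_
    have := key (-d) (by rw [neg_dotProduct, hd, neg_zero])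
    rw [neg_dotProduct] at this; linarith
  have lin : ∀ y, P.cf a' y = (P.Cnormal a ⬝ᵥ P.Cnormal a') * P.cf a y := by
    intro y
    have hu := P.Cnormal_unit a
    have := key2 ((y - x) - ((y - x) ⬝ᵥ P.Cnormal a) • P.Cnormal a) (by
      rw [sub_dotProduct, smul_dotProduct, hu]; simp)
    rw [sub_dotProduct, smul_dotProduct] at this
    have q1 : P.cf a' y = P.cf a' x + (y - x) ⬝ᵥ P.Cnormal a' := by
      simp [cf, dotProduct, Fin.sum_univ_three]; ring
    have q2 : P.cf a y = P.cf a x + (y - x) ⬝ᵥ P.Cnormal a := by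
      simp [cf, dotProduct, Fin.sum_univ_three]; ring
    rw [q1, q2, h0, h0']
    simp only [smul_eq_mul] at this
    linarith
  rw [lin] at e2 e4
  rcases lt_or_ge 0 (P.Cnormal a ⬝ᵥ P.Cnormal a') with hp | hp
  · nlinarith
  · nlinarith

end PolyCtx


theorem plane_cramer {F a b d : V3} (hF : F ⬝ᵥ F = 1) (ha : a ⬝ᵥ F = 0) (hb : b ⬝ᵥ F = 0) (hd : d ⬝ᵥ F = 0) :
    (a ⬝ᵥ crossProduct F b) • d = (d ⬝ᵥ crossProduct F b) • a + (a ⬝ᵥ crossProduct F d) • b := by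
  have h0 : d ⬝ᵥ crossProduct a b = 0 := by
    simp only [cross_apply, dotProduct, Fin.sum_univ_three, Matrix.cons_val_zero, Matrix.cons_val_one, Matrix.cons_val] at *
    linear_combination (-(d 0 * (a 1 * b 2 - a 2 * b 1) + d 1 * (a 2 * b 0 - a 0 * b 2) + d 2 * (a 0 * b 1 - a 1 * b 0))) * hF
      + (F 0 * (a 1 * b 2 - a 2 * b 1) + F 1 * (a 2 * b 0 - a 0 * b 2) + F 2 * (a 0 * b 1 - a 1 * b 0)) * hd
      + (F 0 * (b 1 * d 2 - b 2 * d 1) + F 1 * (b 2 * d 0 - b 0 * d 2) + F 2 * (b 0 * d 1 - b 1 * d 0)) * ha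
      + (F 0 * (d 1 * a 2 - d 2 * a 1) + F 1 * (d 2 * a 0 - d 0 * a 2) + F 2 * (d 0 * a 1 - d 1 * a 0)) * hb
  simp only [cross_apply, dotProduct, Fin.sum_univ_three, Matrix.cons_val_zero, Matrix.cons_val_one, Matrix.cons_val] at *
  ext i
  fin_cases i <;> simp
  · linear_combination (-F 0) * h0
  · linear_combination (-F 1) * h0
  · linear_combination (-F 2) * h0

theorem par_of_three {F G a b : V3} (hF : F ⬝ᵥ F = 1) (ha : a ⬝ᵥ F = 0) (hb : b ⬝ᵥ F = 0)
    (ha' : a ⬝ᵥ G = 0) (hb' : b ⬝ᵥ G = 0) (hD : a ⬝ᵥ crossProduct F b ≠ 0) : crossProduct F G = 0 := by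
  have hd : (G - (G ⬝ᵥ F) • F) ⬝ᵥ F = 0 := by rw [sub_dotProduct, smul_dotProduct, hF]; simp
  have h := plane_cramer hF ha hb hd
  have h2 := congrArg (fun v => v ⬝ᵥ (G - (G ⬝ᵥ F) • F)) h
  simp only [add_dotProduct, smul_dotProduct, dotProduct_sub, dotProduct_smul, ha, hb, ha', hb'] at h2
  have h3 : (G - (G ⬝ᵥ F) • F) ⬝ᵥ (G - (G ⬝ᵥ F) • F) = 0 := by
    have : (a ⬝ᵥ crossProduct F b) * ((G - (G ⬝ᵥ F) • F) ⬝ᵥ (G - (G ⬝ᵥ F) • F)) = 0 := by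
      simp only [dotProduct_sub, dotProduct_smul, sub_dotProduct, smul_dotProduct, smul_eq_mul] at h2 ⊢
      linear_combination h2
    exact (mul_eq_zero.1 this).resolve_left hD
  have h4 : G - (G ⬝ᵥ F) • F = 0 := dotProduct_self_eq_zero.1 h3
  rw [sub_eq_zero.1 h4]
  simp

theorem par_form {F G : V3} (hF : F ⬝ᵥ F = 1) (h : crossProduct F G = 0) : G = (G ⬝ᵥ F) • F := by
  have h0 := congrFun h 0
  have h1 := congrFun h 1
  have h2 := congrFun h 2
  simp only [cross_apply, dotProduct, Fin.sum_univ_three, Matrix.cons_val_zero, Matrix.cons_val_one, Matrix.cons_val, Pi.zero_apply] at *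
  ext i
  fin_cases i <;> simp
  · linear_combination (-G 0) * hF - F 1 * h2 + F 2 * h1
  · linear_combination (-G 1) * hF - F 2 * h0 + F 0 * h2
  · linear_combination (-G 2) * hF - F 0 * h1 + F 1 * h0

theorem seg_mem (x y : V3) {t : ℝ} (h0 : 0 ≤ t) (h1 : t ≤ 1) : x + t • (y - x) ∈ segment ℝ x y :=
  ⟨1 - t, t, by linarith, h0, by ring, by module⟩

namespace PolyCtx
variable (P : PolyCtx)

theorem not_between {a b c : Fin P.nv} (hab : a ≠ b) (hbc : b ≠ c) {t : ℝ} (h0 : 0 ≤ t) (h1 : t ≤ 1)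
    (h : P.vert b = P.vert a + t • (P.vert c - P.vert a)) : False := by
  apply P.vert_extreme b
  have ha : P.vert a ∈ convexHull ℝ (Set.range P.vert \ {P.vert b}) :=
    subset_convexHull _ _ ⟨⟨a, rfl⟩, fun h => hab (P.vert_inj h)⟩
  have hc : P.vert c ∈ convexHull ℝ (Set.range P.vert \ {P.vert b}) :=
    subset_convexHull _ _ ⟨⟨c, rfl⟩, fun h => hbc (P.vert_inj h).symm⟩
  have := (convex_convexHull ℝ (Set.range P.vert \ {P.vert b})).add_smul_sub_mem ha hc ⟨h0, h1⟩
  rwa [← h] at this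

theorem noncol {a b c : Fin P.nv} (hab : a ≠ b) (hbc : b ≠ c) (hac : a ≠ c) {F : V3} (hF : F ⬝ᵥ F = 1)
    (h1 : (P.vert a - P.vert b) ⬝ᵥ F = 0) (h2 : (P.vert c - P.vert b) ⬝ᵥ F = 0) :
    (P.vert a - P.vert b) ⬝ᵥ crossProduct F (P.vert c - P.vert b) ≠ 0 := by
  intro h0
  set x := P.vert a - P.vert b with hx
  set y := P.vert c - P.vert b with hy
  have hx0 : x ≠ 0 := fun h => hab (P.vert_inj (sub_eq_zero.1 h))
  have hxx := dot_self_pos hx0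
  -- y = lam x
  have hFx : crossProduct F x ⬝ᵥ F = 0 := by
    simp [cross_apply, dotProduct, Fin.sum_univ_three]; ring
  have hc := plane_cramer hF h1 hFx h2
  have e1 : x ⬝ᵥ crossProduct F (crossProduct F x) = - (x ⬝ᵥ x) := by
    simp only [cross_apply, dotProduct, Fin.sum_univ_three, Matrix.cons_val_zero, Matrix.cons_val_one, Matrix.cons_val] at *
    linear_combination (-(x 0 * x 0 + x 1 * x 1 + x 2 * x 2)) * hF + (x 0 * F 0 + x 1 * F 1 + x 2 * F 2) * h1
  rw [h0, zero_smul, add_zero, e1] at hc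
  obtain ⟨lam, hl⟩ : ∃ lam : ℝ, y = lam • x := by
    refine ⟨(-(x ⬝ᵥ x))⁻¹ * (y ⬝ᵥ crossProduct F (crossProduct F x)), ?_⟩
    rw [mul_smul, ← hc, smul_smul, inv_mul_cancel₀ (by linarith), one_smul]
  have hvc : P.vert c = P.vert b + lam • (P.vert a - P.vert b) := by rw [← hx, ← hl, hy]; module
  rcases lt_trichotomy lam 0 with hl0 | hl0 | hl0
  · -- b between a and c
    refine P.not_between (a := a) (b := b) (c := c) hab hbc (t := 1 / (1 - lam)) (by apply div_nonneg <;> linarith)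
      (by rw [div_le_one] <;> linarith) ?_
    rw [hvc]
    have : (1 - lam) ≠ 0 := by linarith
    have e : P.vert b + lam • (P.vert a - P.vert b) - P.vert a = (1 - lam) • (P.vert b - P.vert a) := by module
    rw [e, smul_smul, one_div, inv_mul_cancel₀ this]; module
  · apply hbc; apply P.vert_inj; rw [hvc, hl0]; module
  · rcases le_or_gt lam 1 with h | h
    · exact P.not_between (a := b) (b := c) (c := a) hbc hac.symm hl0.le h hvc
    · refine P.not_between (a := b) (b := a) (c := c) hab.symm hac (t := lam⁻¹) (by positivity)
        (inv_le_one_of_one_le₀ h.le) ?_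
      rw [hvc]
      have e : P.vert b + lam • (P.vert a - P.vert b) - P.vert b = lam • (P.vert a - P.vert b) := by module
      rw [e, smul_smul, inv_mul_cancel₀ hl0.ne']; module

theorem fv_mem (c i) : P.vert (P.fvert c i) ∈ P.edge (P.fedge c i) ∧ P.vert (P.fvert c (i+1)) ∈ P.edge (P.fedge c i) := by
  rw [P.fedge_seg]; exact ⟨left_mem_segment _ _ _, right_mem_segment _ _ _⟩

theorem fv_face (c i) : P.vert (P.fvert c i) ∈ P.face c := P.fedge_sub c i (P.fv_mem c i).1

theorem face_diff {c x y} (hx : x ∈ P.face c) (hy : y ∈ P.face c) : (x - y) ⬝ᵥ P.Fnormal c = 0 := by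
  rw [sub_dotProduct, (P.mem_face.1 hx).2, (P.mem_face.1 hy).2, sub_self]

theorem edge_other (c) (b) : ∃ c', P.edge b ⊆ P.face c' ∧ crossProduct (P.Fnormal c) (P.Fnormal c') ≠ 0 := by
  obtain ⟨c1, c2, h1, h2, h12⟩ := P.edge_two_faces b
  by_cases e1 : crossProduct (P.Fnormal c) (P.Fnormal c1) = 0
  · by_cases e2 : crossProduct (P.Fnormal c) (P.Fnormal c2) = 0
    · exfalso; apply h12
      rw [par_form (P.Fnormal_unit c) e1, par_form (P.Fnormal_unit c) e2]
      simp
    · exact ⟨c2, h2, e2⟩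
  · exact ⟨c1, h1, e1⟩

theorem fdet (c i) : (P.vert (P.fvert c i) - P.vert (P.fvert c (i+1))) ⬝ᵥ
    crossProduct (P.Fnormal c) (P.vert (P.fvert c (i+2)) - P.vert (P.fvert c (i+1))) ≠ 0 := by
  obtain ⟨h1, h2, h3⟩ := P.fvert_distinct c i
  exact P.noncol h1 h2 h3 (P.Fnormal_unit c) (P.face_diff (P.fv_face _ _) (P.fv_face _ _))
    (P.face_diff (P.fv_face _ _) (P.fv_face _ _))

/-- slack function of a face -/
def sl (c : Fin P.nf) (x : V3) : ℝ := P.foffset c - x ⬝ᵥ P.Fnormal c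

theorem sl_nonneg {c x} (h : x ∈ P.Pbar) : 0 ≤ P.sl c x := sub_nonneg.2 (P.face_supp c x h)
theorem sl_zero {c x} (h : x ∈ P.face c) : P.sl c x = 0 := sub_eq_zero.2 (P.mem_face.1 h).2.symm

theorem sl_comb (c) (v x y : V3) (s t : ℝ) : P.sl c (v + s • (x - v) + t • (y - v)) =
    P.sl c v + s * (P.sl c x - P.sl c v) + t * (P.sl c y - P.sl c v) := by
  simp [sl, dotProduct, Fin.sum_univ_three]; ring

theorem sl_comb1 (c) (v x : V3) (s : ℝ) : P.sl c (v + s • (x - v)) =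
    P.sl c v + s * (P.sl c x - P.sl c v) := by
  simp [sl, dotProduct, Fin.sum_univ_three]; ring

theorem cf_comb2 (a) (v x y : V3) (s t : ℝ) : P.cf a (v + s • (x - v) + t • (y - v)) =
    P.cf a v + s * (P.cf a x - P.cf a v) + t * (P.cf a y - P.cf a v) := by
  simp [cf, dotProduct, Fin.sum_univ_three]; ring

/-- three consecutive vertices of a face do not lie on a non-parallel face -/
theorem not_three {c c' i} (hcc : crossProduct (P.Fnormal c) (P.Fnormal c') ≠ 0)
    (h0 : P.sl c' (P.vert (P.fvert c i)) = 0) (h1 : P.sl c' (P.vert (P.fvert c (i+1))) = 0)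
    (h2 : P.sl c' (P.vert (P.fvert c (i+2))) = 0) : False := by
  refine hcc (par_of_three (P.Fnormal_unit c) (P.face_diff (P.fv_face _ _) (P.fv_face _ _))
    (P.face_diff (P.fv_face _ _) (P.fv_face _ _)) ?_ ?_ (P.fdet c i))
  · rw [sub_dotProduct]; unfold sl at *; linarith
  · rw [sub_dotProduct]; unfold sl at *; linarith

theorem cone {c x} (hx : x ∈ P.face c) (i) : ∃ α β : ℝ, 0 ≤ α ∧ 0 ≤ β ∧
    x = P.vert (P.fvert c (i+1)) + α • (P.vert (P.fvert c i) - P.vert (P.fvert c (i+1))) +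
      β • (P.vert (P.fvert c (i+2)) - P.vert (P.fvert c (i+1))) := by
  have hD := P.fdet c i
  have hc := plane_cramer (P.Fnormal_unit c) (P.face_diff (P.fv_face c i) (P.fv_face c (i+1)))
    (P.face_diff (P.fv_face c (i+2)) (P.fv_face c (i+1))) (P.face_diff hx (P.fv_face c (i+1)))
  obtain ⟨c1, s1, n1⟩ := P.edge_other c (P.fedge c i)
  obtain ⟨c2, s2, n2⟩ := P.edge_other c (P.fedge c (i+1))
  have z1 := P.sl_zero (s1 (P.fv_mem c i).1)
  have z2 := P.sl_zero (s1 (P.fv_mem c i).2)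
  have z3 := P.sl_zero (s2 (P.fv_mem c (i+1)).1)
  have z4 := P.sl_zero (s2 (P.fv_mem c (i+1)).2)
  have p1 : 0 < P.sl c1 (P.vert (P.fvert c (i+2))) :=
    lt_of_le_of_ne (P.sl_nonneg (P.vert_mem _)) fun h => P.not_three n1 z1 z2 h.symm
  have p2 : 0 < P.sl c2 (P.vert (P.fvert c i)) :=
    lt_of_le_of_ne (P.sl_nonneg (P.vert_mem _)) fun h => P.not_three n2 h.symm z3 z4
  rw [show i + 1 + 1 = i + 2 from rfl] at z4
  set D := (P.vert (P.fvert c i) - P.vert (P.fvert c (i+1))) ⬝ᵥ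
    crossProduct (P.Fnormal c) (P.vert (P.fvert c (i+2)) - P.vert (P.fvert c (i+1)))
  obtain ⟨α, β, he⟩ : ∃ α β : ℝ, x = P.vert (P.fvert c (i+1)) + α • (P.vert (P.fvert c i) - P.vert (P.fvert c (i+1))) +
      β • (P.vert (P.fvert c (i+2)) - P.vert (P.fvert c (i+1))) := by
    refine ⟨D⁻¹ * ((x - P.vert (P.fvert c (i+1))) ⬝ᵥ crossProduct (P.Fnormal c)
        (P.vert (P.fvert c (i+2)) - P.vert (P.fvert c (i+1)))),
      D⁻¹ * ((P.vert (P.fvert c i) - P.vert (P.fvert c (i+1))) ⬝ᵥ crossProduct (P.Fnormal c)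
        (x - P.vert (P.fvert c (i+1)))), ?_⟩
    rw [mul_smul, mul_smul, add_assoc, ← smul_add, ← hc, smul_smul, inv_mul_cancel₀ hD]; module
  have q1 := P.sl_nonneg (c := c1) (P.face_sub c hx)
  have q2 := P.sl_nonneg (c := c2) (P.face_sub c hx)
  rw [he, sl_comb, z1, z2] at q1
  rw [he, sl_comb, z3, z4] at q2
  refine ⟨α, β, ?_, ?_, he⟩
  · by_contra h; push Not at h; nlinarith
  · by_contra h; push Not at h; nlinarith

theorem exists_min (c) (g : V3 → ℝ) : ∃ i, ∀ j, g (P.vert (P.fvert c (i+1))) ≤ g (P.vert (P.fvert c j)) := by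
  have hm := P.m_ge c
  have hp : Function.Periodic (P.fvert c) (P.m c) := P.fvert_per c
  obtain ⟨i, hi, hmin⟩ := Finset.exists_min_image (Finset.range (P.m c)) (fun j => g (P.vert (P.fvert c j)))
    ⟨0, by simp; omega⟩
  refine ⟨i + P.m c - 1, fun j => ?_⟩
  rw [show i + P.m c - 1 + 1 = i + P.m c by omega, P.fvert_per, ← hp.map_mod_nat j]
  exact hmin _ (Finset.mem_range.2 (Nat.mod_lt _ (by omega)))

theorem ray_in_edge {c i x} {α : ℝ} (hx : x ∈ P.face c) (h0 : 0 ≤ α)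
    (h : x = P.vert (P.fvert c (i+2)) + α • (P.vert (P.fvert c (i+1)) - P.vert (P.fvert c (i+2)))) :
    x ∈ P.edge (P.fedge c (i+1)) := by
  obtain ⟨a, b, ha, hb, he⟩ := P.cone hx i
  have h1 : α ≤ 1 := by
    obtain ⟨c1, s1, n1⟩ := P.edge_other c (P.fedge c i)
    have z1 := P.sl_zero (s1 (P.fv_mem c i).1)
    have z2 := P.sl_zero (s1 (P.fv_mem c i).2)
    have p1 : 0 < P.sl c1 (P.vert (P.fvert c (i+2))) :=
      lt_of_le_of_ne (P.sl_nonneg (P.vert_mem _)) fun h => P.not_three n1 z1 z2 h.symm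
    have q1 := P.sl_nonneg (c := c1) (P.face_sub c hx)
    rw [h, sl_comb1, z2] at q1
    by_contra hh; push Not at hh; nlinarith
  rw [P.fedge_seg, segment_symm, h]
  exact seg_mem _ _ h0 h1

theorem ray_in_edge' {c i x} {α : ℝ} (hx : x ∈ P.face c) (h0 : 0 ≤ α)
    (h : x = P.vert (P.fvert c i) + α • (P.vert (P.fvert c (i+1)) - P.vert (P.fvert c i))) :
    x ∈ P.edge (P.fedge c i) := by
  have h1 : α ≤ 1 := by
    obtain ⟨c1, s1, n1⟩ := P.edge_other c (P.fedge c (i+1))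
    have z1 := P.sl_zero (s1 (P.fv_mem c (i+1)).1)
    have z2 := P.sl_zero (s1 (P.fv_mem c (i+1)).2)
    have p1 : 0 < P.sl c1 (P.vert (P.fvert c i)) :=
      lt_of_le_of_ne (P.sl_nonneg (P.vert_mem _)) fun h => P.not_three n1 h.symm z1 z2
    have q1 := P.sl_nonneg (c := c1) (P.face_sub c hx)
    rw [h, sl_comb1, z1] at q1
    by_contra hh; push Not at hh; nlinarith
  rw [P.fedge_seg, h]
  exact seg_mem _ _ h0 h1

/-- A point on two nonparallel faces is on an edge of the first. -/
theorem edge_lemma {c c' x} (hx : x ∈ P.face c) (hx' : x ∈ P.face c')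
    (hcc : crossProduct (P.Fnormal c) (P.Fnormal c') ≠ 0) : ∃ i, x ∈ P.edge (P.fedge c i) := by
  obtain ⟨i0, hi0⟩ := P.exists_min c (P.sl c')
  -- shift the index
  obtain ⟨i, hi⟩ : ∃ i, ∀ j, P.sl c' (P.vert (P.fvert c (i+2))) ≤ P.sl c' (P.vert (P.fvert c j)) := by
    refine ⟨i0 + P.m c - 1, fun j => ?_⟩
    have hm := P.m_ge c
    rw [show i0 + P.m c - 1 + 2 = i0 + 1 + P.m c by omega, P.fvert_per]
    exact hi0 j
  obtain ⟨α, β, hα, hβ, he⟩ := P.cone hx (i+1)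
  rw [show i + 1 + 1 = i + 2 from rfl, show i + 1 + 2 = i + 3 from rfl] at he
  have z := P.sl_zero hx'
  rw [he, sl_comb] at z
  have g0 := P.sl_nonneg (c := c') (P.vert_mem (P.fvert c (i+2)))
  have g1 := hi (i+1)
  have g2 := hi (i+3)
  have m1 := mul_nonneg hα (sub_nonneg.2 g1)
  have m2 := mul_nonneg hβ (sub_nonneg.2 g2)
  have y0 : P.sl c' (P.vert (P.fvert c (i+2))) = 0 := by linarith
  have y1 : α * P.sl c' (P.vert (P.fvert c (i+1))) = 0 := by rw [y0, sub_zero] at m1 m2; rw [y0, sub_zero, sub_zero] at z; linarith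
  have y2 : β * P.sl c' (P.vert (P.fvert c (i+3))) = 0 := by rw [y0, sub_zero] at m1 m2; rw [y0, sub_zero, sub_zero] at z; linarith
  rcases mul_eq_zero.1 y1 with y1 | y1
  · refine ⟨i+2, P.ray_in_edge' hx hβ ?_⟩
    rw [he, y1]; simp
  · rcases mul_eq_zero.1 y2 with y2 | y2
    · refine ⟨i+1, P.ray_in_edge hx hα ?_⟩
      rw [he, y2]; simp
    · exact (P.not_three (i := i+1) hcc y1 y0 y2).elim

/-- Parallel faces with a common point. -/
theorem par_faces {c c' x} (hx : x ∈ P.face c) (hx' : x ∈ P.face c')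
    (hcc : crossProduct (P.Fnormal c) (P.Fnormal c') = 0) : P.Fnormal c = P.Fnormal c' ∧ P.face c = P.face c' := by
  have h := par_form (P.Fnormal_unit c) hcc
  set k := P.Fnormal c' ⬝ᵥ P.Fnormal c
  have hk : k * k = 1 := by
    have := P.Fnormal_unit c'
    rw [h, smul_dotProduct, dotProduct_smul, P.Fnormal_unit c] at this
    simpa using this
  have h1 := (P.mem_face.1 hx).2
  have h2 := (P.mem_face.1 hx').2
  rw [h, dotProduct_smul, h1, smul_eq_mul] at h2
  have hk1 : k = 1 := by
    rcases mul_self_eq_one_iff.1 hk with h' | h'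
    · exact h'
    · exfalso
      obtain ⟨y, hy⟩ := P.int_nonempty
      -- slack zero at y
      have hall : ∀ y ∈ P.Pbar, y ⬝ᵥ P.Fnormal c = P.foffset c := by
        intro y hy
        have a1 := P.face_supp c y hy
        have a2 := P.face_supp c' y hy
        rw [h, dotProduct_smul, ← h2, h', smul_eq_mul] at a2
        linarith
      have hc : Continuous (fun t : ℝ => y + t • P.Fnormal c) := by fun_prop
      have hmem : (fun t : ℝ => y + t • P.Fnormal c) ⁻¹' interior P.Pbar ∈ nhds (0:ℝ) :=
        hc.continuousAt.preimage_mem_nhds (by simpa using isOpen_interior.mem_nhds hy)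
      obtain ⟨ε, hε, hb⟩ := Metric.mem_nhds_iff.1 hmem
      have h1 : y + (ε/2) • P.Fnormal c ∈ interior P.Pbar := hb (by simp [abs_of_pos hε]; linarith)
      have e1 := hall _ (interior_subset hy)
      have e2 := hall _ (interior_subset h1)
      rw [add_dotProduct, smul_dotProduct, e1, P.Fnormal_unit, smul_eq_mul] at e2
      linarith
  rw [hk1, one_smul] at h
  refine ⟨h.symm, ?_⟩
  rw [P.face_def, P.face_def, h]
  rw [hk1, one_mul] at h2; rw [h2]

end PolyCtx


theorem perp_two {F G w : V3} (h1 : w ⬝ᵥ F = 0) (h2 : w ⬝ᵥ G = 0) :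
    (crossProduct F G ⬝ᵥ crossProduct F G) • w = (w ⬝ᵥ crossProduct F G) • crossProduct F G := by
  simp only [cross_apply, dotProduct, Fin.sum_univ_three, Matrix.cons_val_zero, Matrix.cons_val_one, Matrix.cons_val] at *
  have k0 : w 1 * (F 0 * G 1 - F 1 * G 0) - w 2 * (F 2 * G 0 - F 0 * G 2) = 0 := by
    linear_combination F 0 * h2 - G 0 * h1
  have k1 : w 2 * (F 1 * G 2 - F 2 * G 1) - w 0 * (F 0 * G 1 - F 1 * G 0) = 0 := by
    linear_combination F 1 * h2 - G 1 * h1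
  have k2 : w 0 * (F 2 * G 0 - F 0 * G 2) - w 1 * (F 1 * G 2 - F 2 * G 1) = 0 := by
    linear_combination F 2 * h2 - G 2 * h1
  ext i
  fin_cases i <;> simp
  · linear_combination (F 2 * G 0 - F 0 * G 2) * k2 - (F 0 * G 1 - F 1 * G 0) * k1
  · linear_combination (F 0 * G 1 - F 1 * G 0) * k0 - (F 1 * G 2 - F 2 * G 1) * k2
  · linear_combination (F 1 * G 2 - F 2 * G 1) * k1 - (F 2 * G 0 - F 0 * G 2) * k0

theorem perp_two_par {F G w u : V3} (hX : crossProduct F G ≠ 0) (h1 : w ⬝ᵥ F = 0) (h2 : w ⬝ᵥ G = 0)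
    (h3 : u ⬝ᵥ F = 0) (h4 : u ⬝ᵥ G = 0) (hu : u ≠ 0) : ∃ k : ℝ, w = k • u := by
  have a := perp_two h1 h2
  have b := perp_two h3 h4
  have hp := dot_self_pos hX
  set X := crossProduct F G
  have hub : u ⬝ᵥ X ≠ 0 := by
    intro h
    rw [h, zero_smul] at b
    exact hu ((smul_eq_zero.1 b).resolve_left hp.ne')
  refine ⟨(w ⬝ᵥ X) * (u ⬝ᵥ X)⁻¹, ?_⟩
  have hX' : X = ((u ⬝ᵥ X)⁻¹ * (X ⬝ᵥ X)) • u := by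
    rw [mul_smul, b, smul_smul, inv_mul_cancel₀ hub, one_smul]
  have : (X ⬝ᵥ X) • w = (X ⬝ᵥ X) • (((w ⬝ᵥ X) * (u ⬝ᵥ X)⁻¹) • u) := by
    rw [a]
    refine (congrArg (fun y => (w ⬝ᵥ X) • y) hX').trans ?_
    simp only [smul_smul]
    congr 1
    ring
  exact smul_right_injective _ hp.ne' this

/-- endpoints of an injective path onto a segment -/
theorem seg_ends {z : ℝ → V3} {p q : V3} (hpq : p ≠ q) (hz : ContinuousOn z (Icc 0 1))
    (hi : InjOn z (Icc 0 1)) (him : z '' Icc 0 1 = segment ℝ p q) :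
    (z 0 = p ∧ z 1 = q) ∨ (z 0 = q ∧ z 1 = p) := by
  have hd := dot_self_pos (sub_ne_zero.2 hpq.symm)
  let h : ℝ → ℝ := fun t => ((z t - p) ⬝ᵥ (q - p)) / ((q - p) ⬝ᵥ (q - p))
  have hzt : ∀ t ∈ Icc (0:ℝ) 1, 0 ≤ h t ∧ h t ≤ 1 ∧ z t = p + h t • (q - p) := by
    intro t ht
    have : z t ∈ segment ℝ p q := him ▸ mem_image_of_mem z ht
    rw [segment_eq_image'] at this
    obtain ⟨θ, hθ, e⟩ := this
    have : h t = θ := by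
      simp only [h]; rw [← e, add_sub_cancel_left, smul_dotProduct, smul_eq_mul]; field_simp
    rw [this]; exact ⟨hθ.1, hθ.2, e.symm⟩
  have hc : ContinuousOn h (Icc 0 1) := by
    have : Continuous (fun v : V3 => ((v - p) ⬝ᵥ (q - p)) / ((q - p) ⬝ᵥ (q - p))) := by
      simp only [dotProduct, Fin.sum_univ_three]; fun_prop
    exact this.comp_continuousOn hz
  have hin : InjOn h (Icc 0 1) := by
    intro s hs t ht e
    apply hi hs ht
    rw [(hzt s hs).2.2, (hzt t ht).2.2, e]
  obtain ⟨tp, htp, ep⟩ : p ∈ z '' Icc 0 1 := him ▸ left_mem_segment _ _ _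
  obtain ⟨tq, htq, eq⟩ : q ∈ z '' Icc 0 1 := him ▸ right_mem_segment _ _ _
  have h_p : h tp = 0 := by simp only [h, ep]; simp
  have h_q : h tq = 1 := by simp only [h, eq]; exact div_self hd.ne'
  have z0 : (0:ℝ) ∈ Icc (0:ℝ) 1 := by simp
  have z1 : (1:ℝ) ∈ Icc (0:ℝ) 1 := by simp
  have b0 := hzt 0 z0
  have b1 := hzt 1 z1
  rcases hc.strictMonoOn_of_injOn_Icc' zero_le_one hin with hm | hm
  · left
    have e0 : h 0 = 0 := le_antisymm (h_p ▸ hm.monotoneOn z0 htp htp.1) b0.1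
    have e1 : h 1 = 1 := le_antisymm b1.2.1 (by have := hm.monotoneOn htq z1 htq.2; rwa [h_q] at this)
    rw [b0.2.2, b1.2.2, e0, e1]; constructor <;> module
  · right
    have e1 : h 1 = 0 := le_antisymm (h_p ▸ hm.antitoneOn htp z1 htp.2) b1.1
    have e0 : h 0 = 1 := le_antisymm b0.2.1 (by have := hm.antitoneOn z0 htq htq.1; rwa [h_q] at this)
    rw [b0.2.2, b1.2.2, e0, e1]; constructor <;> module

theorem gfun_comb (F p q v x y : V3) (s t : ℝ) :
    ((v + s • (x - v) + t • (y - v)) - p) ⬝ᵥ crossProduct F (q - p) =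
    (v - p) ⬝ᵥ crossProduct F (q - p) + s * ((x - p) ⬝ᵥ crossProduct F (q - p) - (v - p) ⬝ᵥ crossProduct F (q - p))
     + t * ((y - p) ⬝ᵥ crossProduct F (q - p) - (v - p) ⬝ᵥ crossProduct F (q - p)) := by
  generalize crossProduct F (q - p) = w
  simp [dotProduct, Fin.sum_univ_three]; ring

namespace PolyCtx
variable (P : PolyCtx)

theorem Bhat_vert {a c x} (hx : x ∈ P.Bhat a c) : ∃ i, a = P.fvert c (i+1) := by
  have h0 := (P.mem_Chat.1 hx.1).2
  obtain ⟨i, hi⟩ := P.exists_min c (fun y => - P.cf a y)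
  refine ⟨i, ?_⟩
  by_contra hne
  obtain ⟨α, β, hα, hβ, he⟩ := P.cone hx.2.1 i
  have h1 := P.cf_other (Ne.symm hne)
  rw [he, cf_comb2] at h0
  have g1 := hi i
  have g2 := hi (i+2)
  have : 0 ≤ α * (P.cf a (P.vert (P.fvert c (i+1))) - P.cf a (P.vert (P.fvert c i))) := mul_nonneg hα (by linarith)
  have : 0 ≤ β * (P.cf a (P.vert (P.fvert c (i+1))) - P.cf a (P.vert (P.fvert c (i+2)))) := mul_nonneg hβ (by linarith)
  linarith

theorem Bseg (c i) : ∃ p q : V3, p ∈ P.Ehat (P.fedge c i) ∧ q ∈ P.Ehat (P.fedge c (i+1)) ∧ p ≠ q ∧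
    P.Bhat (P.fvert c (i+1)) c = segment ℝ p q ∧
    ∃ k : ℝ, k ≠ 0 ∧ ∀ x ∈ P.face c, (x - p) ⬝ᵥ crossProduct (P.Fnormal c) (q - p) = k * P.cf (P.fvert c (i+1)) x := by
  obtain ⟨d1, d2, d3⟩ := P.fvert_distinct c i
  have hD := P.fdet c i
  have f0 := P.cf_self (P.fvert c (i+1))
  have f1 := P.cf_other d1
  have f2 := P.cf_other d2.symm
  have m0 := P.fv_face c i
  have m1 := P.fv_face c (i+1)
  have m2 := P.fv_face c (i+2)
  have hcone := fun x (hx : x ∈ P.face c) => P.cone hx i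
  have E1 := P.fedge_seg c i
  have E2 := P.fedge_seg c (i+1)
  rw [show i + 1 + 1 = i + 2 from rfl] at E2
  have S1 := P.fedge_sub c i
  have S2 := P.fedge_sub c (i+1)
  generalize P.fvert c (i+1) = a at *
  generalize hv : P.vert a = v at *
  generalize P.vert (P.fvert c i) = u at *
  generalize P.vert (P.fvert c (i+2)) = w at *
  obtain ⟨s, hs⟩ : ∃ s, s = P.cf a v / (P.cf a v - P.cf a u) := ⟨_, rfl⟩
  obtain ⟨t, ht⟩ : ∃ t, t = P.cf a v / (P.cf a v - P.cf a w) := ⟨_, rfl⟩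
  have hs0 : 0 < s := by rw [hs]; apply div_pos <;> linarith
  have ht0 : 0 < t := by rw [ht]; apply div_pos <;> linarith
  have hs1 : s < 1 := by rw [hs, div_lt_one] <;> linarith
  have ht1 : t < 1 := by rw [ht, div_lt_one] <;> linarith
  have es : s * (P.cf a u - P.cf a v) = - P.cf a v := by
    rw [hs]; have : P.cf a v - P.cf a u ≠ 0 := by linarith
    field_simp; ring
  have et : t * (P.cf a w - P.cf a v) = - P.cf a v := by
    rw [ht]; have : P.cf a v - P.cf a w ≠ 0 := by linarith
    field_simp; ring
  obtain ⟨p, hp⟩ : ∃ p, p = v + s • (u - v) := ⟨_, rfl⟩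
  obtain ⟨q, hq⟩ : ∃ q, q = v + t • (w - v) := ⟨_, rfl⟩
  have pe : p ∈ P.edge (P.fedge c i) := by
    rw [E1, segment_symm, hp]; exact seg_mem _ _ hs0.le hs1.le
  have qe : q ∈ P.edge (P.fedge c (i+1)) := by
    rw [E2, hq]; exact seg_mem _ _ ht0.le ht1.le
  have pC : p ∈ P.Chat a := P.mem_Chat.2 ⟨P.face_sub c (S1 pe), by rw [hp, cf_comb, es]; ring⟩
  have qC : q ∈ P.Chat a := P.mem_Chat.2 ⟨P.face_sub c (S2 qe), by rw [hq, cf_comb, et]; ring⟩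
  have hg : ∀ x ∈ P.face c, ∃ α β : ℝ, 0 ≤ α ∧ 0 ≤ β ∧ x = v + (α * s) • (u - v) + (β * t) • (w - v) := by
    intro x hx
    obtain ⟨α, β, hα, hβ, he⟩ := hcone x hx
    refine ⟨α / s, β / t, by positivity, by positivity, ?_⟩
    rw [div_mul_cancel₀ _ hs0.ne', div_mul_cancel₀ _ ht0.ne', he]
  have hk : (v - p) ⬝ᵥ crossProduct (P.Fnormal c) (q - p) = -(s * t) * ((u - v) ⬝ᵥ crossProduct (P.Fnormal c) (w - v)) := by
    rw [hp, hq]; simp [cross_apply, dotProduct, Fin.sum_univ_three]; ring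
  have gp : (v - p) ⬝ᵥ crossProduct (P.Fnormal c) (q - p) +
      s * ((u - p) ⬝ᵥ crossProduct (P.Fnormal c) (q - p) - (v - p) ⬝ᵥ crossProduct (P.Fnormal c) (q - p)) = 0 := by
    have h1 : (v - p) + s • (u - v) = 0 := by rw [hp]; module
    have h2 : u - v = (u - p) - (v - p) := by module
    rw [← sub_dotProduct, ← h2, ← smul_eq_mul, ← smul_dotProduct, ← add_dotProduct, h1, zero_dotProduct]
  have gq : (v - p) ⬝ᵥ crossProduct (P.Fnormal c) (q - p) +
      t * ((w - p) ⬝ᵥ crossProduct (P.Fnormal c) (q - p) - (v - p) ⬝ᵥ crossProduct (P.Fnormal c) (q - p)) = 0 := by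
    have h1 : (v - p) + t • (w - v) = q - p := by rw [hq]; module
    have h2 : w - v = (w - p) - (v - p) := by module
    rw [← sub_dotProduct, ← h2, ← smul_eq_mul, ← smul_dotProduct, ← add_dotProduct, h1]
    simp [cross_apply, dotProduct, Fin.sum_univ_three]; ring
  refine ⟨p, q, ⟨pe, P.Chat_Rall pC⟩, ⟨qe, P.Chat_Rall qC⟩, ?_, ?_,
    ((v - p) ⬝ᵥ crossProduct (P.Fnormal c) (q - p)) / P.cf a v, ?_, ?_⟩
  · intro h
    rw [h, sub_self, map_zero, dotProduct_zero] at hk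
    rcases mul_eq_zero.1 hk.symm with h | h
    · have := mul_pos hs0 ht0
      linarith
    · exact hD h
  · apply Subset.antisymm
    · intro x hx
      have h0 := (P.mem_Chat.1 hx.1).2
      obtain ⟨α, β, hα, hβ, he⟩ := hg x hx.2.1
      rw [he, cf_comb2, mul_assoc, es, mul_assoc, et] at h0
      have hab : α + β = 1 := by
        have : P.cf a v * (1 - α - β) = 0 := by linarith
        have := (mul_eq_zero.1 this).resolve_left f0.ne'
        linarith
      refine ⟨α, β, hα, hβ, hab, ?_⟩
      rw [he, hp, hq, show α = 1 - β by linarith]; module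
    · intro x hx
      have h1 := (P.convex_Chat a).segment_subset pC qC hx
      exact ⟨h1, (P.convex_face c).segment_subset (S1 pe) (S2 qe) hx, P.Chat_Rall h1⟩
  · rw [hk]
    have : s * t ≠ 0 := by positivity
    exact div_ne_zero (mul_ne_zero (neg_ne_zero.2 this) hD) f0.ne'
  · intro x hx
    obtain ⟨α, β, hα, hβ, he⟩ := hg x hx
    rw [he, gfun_comb, cf_comb2]
    generalize (v - p) ⬝ᵥ crossProduct (P.Fnormal c) (q - p) = G at *
    generalize (u - p) ⬝ᵥ crossProduct (P.Fnormal c) (q - p) = G1 at *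
    generalize (w - p) ⬝ᵥ crossProduct (P.Fnormal c) (q - p) = G2 at *
    have : G / P.cf a v * (P.cf a v + α * s * (P.cf a u - P.cf a v) + β * t * (P.cf a w - P.cf a v)) = G * (1 - α - β) := by
      rw [mul_assoc α, es, mul_assoc β, et]; field_simp; ring
    rw [this]
    linear_combination α * gp + β * gq

/-- A point of the truncated face strictly inside `R^a`. -/
theorem exists_strict (c i) : ∃ x ∈ P.Fhat c, P.cf (P.fvert c (i+1)) x < 0 := by
  have hm := P.m_ge c
  -- use the vertex before
  obtain ⟨j, h1, h2⟩ : ∃ j, P.fvert c (j+1) ≠ P.fvert c (i+1) ∧ P.fvert c (j+2) ≠ P.fvert c (i+1) := by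
    refine ⟨i + 1, (P.fvert_distinct c (i+1)).1.symm, ?_⟩
    exact (P.fvert_distinct c (i+1)).2.2.symm
  obtain ⟨p, q, hp, hq, -⟩ := P.Bseg c j
  refine ⟨q, ⟨P.fedge_sub _ _ hq.1, hq.2⟩, ?_⟩
  have := hq.1
  rw [P.fedge_seg, segment_eq_image'] at this
  obtain ⟨θ, hθ, e⟩ := this
  rw [← e]
  simp only
  rw [cf_comb]
  have a1 := P.cf_other h1
  have a2 := P.cf_other h2
  rw [show j + 1 + 1 = j + 2 from rfl]
  have : P.cf (P.fvert c (i+1)) (P.vert (P.fvert c (j+1))) * (1 - θ) + θ * P.cf (P.fvert c (i+1)) (P.vert (P.fvert c (j+2))) < 0 := by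
    rcases eq_or_lt_of_le hθ.1 with h | h
    · rw [← h]; simpa using a1
    · have b1 := mul_neg_of_pos_of_neg h a2
      have b2 := mul_nonneg (sub_nonneg.2 hθ.2) (neg_nonneg.2 a1.le)
      nlinarith
  linarith

theorem Bparam (c i) : ∃ p q : V3, ((p ∈ P.Ehat (P.fedge c i) ∧ q ∈ P.Ehat (P.fedge c (i+1))) ∨
      (q ∈ P.Ehat (P.fedge c i) ∧ p ∈ P.Ehat (P.fedge c (i+1)))) ∧
    P.IsPosParamSeg (P.fvert c (i+1)) c (fun t => p + t • (q - p)) ∧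
    ∀ z, P.IsPosParamSeg (P.fvert c (i+1)) c z → z 0 = p ∧ z 1 = q := by
  obtain ⟨p, q, hp, hq, hpq, hB, k, hk, hg⟩ := P.Bseg c i
  obtain ⟨x0, hx0, hx0'⟩ := P.exists_strict c i
  have hanti : ∀ x, (x - q) ⬝ᵥ crossProduct (P.Fnormal c) (p - q) = - ((x - p) ⬝ᵥ crossProduct (P.Fnormal c) (q - p)) := by
    intro x; simp [cross_apply, dotProduct, Fin.sum_univ_three]; ring
  have hle : ∀ x ∈ P.Fhat c, P.cf (P.fvert c (i+1)) x ≤ 0 := fun x hx => P.mem_Rall.1 hx.2 _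
  have lin : ∀ p q : V3, p ≠ q → segment ℝ p q = P.Bhat (P.fvert c (i+1)) c →
      (∀ x ∈ P.Fhat c, 0 ≤ (x - p) ⬝ᵥ crossProduct (P.Fnormal c) (q - p)) →
      P.IsPosParamSeg (P.fvert c (i+1)) c (fun t => p + t • (q - p)) := by
    intro p q hpq hB h
    refine ⟨by fun_prop, ?_, ?_, ?_⟩
    · rw [← hB, segment_eq_image']
    · intro s _ t _ e
      simp only [add_right_inj] at e
      exact smul_left_injective ℝ (sub_ne_zero.2 hpq.symm) e
    · intro x hx; have := h x hx; simpa using this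
  rcases lt_or_gt_of_ne hk with hk | hk
  · refine ⟨p, q, Or.inl ⟨hp, hq⟩, lin p q hpq hB.symm fun x hx => ?_, ?_⟩
    · rw [hg x hx.1]; nlinarith [hle x hx]
    · intro z hz
      rcases seg_ends hpq hz.1 hz.2.2.1 (hz.2.1.trans hB) with h | h
      · exact h
      · exfalso
        have := hz.2.2.2 x0 hx0
        rw [h.1, h.2, hanti, hg x0 hx0.1] at this
        nlinarith
  · refine ⟨q, p, Or.inr ⟨hp, hq⟩, lin q p hpq.symm ?_ fun x hx => ?_, ?_⟩
    · rw [hB, segment_symm]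
    · rw [hanti, hg x hx.1]; nlinarith [hle x hx]
    · intro z hz
      rcases seg_ends hpq hz.1 hz.2.2.1 (hz.2.1.trans hB) with h | h
      · exfalso
        have := hz.2.2.2 x0 hx0
        rw [h.1, h.2, hg x0 hx0.1] at this
        nlinarith
      · exact h

theorem nonanti {n : V3 → V3} (hn : P.MemC0Phat n) {c i p q} (hp : p ∈ P.Ehat (P.fedge c i))
    (hq : q ∈ P.Ehat (P.fedge c (i+1))) : n q ≠ - n p := by
  have key : ∀ j x, x ∈ P.Ehat (P.fedge c j) → ∃ k : ℝ, n x = k • (P.vert (P.fvert c j) - P.vert (P.fvert c (j+1))) := by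
    intro j x hx
    obtain ⟨c', h1, h2⟩ := P.edge_other c (P.fedge c j)
    have d := (P.fvert_distinct c j).1
    refine perp_two_par h2 (hn.2.2 c x ⟨P.fedge_sub c j hx.1, hx.2⟩) (hn.2.2 c' x ⟨h1 hx.1, hx.2⟩)
      (P.face_diff (P.fv_face _ _) (P.fv_face _ _))
      (P.face_diff (h1 (P.fv_mem c j).1) (h1 (P.fv_mem c j).2)) (sub_ne_zero.2 fun h => d (P.vert_inj h))
  obtain ⟨k, hk⟩ := key i p hp
  obtain ⟨l, hl⟩ := key (i+1) q hq
  intro h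
  have hD := P.fdet c i
  have hp0 : n p ∈ sphereS := hn.2.1 p (P.Fhat_sub c ⟨P.fedge_sub c i hp.1, hp.2⟩)
  rw [hk, hl, show i + 1 + 1 = i + 2 from rfl] at h
  have h2 := congrArg (fun y => y ⬝ᵥ crossProduct (P.Fnormal c) (P.vert (P.fvert c (i+2)) - P.vert (P.fvert c (i+1)))) h
  simp only [smul_dotProduct, neg_dotProduct] at h2
  have h3 : (P.vert (P.fvert c (i+1)) - P.vert (P.fvert c (i+2))) ⬝ᵥ
      crossProduct (P.Fnormal c) (P.vert (P.fvert c (i+2)) - P.vert (P.fvert c (i+1))) = 0 := by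
    simp [cross_apply, dotProduct, Fin.sum_univ_three]; ring
  rw [h3] at h2
  simp at h2
  rcases h2 with h2 | h2
  · rw [h2, zero_smul] at hk
    exact sphere_ne_zero hp0 hk
  · exact hD (by simpa using h2)

end PolyCtx


/-- positively oriented orthonormal frame of the plane orthogonal to `N` -/
def IsFrame (N e₁ e₂ : V3) : Prop :=
  e₁ ⬝ᵥ e₁ = 1 ∧ e₂ ⬝ᵥ e₂ = 1 ∧ e₁ ⬝ᵥ e₂ = 0 ∧ crossProduct e₁ e₂ = N

/-- complex coordinate -/
def cc (e₁ e₂ v : V3) : ℂ := ⟨v ⬝ᵥ e₁, v ⬝ᵥ e₂⟩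

theorem exists_frame {N : V3} (hN : N ⬝ᵥ N = 1) : ∃ e₁ e₂, IsFrame N e₁ e₂ := by
  obtain ⟨u, hu⟩ : ∃ u, crossProduct N u ≠ 0 := by
    by_contra! h
    have h1 := h ![1,0,0]
    have h2 := h ![0,1,0]
    have a := congrFun h1 1
    have b := congrFun h1 2
    have c := congrFun h2 2
    simp [cross_apply] at a b c
    simp [dotProduct, Fin.sum_univ_three, a, b, c] at hN
  have hm := nrm_mem hu
  obtain ⟨k, hk⟩ : ∃ k : ℝ, nrm (crossProduct N u) = k • crossProduct N u := ⟨_, rfl⟩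
  have hp : nrm (crossProduct N u) ⬝ᵥ N = 0 := by
    rw [hk, smul_dotProduct]
    have : crossProduct N u ⬝ᵥ N = 0 := by
      simp [cross_apply, dotProduct, Fin.sum_univ_three]; ring
    rw [this, smul_zero]
  generalize nrm (crossProduct N u) = e at *
  have he : e ⬝ᵥ e = 1 := hm
  refine ⟨e, crossProduct N e, he, ?_, ?_, ?_⟩
  · have : crossProduct N e ⬝ᵥ crossProduct N e = (N ⬝ᵥ N) * (e ⬝ᵥ e) - (e ⬝ᵥ N)^2 := by
      simp [cross_apply, dotProduct, Fin.sum_univ_three]; ring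
    rw [this, hN, he, hp]; norm_num
  · simp [cross_apply, dotProduct, Fin.sum_univ_three]; ring
  · have : crossProduct e (crossProduct N e) = (e ⬝ᵥ e) • N - (e ⬝ᵥ N) • e := by
      ext i; fin_cases i <;> simp [cross_apply, dotProduct, Fin.sum_univ_three] <;> ring
    rw [this, he, hp]; simp

theorem IsFrame.perp {N e₁ e₂ : V3} (h : IsFrame N e₁ e₂) : e₁ ⬝ᵥ N = 0 ∧ e₂ ⬝ᵥ N = 0 := by
  rw [← h.2.2.2]
  constructor <;> simp [cross_apply, dotProduct, Fin.sum_univ_three] <;> ring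

theorem IsFrame.cross1 {N e₁ e₂ : V3} (h : IsFrame N e₁ e₂) : crossProduct N e₁ = e₂ := by
  have : crossProduct (crossProduct e₁ e₂) e₁ = (e₁ ⬝ᵥ e₁) • e₂ - (e₁ ⬝ᵥ e₂) • e₁ := by
    ext i; fin_cases i <;> simp [cross_apply, dotProduct, Fin.sum_univ_three] <;> ring
  rw [← h.2.2.2, this, h.1, h.2.2.1]; simp

theorem IsFrame.cross2 {N e₁ e₂ : V3} (h : IsFrame N e₁ e₂) : crossProduct N e₂ = - e₁ := by
  have : crossProduct (crossProduct e₁ e₂) e₂ = (e₁ ⬝ᵥ e₂) • e₂ - (e₂ ⬝ᵥ e₂) • e₁ := by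
    ext i; fin_cases i <;> simp [cross_apply, dotProduct, Fin.sum_univ_three] <;> ring
  rw [← h.2.2.2, this, h.2.1, h.2.2.1]; simp

theorem IsFrame.unit {N e₁ e₂ : V3} (h : IsFrame N e₁ e₂) : N ⬝ᵥ N = 1 := by
  have : crossProduct e₁ e₂ ⬝ᵥ crossProduct e₁ e₂ = (e₁ ⬝ᵥ e₁) * (e₂ ⬝ᵥ e₂) - (e₁ ⬝ᵥ e₂)^2 := by
    simp [cross_apply, dotProduct, Fin.sum_univ_three]; ring
  rw [← h.2.2.2, this, h.1, h.2.1, h.2.2.1]; norm_num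

theorem continuous_cc (e₁ e₂ : V3) : Continuous (cc e₁ e₂) := by
  have : cc e₁ e₂ = fun v => ((v ⬝ᵥ e₁ : ℝ) : ℂ) + ((v ⬝ᵥ e₂ : ℝ) : ℂ) * Complex.I := by
    funext v; simp [cc, Complex.ext_iff]
  rw [this]
  simp only [dotProduct, Fin.sum_univ_three]
  fun_prop

theorem cc_sub (e₁ e₂ v w : V3) : cc e₁ e₂ (v - w) = cc e₁ e₂ v - cc e₁ e₂ w := by
  apply Complex.ext <;> simp [cc, sub_dotProduct]
theorem cc_add (e₁ e₂ v w : V3) : cc e₁ e₂ (v + w) = cc e₁ e₂ v + cc e₁ e₂ w := by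
  apply Complex.ext <;> simp [cc, add_dotProduct]
theorem cc_smul (e₁ e₂ v : V3) (k : ℝ) : cc e₁ e₂ (k • v) = k * cc e₁ e₂ v := by
  apply Complex.ext <;> simp [cc, smul_dotProduct]

theorem IsFrame.decomp {N e₁ e₂ : V3} (h : IsFrame N e₁ e₂) {v : V3} (hv : v ⬝ᵥ N = 0) :
    v = (cc e₁ e₂ v).re • e₁ + (cc e₁ e₂ v).im • e₂ := by
  have hX : crossProduct N e₁ ≠ 0 := by
    rw [h.cross1]; intro h0; have := h.2.1; rw [h0] at this; simp at this
  have hN := h.unit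
  set w := v - ((cc e₁ e₂ v).re • e₁ + (cc e₁ e₂ v).im • e₂) with hw
  have w1 : w ⬝ᵥ N = 0 := by
    rw [hw, sub_dotProduct, add_dotProduct, smul_dotProduct, smul_dotProduct, h.perp.1, h.perp.2, hv]; simp
  have w2 : w ⬝ᵥ e₁ = 0 := by
    rw [hw, sub_dotProduct, add_dotProduct, smul_dotProduct, smul_dotProduct, h.1, dotProduct_comm e₂, h.2.2.1]; simp [cc]
  have w3 : w ⬝ᵥ e₂ = 0 := by
    rw [hw, sub_dotProduct, add_dotProduct, smul_dotProduct, smul_dotProduct, h.2.1, h.2.2.1]; simp [cc]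
  have := perp_two w1 w2
  rw [h.cross1, w3, h.2.1] at this
  have hz : w = 0 := by simpa using this
  exact sub_eq_zero.1 hz

theorem IsFrame.cc_inj {N e₁ e₂ : V3} (h : IsFrame N e₁ e₂) {v w : V3} (hv : v ⬝ᵥ N = 0) (hw : w ⬝ᵥ N = 0)
    (e : cc e₁ e₂ v = cc e₁ e₂ w) : v = w := by
  rw [h.decomp hv, h.decomp hw, e]

theorem IsFrame.cc_ne {N e₁ e₂ : V3} (h : IsFrame N e₁ e₂) {v : V3} (hv : v ⬝ᵥ N = 0) (h0 : v ≠ 0) :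
    cc e₁ e₂ v ≠ 0 := by
  intro e
  apply h0
  rw [h.decomp hv, e]; simp

theorem IsFrame.cc_comb {N e₁ e₂ : V3} (h : IsFrame N e₁ e₂) (a b : ℝ) :
    cc e₁ e₂ (a • e₁ + b • e₂) = a + b * Complex.I := by
  apply Complex.ext <;> simp [cc, add_dotProduct, smul_dotProduct, h.1, h.2.1, h.2.2.1, dotProduct_comm e₂ e₁]

theorem IsFrame.cc_cross {N e₁ e₂ : V3} (h : IsFrame N e₁ e₂) (v : V3) :
    cc e₁ e₂ (crossProduct N v) = Complex.I * cc e₁ e₂ v := by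
  have key : ∀ u w : V3, crossProduct N u ⬝ᵥ w = - (u ⬝ᵥ crossProduct N w) := by
    intro u w; simp [cross_apply, dotProduct, Fin.sum_univ_three]; ring
  apply Complex.ext <;> simp [cc, key, h.cross1, h.cross2]

theorem rot3_perp {F v : V3} (θ : ℝ) (hv : v ⬝ᵥ F = 0) :
    rot3 F θ v = Real.cos θ • v + Real.sin θ • crossProduct F v := by
  simp [rot3, dotProduct_comm F v, hv]

theorem IsFrame.cc_rot {N e₁ e₂ : V3} (h : IsFrame N e₁ e₂) {v : V3} (hv : v ⬝ᵥ N = 0) (θ : ℝ) :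
    cc e₁ e₂ (rot3 N θ v) = Complex.exp (θ * Complex.I) * cc e₁ e₂ v := by
  rw [rot3_perp θ hv, cc_add, cc_smul, cc_smul, h.cc_cross, Complex.exp_mul_I]
  push_cast; ring

theorem rot3_dot {F v : V3} (θ : ℝ) (hv : v ⬝ᵥ F = 0) : rot3 F θ v ⬝ᵥ F = 0 := by
  rw [rot3_perp θ hv, add_dotProduct, smul_dotProduct, smul_dotProduct, hv]
  have : crossProduct F v ⬝ᵥ F = 0 := by
    simp [cross_apply, dotProduct, Fin.sum_univ_three]; ring
  rw [this]; simp

theorem rot3_unit {F v : V3} (θ : ℝ) (hF : F ⬝ᵥ F = 1) (hv : v ⬝ᵥ F = 0) (hu : v ∈ sphereS) : rot3 F θ v ∈ sphereS := by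
  rw [rot3_perp θ hv]
  have h1 : v ⬝ᵥ v = 1 := hu
  show _ = _
  have h2 : v ⬝ᵥ crossProduct F v = 0 := by
    simp [cross_apply, dotProduct, Fin.sum_univ_three]; ring
  have h3 : crossProduct F v ⬝ᵥ crossProduct F v = 1 := by
    have : crossProduct F v ⬝ᵥ crossProduct F v = (F ⬝ᵥ F) * (v ⬝ᵥ v) - (v ⬝ᵥ F)^2 := by
      simp [cross_apply, dotProduct, Fin.sum_univ_three]; ring
    rw [this, hF, h1, hv]; norm_num
  simp only [add_dotProduct, dotProduct_add, smul_dotProduct, dotProduct_smul, h1, h2, h3, dotProduct_comm (crossProduct F v) v, smul_eq_mul]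
  linear_combination Real.sin_sq_add_cos_sq θ

theorem continuous_rot3 (F : V3) : Continuous (fun q : ℝ × V3 => rot3 F q.1 q.2) := by
  have h1 : Continuous (fun q : ℝ × V3 => crossProduct F q.2) :=
    (LinearMap.continuous_of_finiteDimensional (crossProduct F)).comp continuous_snd
  have h2 : Continuous (fun q : ℝ × V3 => F ⬝ᵥ q.2) := by
    simp only [dotProduct, Fin.sum_univ_three]; fun_prop
  simp only [rot3]
  fun_prop

theorem rot3_zero (F v : V3) : rot3 F 0 v = v := by simp [rot3]

theorem IsFrame.cc_norm {N e₁ e₂ : V3} (h : IsFrame N e₁ e₂) {v : V3} (hv : v ⬝ᵥ N = 0) :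
    ‖cc e₁ e₂ v‖ ^ 2 = v ⬝ᵥ v := by
  conv_rhs => rw [h.decomp hv]
  rw [← Complex.normSq_eq_norm_sq, Complex.normSq_apply]
  simp only [add_dotProduct, dotProduct_add, smul_dotProduct, dotProduct_smul, h.1, h.2.1, h.2.2.1, dotProduct_comm e₂ e₁, smul_eq_mul]
  ring


theorem star_gauge {Q : Set V3} (hQ : IsCompact Q) (hc : Convex ℝ Q) {x₀ : V3} (h0 : x₀ ∈ interior Q) :
    ∃ g : V3 → ℝ, Continuous g ∧ (∀ u, u ≠ 0 → 0 < g u) ∧ (∀ k : ℝ, 0 ≤ k → ∀ u, g (k • u) = k * g u) ∧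
      (∀ u, x₀ + u ∈ Q ↔ g u ≤ 1) ∧ (∀ u, x₀ + u ∈ frontier Q ↔ g u = 1) := by
  have e : (fun u => x₀ + u) = Homeomorph.addLeft x₀ := rfl
  set S := (fun u => x₀ + u) ⁻¹' Q with hS
  have hSc : Convex ℝ S := hc.translate_preimage_right x₀
  have hScl : IsClosed S := hQ.isClosed.preimage (by fun_prop)
  have hS0 : S ∈ nhds (0:V3) := by
    have : ContinuousAt (fun u => x₀ + u) (0:V3) := by fun_prop
    apply this
    simpa using mem_interior_iff_mem_nhds.1 h0
  have hSb : Bornology.IsVonNBounded ℝ S := by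
    have : IsCompact S := by
      rw [hS, e]; exact (Homeomorph.addLeft x₀).isCompact_preimage.2 hQ
    exact this.isVonNBounded ℝ
  refine ⟨gauge S, continuous_gauge hSc hS0, fun u hu => (gauge_pos (absorbent_nhds_zero hS0) hSb).2 hu,
    fun k hk u => by rw [gauge_smul_of_nonneg hk]; rfl, fun u => ?_, fun u => ?_⟩
  · rw [gauge_le_one_iff_mem_closure hSc hS0, hScl.closure_eq]; rfl
  · rw [gauge_eq_one_iff_mem_frontier hSc hS0, hS, e, ← (Homeomorph.addLeft x₀).preimage_frontier]
    rfl

namespace PolyCtx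
variable (P : PolyCtx)

theorem exists_ret : ∃ ret : V3 → V3, ContinuousOn ret P.PhatSet ∧
    (∀ x ∈ P.PhatSet, ret x ∈ P.PhatSet ∧ ((∃ c, ret x ∈ P.Fhat c) ∨ ∃ a, ret x ∈ P.Chat a)) ∧
    ∀ c, ∀ x ∈ P.Fhat c, ret x = x := by
  let a₀ : Fin P.nv := ⟨0, P.nv_pos⟩
  obtain ⟨x₀, hx0, hp, hneg⟩ := P.near_vert a₀
  let Q : Set V3 := P.Pbar ∩ ⋂ a : {a // a ≠ a₀}, {x | P.cf a.1 x ≤ 0}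
  have memQ : ∀ x, x ∈ Q ↔ x ∈ P.Pbar ∧ ∀ a, a ≠ a₀ → P.cf a x ≤ 0 := by
    intro x; simp [Q]
  have hQc : IsCompact Q := P.compact.inter_right
    (isClosed_iInter fun a => isClosed_le (P.continuous_cf _) continuous_const)
  have hQv : Convex ℝ Q := by
    refine P.convex.inter (convex_iInter fun a => ?_)
    rw [convex_iff_segment_subset]
    intro x hx y hy z hz
    rw [segment_eq_image'] at hz
    obtain ⟨t, ht, rfl⟩ := hz
    simp only [mem_ofPred_eq] at *
    rw [cf_comb]
    nlinarith [ht.1, ht.2]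
  have intQ : ∀ y ∈ interior P.Pbar, (∀ a, a ≠ a₀ → P.cf a y < 0) → y ∈ interior Q := by
    intro y hy h
    have ho : IsOpen (interior P.Pbar ∩ ⋂ a : {a // a ≠ a₀}, {x | P.cf a.1 x < 0}) :=
      isOpen_interior.inter (isOpen_iInter_of_finite fun a => isOpen_lt (P.continuous_cf _) continuous_const)
    refine mem_interior.2 ⟨_, ?_, ho, hy, by simpa using h⟩
    rintro x ⟨h1, h2⟩
    rw [memQ]
    simp only [mem_iInter, mem_ofPred_eq, Subtype.forall] at h2
    exact ⟨interior_subset h1, fun a ha => (h2 a ha).le⟩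
  obtain ⟨g, gc, gp, gs, gQ, gf⟩ := star_gauge hQc hQv (intQ x₀ hx0 hneg)
  have hne : ∀ x ∈ P.PhatSet, x - x₀ ≠ 0 := by
    intro x hx h
    rw [Phat_eq] at hx
    have := P.mem_Rall.1 hx.2 a₀
    rw [sub_eq_zero.1 h] at this
    linarith
  have hPQ : P.PhatSet ⊆ Q := by
    intro x hx; rw [Phat_eq] at hx; rw [memQ]; exact ⟨hx.1, fun a _ => P.mem_Rall.1 hx.2 a⟩
  refine ⟨fun x => x₀ + (g (x - x₀))⁻¹ • (x - x₀), ?_, ?_, ?_⟩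
  · have hc2 : Continuous fun x : V3 => x - x₀ := by fun_prop
    have hc3 : ContinuousOn (fun x : V3 => g (x - x₀)) P.PhatSet := (gc.comp hc2).continuousOn
    have hc4 := hc3.inv₀ (fun x hx => (gp _ (hne x hx)).ne')
    exact continuousOn_const.add (hc4.smul hc2.continuousOn)
  · intro x hx
    have hg := gp _ (hne x hx)
    have hle : g (x - x₀) ≤ 1 := (gQ _).1 (by simpa using hPQ hx)
    simp only
    set k := (g (x - x₀))⁻¹ with hk
    have hk1 : 1 ≤ k := (one_le_inv₀ hg).2 hle
    have h1 : g (k • (x - x₀)) = 1 := by rw [gs _ (by positivity)]; exact inv_mul_cancel₀ hg.ne'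
    have hfr := (gf _).2 h1
    have hin := (gQ _).2 h1.le
    have hR : x₀ + k • (x - x₀) ∈ P.Rall := by
      rw [mem_Rall]; intro a
      by_cases ha : a = a₀
      · subst ha
        rw [Phat_eq] at hx
        have := P.mem_Rall.1 hx.2 a₀
        rw [cf_comb]; nlinarith
      · exact ((memQ _).1 hin).2 a ha
    have hB := ((memQ _).1 hin).1
    refine ⟨by rw [Phat_eq]; exact ⟨hB, hR⟩, ?_⟩
    by_cases hF : x₀ + k • (x - x₀) ∈ frontier P.Pbar
    · left
      rw [P.frontier_eq, mem_iUnion] at hF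
      obtain ⟨c, hc⟩ := hF
      exact ⟨c, hc, hR⟩
    · right
      by_contra! hC
      apply hfr.2
      apply intQ _ (P.mem_interior_of hB hF)
      intro a _
      refine lt_of_le_of_ne (P.mem_Rall.1 hR a) fun h => hC a (P.mem_Chat.2 ⟨hB, h⟩)
  · intro c x hx
    have hq := hPQ (P.Fhat_sub c hx)
    have : x₀ + (x - x₀) ∈ frontier Q := by
      rw [add_sub_cancel]
      refine ⟨subset_closure hq, fun h => ?_⟩
      have h2 : x ∈ frontier P.Pbar := by rw [P.frontier_eq]; exact mem_iUnion.2 ⟨c, hx.1⟩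
      exact h2.2 (interior_mono (fun x hx => ((memQ x).1 hx).1) h)
    simp only
    rw [(gf _).1 this]; simp

theorem exists_loop (a) {e₁ e₂ : V3} (he : IsFrame (P.Cnormal a) e₁ e₂) :
    ∃ ctr : V3, ctr ∈ interior P.Pbar ∧ ctr ∈ P.Chat a ∧ ctr ∉ P.bdChat a ∧ ∃ z₀ : ℂ → V3,
      ContinuousOn z₀ {ζ | ‖ζ‖ = 1} ∧ (∀ ζ : ℂ, ‖ζ‖ = 1 → z₀ ζ ∈ P.bdChat a) ∧
      (∀ x ∈ P.bdChat a, z₀ (cc e₁ e₂ (x - ctr) / ‖cc e₁ e₂ (x - ctr)‖) = x) ∧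
      PosLoopParam (P.Cnormal a) ctr (fun β => z₀ (Complex.exp (β * Complex.I))) ∧
      Set.range (fun β : ℝ => z₀ (Complex.exp (β * Complex.I))) = P.bdChat a := by
  obtain ⟨ctr, hi, hc0⟩ := P.plane_point a
  have hC : ctr ∈ P.Chat a := P.mem_Chat.2 ⟨interior_subset hi, hc0⟩
  have hnb : ctr ∉ P.bdChat a := fun h => P.not_frontier hi (P.mem_bdChat.1 h).2
  obtain ⟨g, gc, gp, gs, gQ, gf⟩ := star_gauge P.compact P.convex hi
  let u : ℂ → V3 := fun ζ => ζ.re • e₁ + ζ.im • e₂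
  have uc : Continuous u := by simp only [u]; fun_prop
  have ucc : ∀ ζ, cc e₁ e₂ (u ζ) = ζ := fun ζ => by simp only [u]; rw [he.cc_comb]; exact Complex.re_add_im ζ
  have u0 : ∀ ζ : ℂ, ‖ζ‖ = 1 → u ζ ≠ 0 := by
    intro ζ h h0
    have := ucc ζ
    rw [h0] at this
    rw [← this] at h
    simp [cc] at h
    rw [show (⟨0,0⟩ : ℂ) = 0 from rfl] at h
    simp at h
  have uN : ∀ ζ, u ζ ⬝ᵥ P.Cnormal a = 0 := by
    intro ζ; simp [u, add_dotProduct, smul_dotProduct, he.perp.1, he.perp.2]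
  have bne : ∀ x ∈ P.bdChat a, x - ctr ≠ 0 := fun x hx h => hnb (sub_eq_zero.1 h ▸ hx)
  have bN : ∀ x ∈ P.Chat a, (x - ctr) ⬝ᵥ P.Cnormal a = 0 := by
    intro x hx
    have h1 := (P.mem_Chat.1 hx).2
    unfold cf at h1 hc0
    rw [show x - ctr = (x - P.cpt a) - (ctr - P.cpt a) by module, sub_dotProduct, h1, hc0, sub_zero]
  have hz : ∀ ζ : ℂ, ‖ζ‖ = 1 → ctr + (g (u ζ))⁻¹ • u ζ ∈ P.bdChat a := by
    intro ζ h
    have hg := gp _ (u0 ζ h)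
    have hf : ctr + (g (u ζ))⁻¹ • u ζ ∈ frontier P.Pbar := by
      rw [gf, gs _ (by positivity)]; exact inv_mul_cancel₀ hg.ne'
    refine P.mem_bdChat.2 ⟨P.mem_Chat.2 ⟨P.compact.isClosed.frontier_subset hf, ?_⟩, hf⟩
    unfold cf at hc0 ⊢
    rw [show ctr + (g (u ζ))⁻¹ • u ζ - P.cpt a = (ctr - P.cpt a) + (g (u ζ))⁻¹ • u ζ by module,
      add_dotProduct, smul_dotProduct, uN, hc0]; simp
  have cne : ∀ x ∈ P.bdChat a, cc e₁ e₂ (x - ctr) ≠ 0 := fun x hx => he.cc_ne (bN x (P.bdChat_sub a hx)) (bne x hx)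
  have hD : ∀ x ∈ P.bdChat a, ctr + (g (u (cc e₁ e₂ (x - ctr) / ‖cc e₁ e₂ (x - ctr)‖)))⁻¹ • u (cc e₁ e₂ (x - ctr) / ‖cc e₁ e₂ (x - ctr)‖) = x := by
    intro x hx
    have hp : 0 < ‖cc e₁ e₂ (x - ctr)‖ := norm_pos_iff.2 (cne x hx)
    have : u (cc e₁ e₂ (x - ctr) / ‖cc e₁ e₂ (x - ctr)‖) = (‖cc e₁ e₂ (x - ctr)‖)⁻¹ • (x - ctr) := by
      refine he.cc_inj (uN _) ?_ ?_
      · rw [smul_dotProduct, bN x (P.bdChat_sub a hx), smul_zero]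
      · rw [ucc, cc_smul]; push_cast; field_simp
    rw [this, gs _ (by positivity)]
    have h1 : g (x - ctr) = 1 := (gf _).1 (by simpa using (P.mem_bdChat.1 hx).2)
    rw [h1, mul_one, inv_inv, smul_smul, mul_inv_cancel₀ hp.ne', one_smul, add_sub_cancel]
  have ec : ∀ β : ℝ, ‖Complex.exp (β * Complex.I)‖ = 1 := fun β => Complex.norm_exp_ofReal_mul_I β
  have z0c : ContinuousOn (fun ζ => ctr + (g (u ζ))⁻¹ • u ζ) {ζ | ‖ζ‖ = 1} := by
    refine continuousOn_const.add (ContinuousOn.smul (ContinuousOn.inv₀ (gc.comp uc).continuousOn ?_) uc.continuousOn)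
    intro ζ h; exact (gp _ (u0 ζ h)).ne'
  refine ⟨ctr, hi, hC, hnb, fun ζ => ctr + (g (u ζ))⁻¹ • u ζ, z0c, hz, hD, ⟨?_, ?_, e₁, e₂, he.1, he.2.1, he.2.2.1, he.2.2.2,
     fun φ => φ, fun φ => (g (u (Complex.exp (φ * Complex.I))))⁻¹, continuous_id, monotone_id, fun _ => rfl, ?_, ?_⟩, ?_⟩
  · exact z0c.comp_continuous (f := fun β : ℝ => Complex.exp (β * Complex.I)) (by fun_prop) ec
  · intro φ
    have : Complex.exp (((φ + 2 * Real.pi : ℝ) : ℂ) * Complex.I) = Complex.exp (φ * Complex.I) := by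
      push_cast
      rw [add_mul, Complex.exp_add, Complex.exp_two_pi_mul_I, mul_one]
    simp only
    rw [this]
  · intro φ; exact inv_pos.2 (gp _ (u0 _ (ec φ)))
  · intro φ
    simp only [u, Complex.exp_ofReal_mul_I_re, Complex.exp_ofReal_mul_I_im]
  · apply Subset.antisymm
    · rintro _ ⟨β, rfl⟩; exact hz _ (ec β)
    · intro x hx
      refine ⟨Complex.arg (cc e₁ e₂ (x - ctr)), ?_⟩
      have : Complex.exp (Complex.arg (cc e₁ e₂ (x - ctr)) * Complex.I) = cc e₁ e₂ (x - ctr) / ‖cc e₁ e₂ (x - ctr)‖ := by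
        have h := Complex.norm_mul_exp_arg_mul_I (cc e₁ e₂ (x - ctr))
        have hp : ((‖cc e₁ e₂ (x - ctr)‖ : ℝ) : ℂ) ≠ 0 := by
          exact_mod_cast (norm_pos_iff.2 (cne x hx)).ne'
        rw [eq_div_iff hp, mul_comm]; exact h
      simp only
      rw [this]; exact hD x hx

end PolyCtx


theorem dot_lt_one {p v : V3} (hp : p ∈ sphereS) (hv : v ∈ sphereS) (h : v ≠ p) : p ⬝ᵥ v < 1 := by
  have h1 := dot_self_pos (sub_ne_zero.2 h)
  have hp' : p ⬝ᵥ p = 1 := hp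
  have hv' : v ⬝ᵥ v = 1 := hv
  simp only [sub_dotProduct, dotProduct_sub, hp', hv', dotProduct_comm v p] at h1
  linarith

theorem neg_one_lt_dot {p v : V3} (hp : p ∈ sphereS) (hv : v ∈ sphereS) (h : v ≠ -p) : -1 < p ⬝ᵥ v := by
  have h1 := dot_self_pos (sub_ne_zero.2 h)
  have hp' : p ⬝ᵥ p = 1 := hp
  have hv' : v ⬝ᵥ v = 1 := hv
  simp only [sub_dotProduct, dotProduct_sub, dotProduct_neg, neg_dotProduct, hp', hv', dotProduct_comm v p] at h1
  linarith

theorem sphere_coord {w : V3} {r : ℝ} (hr : 0 ≤ r) (h : w ⬝ᵥ w = r ^ 2) : ‖w‖ ≤ r := by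
  rw [pi_norm_le_iff_of_nonneg hr]
  intro i
  rw [Real.norm_eq_abs]
  apply abs_le_of_sq_le_sq _ hr
  rw [← h, dotProduct, Fin.sum_univ_three]
  fin_cases i <;> simp <;> nlinarith [sq_nonneg (w 0), sq_nonneg (w 1), sq_nonneg (w 2)]


theorem sin_arccos_pos {p v : V3} (hp : p ∈ sphereS) (hv : v ∈ sphereS) (h1 : v ≠ p) (h2 : v ≠ -p)
    : 0 < Real.sin (Real.arccos (p ⬝ᵥ v)) := by
  rw [Real.sin_arccos]
  have := dot_lt_one hp hv h1
  have := neg_one_lt_dot hp hv h2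
  apply Real.sqrt_pos.2
  nlinarith

theorem cos_arccos_dot {p v : V3} (hp : p ∈ sphereS) (hv : v ∈ sphereS) (h1 : v ≠ p) (h2 : v ≠ -p)
    : Real.cos (Real.arccos (p ⬝ᵥ v)) = p ⬝ᵥ v :=
  Real.cos_arccos (neg_one_lt_dot hp hv h2).le (dot_lt_one hp hv h1).le

theorem geo_eq {p v : V3} (hp : p ∈ sphereS) (hv : v ∈ sphereS) (h1 : v ≠ p) (h2 : v ≠ -p)
    (ρ : ℝ) : geo p v ρ = Real.cos (ρ * Real.arccos (p ⬝ᵥ v)) • p +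
    (Real.sin (ρ * Real.arccos (p ⬝ᵥ v)) / Real.sin (Real.arccos (p ⬝ᵥ v))) • (v - (p ⬝ᵥ v) • p) := by
  have hs := sin_arccos_pos hp hv h1 h2
  have hc := cos_arccos_dot hp hv h1 h2
  rw [geo, if_neg h1.symm, sub_mul, one_mul, Real.sin_sub, hc]
  generalize Real.arccos (p ⬝ᵥ v) = α at *
  rw [sub_div, mul_div_assoc, mul_comm (Real.sin α), div_mul_cancel₀ _ hs.ne']
  module

theorem geo_orth {p v : V3} (hp : p ∈ sphereS)
    : p ⬝ᵥ (v - (p ⬝ᵥ v) • p) = 0 := by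
  have hp' : p ⬝ᵥ p = 1 := hp
  rw [dotProduct_sub, dotProduct_smul, hp']; simp

theorem geo_wsq {p v : V3} (hp : p ∈ sphereS) (hv : v ∈ sphereS) (h1 : v ≠ p) (h2 : v ≠ -p)
    : (v - (p ⬝ᵥ v) • p) ⬝ᵥ (v - (p ⬝ᵥ v) • p) = Real.sin (Real.arccos (p ⬝ᵥ v)) ^ 2 := by
  have hp' : p ⬝ᵥ p = 1 := hp
  have hv' : v ⬝ᵥ v = 1 := hv
  rw [Real.sin_sq, cos_arccos_dot hp hv h1 h2]
  simp only [dotProduct_sub, sub_dotProduct, dotProduct_smul, smul_dotProduct, hp', hv', smul_eq_mul, dotProduct_comm v p]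
  ring

theorem geo_mem {p v : V3} (hp : p ∈ sphereS) (hv : v ∈ sphereS) (h1 : v ≠ p) (h2 : v ≠ -p)
    (ρ : ℝ) : geo p v ρ ∈ sphereS := by
  have hs := sin_arccos_pos hp hv h1 h2
  have ho := geo_orth (v := v) hp
  have hw := geo_wsq hp hv h1 h2
  rw [geo_eq hp hv h1 h2]
  generalize v - (p ⬝ᵥ v) • p = w at *
  have hp' : p ⬝ᵥ p = 1 := hp
  show _ = _
  simp only [dotProduct_add, add_dotProduct, dotProduct_smul, smul_dotProduct, hp', ho, hw, smul_eq_mul, dotProduct_comm w p]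
  have := Real.sin_sq_add_cos_sq (ρ * Real.arccos (p ⬝ᵥ v))
  field_simp
  linear_combination Real.sin (Real.arccos (p ⬝ᵥ v)) * this

theorem geo_one {p v : V3} (hp : p ∈ sphereS) (hv : v ∈ sphereS) (h1 : v ≠ p) (h2 : v ≠ -p)
    : geo p v 1 = v := by
  have hs := sin_arccos_pos hp hv h1 h2
  rw [geo, if_neg h1.symm]
  simp [div_self hs.ne']

theorem geo_dist {p v : V3} (hp : p ∈ sphereS) (hv : v ∈ sphereS) (h1 : v ≠ p) (h2 : v ≠ -p)
    {ρ : ℝ} (hρ : 0 ≤ ρ) : ‖geo p v ρ - p‖ ≤ 2 * Real.pi * ρ := by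
  have hs := sin_arccos_pos hp hv h1 h2
  have hw := sphere_coord hs.le (geo_wsq hp hv h1 h2)
  rw [geo_eq hp hv h1 h2]
  have ha := Real.arccos_nonneg (p ⬝ᵥ v)
  have hb := Real.arccos_le_pi (p ⬝ᵥ v)
  have hpn : ‖p‖ ≤ 1 := sphere_coord zero_le_one (by rw [show p ⬝ᵥ p = 1 from hp]; norm_num)
  generalize v - (p ⬝ᵥ v) • p = w at *
  generalize Real.arccos (p ⬝ᵥ v) = α at *
  have e : Real.cos (ρ * α) • p + (Real.sin (ρ * α) / Real.sin α) • w - p =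
    (Real.cos (ρ * α) - 1) • p + (Real.sin (ρ * α) / Real.sin α) • w := by module
  have hra : ρ * α ≤ Real.pi * ρ := by nlinarith
  have hra0 : 0 ≤ ρ * α := by positivity
  have k1 : |Real.sin (ρ * α)| ≤ ρ * α := by
    have := Real.abs_sin_le_abs (x := ρ * α); rwa [abs_of_nonneg hra0] at this
  have k2 : |Real.cos (ρ * α) - 1| ≤ ρ * α := by
    have := Real.abs_cos_sub_cos_le (ρ * α) 0
    rwa [Real.cos_zero, sub_zero, abs_of_nonneg hra0] at this
  rw [e]
  refine (norm_add_le _ _).trans ?_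
  rw [norm_smul, norm_smul, Real.norm_eq_abs, Real.norm_eq_abs, abs_div, abs_of_pos hs]
  have m1 : |Real.cos (ρ * α) - 1| * ‖p‖ ≤ ρ * α := by
    calc _ ≤ |Real.cos (ρ * α) - 1| * 1 := by gcongr
      _ ≤ _ := by linarith
  have m2 : |Real.sin (ρ * α)| / Real.sin α * ‖w‖ ≤ ρ * α := by
    calc _ ≤ |Real.sin (ρ * α)| / Real.sin α * Real.sin α := by gcongr
      _ = |Real.sin (ρ * α)| := div_mul_cancel₀ _ hs.ne'
      _ ≤ _ := k1
  linarith

theorem geo_ne {p v : V3} (hp : p ∈ sphereS) (hv : v ∈ sphereS) (h1 : v ≠ p) (h2 : v ≠ -p)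
    {ρ : ℝ} (hρ : 0 ≤ ρ) (hρ1 : ρ ≤ 1) : geo p v ρ ≠ -p := by
  intro h
  have ho := geo_orth (v := v) hp
  have hp' : p ⬝ᵥ p = 1 := hp
  have hlt : Real.arccos (p ⬝ᵥ v) < Real.pi := by
    rcases (Real.arccos_le_pi (p ⬝ᵥ v)).lt_or_eq with h | h
    · exact h
    · have := Real.arccos_eq_pi.1 h
      linarith [neg_one_lt_dot hp hv h2]
  have ha := Real.arccos_nonneg (p ⬝ᵥ v)
  rw [geo_eq hp hv h1 h2] at h
  have := congrArg (fun y => p ⬝ᵥ y) h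
  simp only [dotProduct_add, dotProduct_smul, ho, hp', dotProduct_neg, smul_eq_mul, mul_one, mul_zero, add_zero] at this
  have hl : ρ * Real.arccos (p ⬝ᵥ v) < Real.pi := by nlinarith
  have h3 := Real.strictAntiOn_cos ⟨by positivity, hl.le⟩ ⟨Real.pi_pos.le, le_rfl⟩ hl
  rw [Real.cos_pi] at h3
  linarith
theorem geo_continuousOn {p : V3} (hp : p ∈ sphereS) :
    ContinuousOn (fun q : V3 × ℝ => geo p q.1 q.2) ({v | v ∈ sphereS ∧ v ≠ p ∧ v ≠ -p} ×ˢ univ) := by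
  have hd : Continuous (fun q : V3 × ℝ => p ⬝ᵥ q.1) := by simp only [dotProduct, Fin.sum_univ_three]; fun_prop
  have ha : Continuous (fun q : V3 × ℝ => Real.arccos (p ⬝ᵥ q.1)) := Real.continuous_arccos.comp hd
  have hs : ContinuousOn (fun q : V3 × ℝ => Real.sin (q.2 * Real.arccos (p ⬝ᵥ q.1)) / Real.sin (Real.arccos (p ⬝ᵥ q.1)))
     ({v | v ∈ sphereS ∧ v ≠ p ∧ v ≠ -p} ×ˢ univ) := by
    apply ContinuousOn.div
    · exact (Real.continuous_sin.comp (continuous_snd.mul ha)).continuousOn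
    · exact (Real.continuous_sin.comp ha).continuousOn
    · rintro ⟨v, ρ⟩ ⟨⟨h0, h1, h2⟩, -⟩
      exact (sin_arccos_pos hp h0 h1 h2).ne'
  have h1 : Continuous (fun q : V3 × ℝ => Real.cos (q.2 * Real.arccos (p ⬝ᵥ q.1)) • p) := by fun_prop
  have h2 : Continuous (fun q : V3 × ℝ => q.1 - (p ⬝ᵥ q.1) • p) := by fun_prop
  refine (h1.continuousOn.add (hs.smul h2.continuousOn)).congr ?_
  rintro ⟨v, ρ⟩ ⟨⟨h0, h1, h2⟩, -⟩
  exact geo_eq hp h0 h1 h2 ρ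

theorem cone_cont {f : ℂ → V3} (hf : ContinuousOn f {ζ | ζ ≠ 0}) {B : ℝ} (hb : ∀ ζ, ‖f ζ‖ ≤ B) :
    Continuous (fun ζ : ℂ => ‖ζ‖ • f ζ) := by
  rw [continuous_iff_continuousAt]
  intro ζ
  by_cases h : ζ = 0
  · subst h
    rw [ContinuousAt]
    simp only [norm_zero, zero_smul]
    apply squeeze_zero_norm (a := fun ζ : ℂ => ‖ζ‖ * B)
    · intro ζ
      rw [norm_smul, norm_norm]
      exact mul_le_mul_of_nonneg_left (hb ζ) (norm_nonneg _)
    · have : Continuous (fun ζ : ℂ => ‖ζ‖ * B) := by fun_prop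
      simpa using this.tendsto 0
  · have : ContinuousAt f ζ := hf.continuousAt (isOpen_ne.mem_nhds h)
    exact continuous_norm.continuousAt.smul this


/-- the disk coordinate map -/
def ymap (z : ℝ → V3) (ctr : V3) (x : V3) : V3 :=
  ‖zeta x‖ • z (Complex.arg (zeta x)) + (1 - ‖zeta x‖) • ctr

theorem sqrt_zeta (x : V3) : Real.sqrt ((x 0) ^ 2 + (x 1) ^ 2) = ‖zeta x‖ := by
  rw [show (x 0) ^ 2 + (x 1) ^ 2 = ‖zeta x‖ ^ 2 by rw [zeta_norm_sq]; ring]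
  exact Real.sqrt_sq (norm_nonneg _)

theorem wrap_up {n z ctr s} {x : V3} (h : 0 ≤ x 2) : wrapMap n z ctr s x = n (ymap z ctr x) := by
  rw [wrapMap, if_pos h, sqrt_zeta]; rfl

theorem wrap_low {n z ctr s} {x : V3} (h : ¬ 0 ≤ x 2) :
    wrapMap n z ctr s x = geo (-s) (n (z (Complex.arg (zeta x)))) ‖zeta x‖ := by
  rw [wrapMap, if_neg h, sqrt_zeta]; rfl

theorem zeta_le {x : V3} (hx : x ∈ sphereS) : ‖zeta x‖ ≤ 1 := by
  have h := zeta_norm_sq x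
  have : x ⬝ᵥ x = 1 := hx
  rw [dotProduct, Fin.sum_univ_three] at this
  nlinarith [norm_nonneg (zeta x), mul_self_nonneg (x 2)]

theorem zeta_eq_one {x : V3} (hx : x ∈ sphereS) (h2 : x 2 = 0) : ‖zeta x‖ = 1 := by
  have h := zeta_norm_sq x
  have : x ⬝ᵥ x = 1 := hx
  rw [dotProduct, Fin.sum_univ_three, h2] at this
  have h3 : ‖zeta x‖ ^ 2 = 1 := by linarith
  exact (pow_eq_one_iff_of_nonneg (norm_nonneg _) two_ne_zero).1 h3

theorem ymap_cont {z : ℝ → V3} (hz : Continuous z) (hp : ∀ φ, z (φ + 2 * Real.pi) = z φ) {C : Set V3}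
    (hC : IsCompact C) (hzC : ∀ φ, z φ ∈ C) (ctr : V3) : Continuous (ymap z ctr) := by
  obtain ⟨B, hB⟩ := hC.isBounded.exists_norm_le
  have := cone_cont (periodic_arg hz hp) (B := B) (fun ζ => hB _ (hzC _))
  have h2 : Continuous (fun x => ‖zeta x‖ • z (Complex.arg (zeta x))) := this.comp continuous_zeta
  have h3 := continuous_zeta
  unfold ymap
  fun_prop

theorem ymap_mem {z : ℝ → V3} {C : Set V3} (hC : Convex ℝ C) (hzC : ∀ φ, z φ ∈ C) {ctr : V3} (hc : ctr ∈ C)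
    {x : V3} (hx : x ∈ sphereS) : ymap z ctr x ∈ C :=
  hC (hzC _) hc (norm_nonneg _) (sub_nonneg.2 (zeta_le hx)) (by ring)

theorem geo_joint {T : Set ℝ} {H : ℝ → V3 → V3} {C : Set V3} {s : V3} (hs : s ∈ sphereS)
    (hH : ContinuousOn (fun q : ℝ × V3 => H q.1 q.2) (T ×ˢ C))
    (hS : ∀ t ∈ T, ∀ x ∈ C, H t x ∈ sphereS)
    {z : ℝ → V3} (hz : Continuous z) (hp : ∀ φ, z (φ + 2 * Real.pi) = z φ) (hzC : ∀ φ, z φ ∈ C)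
    (hne : ∀ t ∈ T, ∀ φ, H t (z φ) ≠ s ∧ H t (z φ) ≠ -s) :
    ContinuousOn (fun q : ℝ × V3 => geo (-s) (H q.1 (z (Complex.arg (zeta q.2)))) ‖zeta q.2‖) (T ×ˢ univ) := by
  have hs' : -s ∈ sphereS := by
    have : s ⬝ᵥ s = 1 := hs
    show _ = _
    simpa using this
  rintro ⟨t, x⟩ ⟨ht, -⟩
  have ht : t ∈ T := ht
  by_cases h : zeta x = 0
  · rw [ContinuousWithinAt, tendsto_iff_norm_sub_tendsto_zero]
    simp only [h]
    have e : geo (-s) (H t (z (Complex.arg 0))) ‖(0:ℂ)‖ = -s := by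
      have := hne t ht (Complex.arg 0)
      have := geo_dist hs' (hS t ht _ (hzC (Complex.arg 0))) this.2 (by rw [neg_neg]; exact this.1) (ρ := ‖(0:ℂ)‖) (norm_nonneg _)
      rw [norm_zero, mul_zero] at this
      rw [norm_zero]
      exact sub_eq_zero.1 (norm_le_zero_iff.1 this)
    rw [e]
    have c1 : Continuous (fun q : ℝ × V3 => 2 * Real.pi * ‖zeta q.2‖) := by
      have := continuous_zeta; fun_prop
    refine squeeze_zero' (g := fun q : ℝ × V3 => 2 * Real.pi * ‖zeta q.2‖) (Filter.Eventually.of_forall fun _ => norm_nonneg _) ?_ ?_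
    · filter_upwards [self_mem_nhdsWithin] with q hq
      have := hne q.1 hq.1 (Complex.arg (zeta q.2))
      exact geo_dist hs' (hS q.1 hq.1 _ (hzC _)) this.2 (by rw [neg_neg]; exact this.1) (norm_nonneg _)
    · have := c1.continuousWithinAt (s := T ×ˢ univ) (x := (t, x))
      rw [ContinuousWithinAt] at this
      simpa [h] using this
  · have c0 : ContinuousOn (fun q : ℝ × V3 => z (Complex.arg (zeta q.2))) (T ×ˢ {x | zeta x ≠ 0}) := by
      have h1 : ContinuousOn (fun q : ℝ × V3 => zeta q.2) (T ×ˢ {x | zeta x ≠ 0}) :=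
        (continuous_zeta.comp continuous_snd).continuousOn
      exact (periodic_arg hz hp).comp (f := fun q : ℝ × V3 => zeta q.2) h1 (fun q hq => hq.2)
    have c1 : ContinuousOn (fun q : ℝ × V3 => H q.1 (z (Complex.arg (zeta q.2)))) (T ×ˢ {x | zeta x ≠ 0}) :=
      hH.comp (f := fun q : ℝ × V3 => (q.1, z (Complex.arg (zeta q.2)))) (continuousOn_fst.prodMk c0)
        (fun q hq => ⟨hq.1, hzC _⟩)
    have c2 : ContinuousOn (fun q : ℝ × V3 => ‖zeta q.2‖) (T ×ˢ {x | zeta x ≠ 0}) := by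
      have := continuous_zeta
      exact Continuous.continuousOn (by fun_prop)
    have c3 := (geo_continuousOn hs').comp (f := fun q : ℝ × V3 => (H q.1 (z (Complex.arg (zeta q.2))), ‖zeta q.2‖))
      (c1.prodMk c2) (fun q hq => ⟨⟨hS q.1 hq.1 _ (hzC _), (hne q.1 hq.1 _).2, by rw [neg_neg]; exact (hne q.1 hq.1 _).1⟩, mem_univ _⟩)
    have c4 := c3 (t, x) ⟨ht, h⟩
    refine c4.mono_of_mem_nhdsWithin ?_
    have ho : IsOpen {q : ℝ × V3 | zeta q.2 ≠ 0} :=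
      isOpen_ne.preimage (continuous_zeta.comp continuous_snd)
    filter_upwards [self_mem_nhdsWithin, mem_nhdsWithin_of_mem_nhds (ho.mem_nhds h)] with q h1 h2
    exact ⟨h1.1, h2⟩

theorem wrap_joint {T : Set ℝ} (hT : IsClosed T) {H : ℝ → V3 → V3} {C : Set V3} (hC : IsCompact C) (hCv : Convex ℝ C)
    {s : V3} (hs : s ∈ sphereS)
    (hH : ContinuousOn (fun q : ℝ × V3 => H q.1 q.2) (T ×ˢ C))
    (hS : ∀ t ∈ T, ∀ x ∈ C, H t x ∈ sphereS)
    {z : ℝ → V3} (hz : Continuous z) (hp : ∀ φ, z (φ + 2 * Real.pi) = z φ) (hzC : ∀ φ, z φ ∈ C)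
    {ctr : V3} (hc : ctr ∈ C)
    (hne : ∀ t ∈ T, ∀ φ, H t (z φ) ≠ s ∧ H t (z φ) ≠ -s) :
    ContinuousOn (fun q : ℝ × V3 => wrapMap (H q.1) z ctr s q.2) (T ×ˢ sphereS) ∧
    (∀ t ∈ T, MapsTo (wrapMap (H t) z ctr s) sphereS sphereS) ∧
    (∀ t ∈ T, ∀ x ∈ sphereS, x 2 ≤ 0 → wrapMap (H t) z ctr s x ≠ s) := by
  have hs' : -s ∈ sphereS := by
    have : s ⬝ᵥ s = 1 := hs
    show _ = _
    simpa using this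
  have gj := geo_joint hs hH hS hz hp hzC hne
  have hlow : ∀ t ∈ T, ∀ x ∈ sphereS, x 2 ≤ 0 → wrapMap (H t) z ctr s x = geo (-s) (H t (z (Complex.arg (zeta x)))) ‖zeta x‖ := by
    intro t ht x hx h
    by_cases h0 : 0 ≤ x 2
    · have hone := zeta_eq_one hx (le_antisymm h h0)
      rw [wrap_up h0, ymap, hone]
      have := hne t ht (Complex.arg (zeta x))
      rw [geo_one hs' (hS t ht _ (hzC _)) this.2 (by rw [neg_neg]; exact this.1)]
      simp
    · exact wrap_low h0
  have c2 : Continuous (fun x : V3 => x 2) := by fun_prop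
  refine ⟨?_, ?_, ?_⟩
  · have e : T ×ˢ sphereS = (T ×ˢ (sphereS ∩ {x : V3 | 0 ≤ x 2})) ∪ (T ×ˢ (sphereS ∩ {x : V3 | x 2 ≤ 0})) := by
      rw [← prod_union, ← inter_union_distrib_left]
      congr 1
      symm; apply inter_eq_left.2
      intro x _; exact le_total 0 (x 2)
    rw [e]
    apply ContinuousOn.union_of_isClosed
    · have hy := ymap_cont hz hp hC hzC ctr
      refine (hH.comp (f := fun q : ℝ × V3 => (q.1, ymap z ctr q.2)) (by fun_prop) ?_).congr ?_
      · intro q hq; exact ⟨hq.1, ymap_mem hCv hzC hc hq.2.1⟩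
      · intro q hq; exact wrap_up hq.2.2
    · refine (gj.mono (prod_mono_right (subset_univ _))).congr ?_
      intro q hq; exact hlow q.1 hq.1 q.2 hq.2.1 hq.2.2
    · exact hT.prod (isClosed_sphereS.inter (isClosed_le continuous_const c2))
    · exact hT.prod (isClosed_sphereS.inter (isClosed_le c2 continuous_const))
  · intro t ht x hx
    rcases le_total 0 (x 2) with h | h
    · rw [wrap_up h]; exact hS t ht _ (ymap_mem hCv hzC hc hx)
    · rw [hlow t ht x hx h]
      have := hne t ht (Complex.arg (zeta x))
      exact geo_mem hs' (hS t ht _ (hzC _)) this.2 (by rw [neg_neg]; exact this.1) _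
  · intro t ht x hx h
    rw [hlow t ht x hx h]
    have := hne t ht (Complex.arg (zeta x))
    have := geo_ne hs' (hS t ht _ (hzC _)) this.2 (by rw [neg_neg]; exact this.1) (norm_nonneg (zeta x)) (zeta_le hx)
    rwa [neg_neg] at this


namespace PolyCtx
variable (P : PolyCtx)

theorem Chat_diff {a x y} (hx : x ∈ P.Chat a) (hy : y ∈ P.Chat a) : (x - y) ⬝ᵥ P.Cnormal a = 0 := by
  have h1 := (P.mem_Chat.1 hx).2
  have h2 := (P.mem_Chat.1 hy).2
  unfold cf at h1 h2
  rw [show x - y = (x - P.cpt a) - (y - P.cpt a) by module, sub_dotProduct, h1, h2, sub_zero]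

/-- on the boundary of a cleaved face a tangent field avoids `± s` -/
theorem ne_s {s : V3} (hs : P.AdmissibleS s) {g : V3 → V3} (hg : P.MemC0Phat g) {a x} (hx : x ∈ P.bdChat a) :
    g x ≠ s ∧ g x ≠ -s := by
  obtain ⟨c, hc⟩ := mem_iUnion.1 hx
  have h0 := hg.2.2 c x hc.2
  constructor
  · intro h; rw [h] at h0; exact hs.2 c h0
  · intro h; rw [h, neg_dotProduct, neg_eq_zero] at h0; exact hs.2 c h0

/-- direction of a positively oriented boundary loop seen from another centre -/
theorem loop_dir {a} {e₁ e₂ : V3} (he : IsFrame (P.Cnormal a) e₁ e₂) {c₀ : V3} (hc₀ : c₀ ∈ P.Chat a)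
    (hi₀ : c₀ ∈ interior P.Pbar) {ctr : V3} (hc : ctr ∈ P.Chat a) (hi : ctr ∈ interior P.Pbar) {z : ℝ → V3}
    (hz : PosLoopParam (P.Cnormal a) ctr z) (hr : ∀ φ, z φ ∈ P.bdChat a) :
    ∃ Ψ : ℝ → ℂ, Continuous Ψ ∧ (∀ φ, Ψ (φ + 2 * Real.pi) = Ψ φ) ∧
      ∀ φ : ℝ, cc e₁ e₂ (z φ - c₀) / ‖cc e₁ e₂ (z φ - c₀)‖ = Complex.exp (Ψ φ) * Complex.exp (φ * Complex.I) := by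
  obtain ⟨zc, zp, e₁', e₂', f1, f2, f3, f4, θ, r, θc, -, θp, rp, zf⟩ := hz
  have he' : IsFrame (P.Cnormal a) e₁' e₂' := ⟨f1, f2, f3, f4⟩
  have hfr : ∀ φ, z φ ∈ frontier P.Pbar := fun φ => (P.mem_bdChat.1 (hr φ)).2
  have ne : ∀ c ∈ P.Chat a, c ∈ interior P.Pbar → ∀ φ, cc e₁ e₂ (z φ - c) ≠ 0 := by
    intro c h1 h2 φ
    refine he.cc_ne (P.Chat_diff (P.bdChat_sub a (hr φ)) h1) (sub_ne_zero.2 ?_)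
    intro h
    exact P.not_frontier h2 (h ▸ hfr φ)
  have n0 := ne c₀ hc₀ hi₀
  have n1 := ne ctr hc hi
  have hl : cc e₁ e₂ e₁' ≠ 0 := by
    refine he.cc_ne he'.perp.1 ?_
    intro h; rw [h] at f1; simp at f1
  have hl2 : cc e₁ e₂ e₂' = Complex.I * cc e₁ e₂ e₁' := by rw [← he'.cross1, he.cc_cross]
  have hC' : ∀ φ, cc e₁ e₂ (z φ - ctr) = r φ * (cc e₁ e₂ e₁' * Complex.exp (θ φ * Complex.I)) := by
    intro φ
    rw [zf φ, add_sub_cancel_left, cc_smul, cc_add, cc_smul, cc_smul, hl2, Complex.exp_mul_I]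
    push_cast; ring
  have hnorm : ∀ φ, ‖cc e₁ e₂ (z φ - ctr)‖ = r φ * ‖cc e₁ e₂ e₁'‖ := by
    intro φ
    rw [hC', norm_mul, norm_mul, Complex.norm_exp_ofReal_mul_I, mul_one, Complex.norm_real, Real.norm_eq_abs, abs_of_pos (rp φ)]
  have hslit : ∀ φ, cc e₁ e₂ (z φ - c₀) / cc e₁ e₂ (z φ - ctr) ∈ Complex.slitPlane := by
    intro φ
    rw [Complex.mem_slitPlane_iff]
    by_contra! h
    obtain ⟨k, hk⟩ : ∃ k : ℝ, k = -(cc e₁ e₂ (z φ - c₀) / cc e₁ e₂ (z φ - ctr)).re := ⟨_, rfl⟩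
    have hk0 : 0 ≤ k := by linarith [h.1]
    have e1 : cc e₁ e₂ (z φ - c₀) / cc e₁ e₂ (z φ - ctr) = ((-k : ℝ) : ℂ) := by
      apply Complex.ext
      · rw [Complex.ofReal_re, hk, neg_neg]
      · rw [Complex.ofReal_im, h.2]
    rw [div_eq_iff (n1 φ), ← cc_smul] at e1
    have hmem := P.bdChat_sub a (hr φ)
    have e2 := he.cc_inj (P.Chat_diff hmem hc₀) (by rw [smul_dotProduct, P.Chat_diff hmem hc, smul_zero]) e1
    have e3 : z φ = (1 / (1 + k)) • c₀ + (k / (1 + k)) • ctr := by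
      have h1 : (1 + k) • z φ = c₀ + k • ctr := by
        rw [← sub_eq_zero, show (1 + k) • z φ - (c₀ + k • ctr) = (z φ - c₀) + k • (z φ - ctr) by module, e2]
        module
      have h2 : (1 + k) ≠ 0 := by positivity
      apply smul_right_injective _ h2
      simp only
      rw [h1, smul_add, smul_smul, smul_smul, mul_one_div_cancel h2, mul_div_cancel₀ _ h2, one_smul]
    have := P.convex.interior hi₀ hi (a := 1 / (1 + k)) (b := k / (1 + k)) (by positivity) (by positivity) (by field_simp)
    rw [← e3] at this
    exact P.not_frontier this (hfr φ)
  have cC : ∀ c, Continuous (fun φ => cc e₁ e₂ (z φ - c)) := fun c =>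
    (continuous_cc e₁ e₂).comp (zc.sub continuous_const)
  refine ⟨fun φ => Complex.log (cc e₁ e₂ (z φ - c₀) / cc e₁ e₂ (z φ - ctr)) + Complex.log (cc e₁ e₂ e₁') +
    ((θ φ - φ : ℝ) : ℂ) * Complex.I + ((Real.log (‖cc e₁ e₂ (z φ - ctr)‖ / (‖cc e₁ e₂ e₁'‖ * ‖cc e₁ e₂ (z φ - c₀)‖)) : ℝ) : ℂ), ?_, ?_, ?_⟩
  · have c1 : Continuous (fun φ => Complex.log (cc e₁ e₂ (z φ - c₀) / cc e₁ e₂ (z φ - ctr))) :=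
      Continuous.clog ((cC c₀).div (cC ctr) n1) hslit
    have c2 : Continuous (fun φ => Real.log (‖cc e₁ e₂ (z φ - ctr)‖ / (‖cc e₁ e₂ e₁'‖ * ‖cc e₁ e₂ (z φ - c₀)‖))) := by
      apply Continuous.log
      · apply Continuous.div (cC ctr).norm (continuous_const.mul (cC c₀).norm)
        intro φ; exact mul_ne_zero (norm_ne_zero_iff.2 hl) (norm_ne_zero_iff.2 (n0 φ))
      · intro φ
        exact div_ne_zero (norm_ne_zero_iff.2 (n1 φ)) (mul_ne_zero (norm_ne_zero_iff.2 hl) (norm_ne_zero_iff.2 (n0 φ)))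
    have c3 : Continuous (fun φ : ℝ => ((θ φ - φ : ℝ) : ℂ) * Complex.I) := by fun_prop
    exact ((c1.add continuous_const).add c3).add (Complex.continuous_ofReal.comp c2)
  · intro φ
    simp only [zp, θp]
    rw [show θ φ + 2 * Real.pi - (φ + 2 * Real.pi) = θ φ - φ by ring]
  · intro φ
    have q1 : 0 < ‖cc e₁ e₂ (z φ - ctr)‖ := norm_pos_iff.2 (n1 φ)
    have q2 : 0 < ‖cc e₁ e₂ (z φ - c₀)‖ := norm_pos_iff.2 (n0 φ)
    have q3 : 0 < ‖cc e₁ e₂ e₁'‖ := norm_pos_iff.2 hl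
    rw [Complex.exp_add, Complex.exp_add, Complex.exp_add, Complex.exp_log (div_ne_zero (n0 φ) (n1 φ)), Complex.exp_log hl,
      ← Complex.ofReal_exp, Real.exp_log (by positivity), Complex.ofReal_sub, sub_mul, Complex.exp_sub, hnorm]
    have q4 := n1 φ
    rw [hC'] at q4 ⊢
    have a1 := Complex.exp_ne_zero (φ * Complex.I)
    have a2 := Complex.exp_ne_zero (θ φ * Complex.I)
    have a3 : (r φ : ℂ) ≠ 0 := by exact_mod_cast (rp φ).ne'
    have a4 : ((‖cc e₁ e₂ e₁'‖ : ℝ) : ℂ) ≠ 0 := by exact_mod_cast q3.ne'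
    have a5 : ((‖cc e₁ e₂ (z φ - c₀)‖ : ℝ) : ℂ) ≠ 0 := by exact_mod_cast q2.ne'
    push_cast
    field_simp

theorem wrap_winding {deg : (V3 → V3) → ℤ} (hdeg : DegreeTheory deg) {s : V3} (hs : P.AdmissibleS s)
    {g : V3 → V3} (hg : P.MemC0Phat g) {a} {e₁ e₂ : V3} (he : IsFrame (P.Cnormal a) e₁ e₂)
    {c₀ : V3} (hc₀ : c₀ ∈ P.Chat a) (hi₀ : c₀ ∈ interior P.Pbar) {z₀ : ℂ → V3}
    (hz₀ : ∀ x ∈ P.bdChat a, z₀ (cc e₁ e₂ (x - c₀) / ‖cc e₁ e₂ (x - c₀)‖) = x)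
    {G : V3 → QQ} (hG : IsLift g (P.Chat a) G) {cs : QQ} (hcs : cs ≠ 0) (hcs' : qv (-s) * cs = cs * qI)
    {m : ℤ} {ψ : ℂ → ℂ} (hψ : ContinuousOn ψ {ζ | ‖ζ‖ = 1})
    (hW : ∀ ζ, ‖ζ‖ = 1 → qrat (qstep (-s) (g (z₀ ζ)) * cs) (G (z₀ ζ)) = Complex.exp (ψ ζ) * ζ ^ m)
    {w : ℤ} (hw : P.HasWrap deg s a g w) : w = -m := by
  obtain ⟨ctr, z, hc, hcb, hz, hr, rfl⟩ := hw
  have hi := P.ctr_interior hc hcb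
  have hzb : ∀ φ, z φ ∈ P.bdChat a := fun φ => hr ▸ mem_range_self φ
  have hzC : ∀ φ, z φ ∈ P.Chat a := fun φ => P.bdChat_sub a (hzb φ)
  obtain ⟨Ψ, Ψc, Ψp, hΨ⟩ := P.loop_dir he hc₀ hi₀ hc hi hz hzb
  have gC : ContinuousOn g (P.Chat a) := hg.1.mono (P.Chat_sub a)
  have gS : ∀ x ∈ P.Chat a, g x ∈ sphereS := fun x hx => hg.2.1 x (P.Chat_sub a hx)
  have hs' : -s ∈ sphereS := by
    have : s ⬝ᵥ s = 1 := hs.1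
    show _ = _
    simpa using this
  obtain ⟨J1, J2, J3⟩ := wrap_joint (T := {(0:ℝ)}) isClosed_singleton (H := fun _ => g) (P.isCompact_Chat a) (P.convex_Chat a) hs.1
    (gC.comp continuousOn_snd (fun q hq => hq.2)) (fun _ _ => gS) hz.1 hz.2.1 hzC hc
    (fun _ _ φ => P.ne_s hs hg (hzb φ))
  have wc : ContinuousOn (wrapMap g z ctr s) sphereS :=
    J1.comp (f := fun x : V3 => ((0:ℝ), x)) (by fun_prop) (fun x hx => ⟨rfl, hx⟩)
  have wS := J2 0 rfl
  have wne := J3 0 rfl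
  have yc := ymap_cont hz.1 hz.2.1 (P.isCompact_Chat a) hzC ctr
  have ym : ∀ x ∈ sphereS, ymap z ctr x ∈ P.Chat a := fun x hx => ymap_mem (P.convex_Chat a) hzC hc hx
  have hcirc : ∀ φ : ℝ, ‖cc e₁ e₂ (z φ - c₀) / ‖cc e₁ e₂ (z φ - c₀)‖‖ = 1 := by
    intro φ
    have h0 : cc e₁ e₂ (z φ - c₀) ≠ 0 := by
      refine he.cc_ne (P.Chat_diff (hzC φ) hc₀) (sub_ne_zero.2 ?_)
      intro h
      exact P.not_frontier hi₀ (h ▸ (P.mem_bdChat.1 (hzb φ)).2)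
    rw [norm_div, Complex.norm_real, norm_norm, div_self (norm_ne_zero_iff.2 h0)]
  have cD : Continuous (fun φ : ℝ => cc e₁ e₂ (z φ - c₀) / ‖cc e₁ e₂ (z φ - c₀)‖) := by
    simp_rw [hΨ]; fun_prop
  have cE : Continuous (fun φ : ℝ => ψ (cc e₁ e₂ (z φ - c₀) / ‖cc e₁ e₂ (z φ - c₀)‖) + m * Ψ φ) :=
    (hψ.comp_continuous cD hcirc).add (continuous_const.mul Ψc)
  have pE : ∀ φ : ℝ, ψ (cc e₁ e₂ (z (φ + 2 * Real.pi) - c₀) / ‖cc e₁ e₂ (z (φ + 2 * Real.pi) - c₀)‖) + m * Ψ (φ + 2 * Real.pi) =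
     ψ (cc e₁ e₂ (z φ - c₀) / ‖cc e₁ e₂ (z φ - c₀)‖) + m * Ψ φ := by
    intro φ; rw [hz.2.1, Ψp]
  have cF := periodic_arg cE pE
  refine deg_of_lifts hdeg wc wS (U := fun x => G (ymap z ctr x)) (L := fun x => qstep (-s) (wrapMap g z ctr s x) * cs)
    (ψ := fun x => ψ (cc e₁ e₂ (z (Complex.arg (zeta x)) - c₀) / ‖cc e₁ e₂ (z (Complex.arg (zeta x)) - c₀)‖) + m * Ψ (Complex.arg (zeta x)))
    ⟨?_, ?_⟩ ⟨?_, ?_⟩ ?_ ?_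
  · exact hG.1.comp yc.continuousOn (fun x hx => ym x hx.1)
  · intro x hx
    rw [wrap_up hx.2]
    exact hG.2 _ (ym x hx.1)
  · refine ContinuousOn.mul ?_ continuousOn_const
    exact continuous_qstep.comp_continuousOn (f := fun x => (-s, wrapMap g z ctr s x)) (continuousOn_const.prodMk (wc.mono inter_subset_left))
  · intro x hx
    refine ⟨mul_ne_zero (qstep_ne (wS hx.1) fun h => wne x hx.1 hx.2 (neg_injective h).symm) hcs, ?_⟩
    rw [← mul_assoc, qstep_spec hs' (wS hx.1), mul_assoc, hcs', mul_assoc]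
  · refine cF.comp (f := zeta) continuous_zeta.continuousOn ?_
    intro x hx h
    have := zeta_eq_one hx.1 hx.2
    rw [h] at this; simp at this
  · intro x hx
    have h1 := zeta_eq_one hx.1 hx.2
    have hy : ymap z ctr x = z (Complex.arg (zeta x)) := by rw [ymap, h1]; simp
    have hx2 : (0:ℝ) ≤ x 2 := le_of_eq (Eq.symm hx.2)
    rw [wrap_up hx2, hy]
    generalize hφ : Complex.arg (zeta x) = φ
    have hex : Complex.exp (φ * Complex.I) = zeta x := by
      have := Complex.norm_mul_exp_arg_mul_I (zeta x)
      rw [h1, hφ] at this; simpa using this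
    obtain ⟨g1, g2⟩ := hG.2 _ (hzC φ)
    have hns := P.ne_s hs hg (hzb φ)
    have := (qrat_spec (L := qstep (-s) (g (z φ)) * cs)
      (mul_ne_zero (qstep_ne (gS _ (hzC φ)) fun h => hns.1 (neg_injective h).symm) hcs) g1
      (by rw [← mul_assoc, qstep_spec hs' (gS _ (hzC φ)), mul_assoc, hcs', mul_assoc]) g2).1
    have hw := hW _ (hcirc φ)
    rw [hz₀ _ (hzb φ)] at hw
    rw [hw] at this
    rw [this]
    congr 2
    rw [Complex.exp_add, mul_assoc]
    congr 1
    rw [hΨ, hex, mul_zpow, ← Complex.exp_int_mul]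

end PolyCtx


theorem int_const {E : Type*} [TopologicalSpace E] {X : Set E} (hX : IsPreconnected X) {f : E → ℝ}
    (hf : ContinuousOn f X) (hk : ∀ x ∈ X, ∃ k : ℤ, f x = 2 * Real.pi * k) {x y} (hx : x ∈ X) (hy : y ∈ X) :
    f x = f y := by
  have key : ∀ x ∈ X, ∀ y ∈ X, ¬ f x < f y := by
    intro x hx y hy hlt
    obtain ⟨k, hk1⟩ := hk x hx
    obtain ⟨l, hl⟩ := hk y hy
    have hpi := Real.pi_pos
    have hkl : k < l := by
      rw [hk1, hl] at hlt
      have := lt_of_mul_lt_mul_left hlt (by positivity)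
      exact_mod_cast this
    have hkl' : (k:ℝ) + 1 ≤ l := by exact_mod_cast hkl
    have hm : 2 * Real.pi * (k + 1/2) ∈ Icc (f x) (f y) := by
      constructor <;> nlinarith
    obtain ⟨w, hw, e⟩ := hX.intermediate_value hx hy hf hm
    obtain ⟨j, hj⟩ := hk w hw
    rw [hj] at e
    have := mul_left_cancel₀ (by positivity : 2 * Real.pi ≠ 0) e
    have h2 : (2 * j : ℝ) = 2 * k + 1 := by linarith
    have h3 : 2 * j = 2 * k + 1 := by exact_mod_cast h2
    omega
  exact le_antisymm (not_lt.1 (key y hy x hx)) (not_lt.1 (key x hx y hy))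

theorem rot_inj {F v : V3} (hF : F ⬝ᵥ F = 1) (hv : v ⬝ᵥ F = 0) (hS : v ∈ sphereS) {θ φ : ℝ}
    (h : rot3 F θ v = rot3 F φ v) : ∃ k : ℤ, θ - φ = 2 * Real.pi * k := by
  obtain ⟨e₁, e₂, he⟩ := exists_frame hF
  have h1 := congrArg (cc e₁ e₂) h
  rw [he.cc_rot hv, he.cc_rot hv] at h1
  have h2 := mul_right_cancel₀ (he.cc_ne hv (sphere_ne_zero hS)) h1
  obtain ⟨k, hk⟩ := Complex.exp_eq_exp_iff_exists_int.1 h2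
  refine ⟨k, ?_⟩
  have h3 : ((θ:ℂ) - φ - 2 * Real.pi * k) * Complex.I = 0 := by linear_combination hk
  have h4 := (mul_eq_zero.1 h3).resolve_right Complex.I_ne_zero
  have h5 : ((θ - φ - 2 * Real.pi * k : ℝ) : ℂ) = 0 := by push_cast; exact h4
  have := Complex.ofReal_eq_zero.1 h5
  linarith

theorem rot_lift {E : Type*} [NormedAddCommGroup E] [NormedSpace ℝ E] {X : Set E} (hX : IsCompact X)
    (hc : Convex ℝ X) {F : V3} (hF : F ⬝ᵥ F = 1) {f g : E → V3} (hf : ContinuousOn f X) (hg : ContinuousOn g X)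
    (hfS : ∀ x ∈ X, f x ∈ sphereS) (hgS : ∀ x ∈ X, g x ∈ sphereS) (hfF : ∀ x ∈ X, f x ⬝ᵥ F = 0)
    (hgF : ∀ x ∈ X, g x ⬝ᵥ F = 0) :
    ∃ δ : E → ℝ, ContinuousOn δ X ∧ ∀ x ∈ X, g x = rot3 F (δ x) (f x) := by
  obtain ⟨e₁, e₂, he⟩ := exists_frame hF
  have c1 : ContinuousOn (fun x => cc e₁ e₂ (f x)) X := (continuous_cc e₁ e₂).comp_continuousOn (f := f) hf
  have c2 : ContinuousOn (fun x => cc e₁ e₂ (g x)) X := (continuous_cc e₁ e₂).comp_continuousOn (f := g) hg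
  have n1 : ∀ x ∈ X, cc e₁ e₂ (f x) ≠ 0 := fun x hx => he.cc_ne (hfF x hx) (sphere_ne_zero (hfS x hx))
  have n2 : ∀ x ∈ X, cc e₁ e₂ (g x) ≠ 0 := fun x hx => he.cc_ne (hgF x hx) (sphere_ne_zero (hgS x hx))
  obtain ⟨ψ, hψ, h⟩ := exp_lift_convex hX hc (c2.div c1 n1) (fun x hx => div_ne_zero (n2 x hx) (n1 x hx))
  refine ⟨fun x => (ψ x).im, Complex.continuous_im.comp_continuousOn (f := ψ) hψ, fun x hx => ?_⟩
  have nf : ‖cc e₁ e₂ (f x)‖ = 1 := by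
    have := he.cc_norm (hfF x hx)
    rw [hfS x hx] at this
    exact (pow_eq_one_iff_of_nonneg (norm_nonneg _) two_ne_zero).1 this
  have ng : ‖cc e₁ e₂ (g x)‖ = 1 := by
    have := he.cc_norm (hgF x hx)
    rw [hgS x hx] at this
    exact (pow_eq_one_iff_of_nonneg (norm_nonneg _) two_ne_zero).1 this
  have hh := h x hx
  simp only [Pi.div_apply] at hh
  have hre : (ψ x).re = 0 := by
    have := congrArg norm hh
    rw [norm_div, nf, ng, Complex.norm_exp] at this
    simp only [div_one] at this
    exact (Real.exp_eq_one_iff _).1 this.symm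
  have hψe : ψ x = ((ψ x).im : ℂ) * Complex.I := by
    apply Complex.ext <;> simp [hre]
  refine he.cc_inj (hgF x hx) ?_ ?_
  · exact rot3_dot _ (hfF x hx)
  rw [he.cc_rot (hfF x hx), ← hψe, ← hh, div_mul_cancel₀ _ (n1 x hx)]

namespace PolyCtx
variable (P : PolyCtx)

theorem mem_Fhat_of_edge {b c x} (h : P.edge b ⊆ P.face c) (hx : x ∈ P.Ehat b) : x ∈ P.Fhat c := ⟨h hx.1, hx.2⟩

/-- homotopic fields agree along edges, throughout the homotopy -/
theorem fwd_edge {H : ℝ → V3 → V3}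
    (hH : ContinuousOn (fun q : ℝ × V3 => H q.1 q.2) (Set.Icc (0:ℝ) 1 ×ˢ P.PhatSet))
    (hm : ∀ t ∈ Set.Icc (0:ℝ) 1, P.MemC0Phat (H t)) {b x} (hx : x ∈ P.Ehat b) {t} (ht : t ∈ Icc (0:ℝ) 1) :
    H t x = H 0 x := by
  obtain ⟨c, c', h1, h2, hX⟩ := P.edge_two_faces b
  have hxP : x ∈ P.PhatSet := P.Fhat_sub c (P.mem_Fhat_of_edge h1 hx)
  have h0 : (0:ℝ) ∈ Icc (0:ℝ) 1 := by simp
  have hk : ∀ t ∈ Icc (0:ℝ) 1, ∃ k : ℝ, H t x = k • H 0 x ∧ k^2 = 1 := by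
    intro t ht
    obtain ⟨k, hk⟩ := perp_two_par hX ((hm t ht).2.2 c x (P.mem_Fhat_of_edge h1 hx))
      ((hm t ht).2.2 c' x (P.mem_Fhat_of_edge h2 hx)) ((hm 0 h0).2.2 c x (P.mem_Fhat_of_edge h1 hx))
      ((hm 0 h0).2.2 c' x (P.mem_Fhat_of_edge h2 hx)) (sphere_ne_zero ((hm 0 h0).2.1 x hxP))
    refine ⟨k, hk, ?_⟩
    have e1 : H t x ⬝ᵥ H t x = 1 := (hm t ht).2.1 x hxP
    have e2 : H 0 x ⬝ᵥ H 0 x = 1 := (hm 0 h0).2.1 x hxP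
    rw [hk, smul_dotProduct, dotProduct_smul, e2] at e1
    simp only [smul_eq_mul] at e1
    linarith
  have e2 : H 0 x ⬝ᵥ H 0 x = 1 := (hm 0 h0).2.1 x hxP
  have hcx : ContinuousOn (fun t => H t x) (Icc (0:ℝ) 1) :=
    hH.comp (f := fun t : ℝ => (t, x)) (by fun_prop) (fun t ht => ⟨ht, hxP⟩)
  have hcont : ContinuousOn (fun t => Real.pi * (1 - H t x ⬝ᵥ H 0 x)) (Icc (0:ℝ) 1) := by
    have : ContinuousOn (fun t => H t x ⬝ᵥ H 0 x) (Icc (0:ℝ) 1) :=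
      continuous_dot.comp_continuousOn (f := fun t => (H t x, H 0 x)) (hcx.prodMk continuousOn_const)
    exact continuousOn_const.mul (continuousOn_const.sub this)
  have hc := int_const isPreconnected_Icc hcont (fun t ht => by
    obtain ⟨k, hk, hk2⟩ := hk t ht
    rw [hk, smul_dotProduct, e2]
    rcases (by rw [show (1:ℝ) = 1^2 by norm_num] at hk2; exact sq_eq_sq_iff_eq_or_eq_neg.1 hk2 : k = 1 ∨ k = -1) with rfl | rfl
    · exact ⟨0, by simp⟩
    · exact ⟨1, by simp; ring⟩) ht h0
  obtain ⟨k, hk, hk2⟩ := hk t ht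
  rw [e2, hk, smul_dotProduct, e2] at hc
  have := mul_left_cancel₀ Real.pi_pos.ne' hc
  simp only [smul_eq_mul, mul_one] at this
  rw [hk, show k = 1 by linarith, one_smul]

theorem fwd_kink {H : ℝ → V3 → V3}
    (hH : ContinuousOn (fun q : ℝ × V3 => H q.1 q.2) (Set.Icc (0:ℝ) 1 ×ˢ P.PhatSet))
    (hm : ∀ t ∈ Set.Icc (0:ℝ) 1, P.MemC0Phat (H t)) {a c κ} (h : P.HasKink a c (H 0) κ) :
    P.HasKink a c (H 1) κ := by
  obtain ⟨z, hz, ξ, hξ, hξ0, hξz, η, hη, hηz, hκ⟩ := h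
  have h0 : (0:ℝ) ∈ Icc (0:ℝ) 1 := by simp
  have h1 : (1:ℝ) ∈ Icc (0:ℝ) 1 := by simp
  have hzB : ∀ t ∈ Icc (0:ℝ) 1, z t ∈ P.Bhat a c := fun t ht => by rw [← hz.2.1]; exact mem_image_of_mem z ht
  have hzF : ∀ t ∈ Icc (0:ℝ) 1, z t ∈ P.Fhat c := fun t ht => (hzB t ht).2
  have hzP : ∀ t ∈ Icc (0:ℝ) 1, z t ∈ P.PhatSet := fun t ht => P.Fhat_sub c (hzF t ht)
  obtain ⟨i, rfl⟩ := P.Bhat_vert (hzB 0 h0)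
  obtain ⟨p, q, hpq, -, hall⟩ := P.Bparam c i
  obtain ⟨hzp, hzq⟩ := hall z hz
  have ep : ∀ t ∈ Icc (0:ℝ) 1, H t (z 0) = H 0 (z 0) := by
    intro t ht; rw [hzp]
    rcases hpq with h | h
    · exact P.fwd_edge hH hm h.1 ht
    · exact P.fwd_edge hH hm h.2 ht
  have eq : ∀ t ∈ Icc (0:ℝ) 1, H t (z 1) = H 0 (z 1) := by
    intro t ht; rw [hzq]
    rcases hpq with h | h
    · exact P.fwd_edge hH hm h.2 ht
    · exact P.fwd_edge hH hm h.1 ht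
  have hN := P.Fnormal_unit c
  have hv := (hm 0 h0).2.2 c _ (hzF 0 h0)
  have hvS := (hm 0 h0).2.1 _ (hzP 0 h0)
  have hcont : ContinuousOn (fun r : ℝ × ℝ => H r.1 (z r.2)) (Icc (0:ℝ) 1 ×ˢ Icc (0:ℝ) 1) :=
    hH.comp (f := fun r : ℝ × ℝ => (r.1, z r.2))
      (continuousOn_fst.prodMk (hz.1.comp continuousOn_snd fun r hr => hr.2)) (fun r hr => ⟨hr.1, hzP _ hr.2⟩)
  obtain ⟨δ, hδ, hδe⟩ := rot_lift (E := ℝ × ℝ) (X := Icc (0:ℝ) 1 ×ˢ Icc (0:ℝ) 1) (isCompact_Icc.prod isCompact_Icc)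
    ((convex_Icc 0 1).prod (convex_Icc 0 1)) hN (f := fun _ => H 0 (z 0)) continuousOn_const hcont
    (fun _ _ => hvS) (fun r hr => (hm _ hr.1).2.1 _ (hzP _ hr.2)) (fun _ _ => hv)
    (fun r hr => (hm _ hr.1).2.2 c _ (hzF _ hr.2))
  -- restriction of δ to sides
  have dcol : ∀ u ∈ Icc (0:ℝ) 1, ContinuousOn (fun t => δ (t, u)) (Icc (0:ℝ) 1) := fun u hu =>
    hδ.comp (f := fun t : ℝ => (t, u)) (by fun_prop) (fun t ht => ⟨ht, hu⟩)
  have drow : ∀ u ∈ Icc (0:ℝ) 1, ContinuousOn (fun t => δ (u, t)) (Icc (0:ℝ) 1) := fun u hu =>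
    hδ.comp (f := fun t : ℝ => (u, t)) (by fun_prop) (fun t ht => ⟨hu, ht⟩)
  have s0 : δ (1, 0) = δ (0, 0) := by
    have := int_const (f := fun t => δ (t, 0) - δ (0,0)) isPreconnected_Icc ((dcol 0 h0).sub continuousOn_const)
      (fun t ht => rot_inj hN hv hvS (by
        rw [← hδe (t,0) ⟨ht, h0⟩, ← hδe (0,0) ⟨h0, h0⟩]; exact ep t ht)) h1 h0
    linarith
  have s1 : δ (1, 1) = δ (0, 1) := by
    have := int_const (f := fun t => δ (t, 1) - δ (0,1)) isPreconnected_Icc ((dcol 1 h1).sub continuousOn_const)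
      (fun t ht => rot_inj hN hv hvS (by
        rw [← hδe (t,1) ⟨ht, h1⟩, ← hδe (0,1) ⟨h0, h1⟩]; exact eq t ht)) h1 h0
    linarith
  have s2 : δ (0, 1) - ξ 1 = δ (0, 0) - ξ 0 := by
    exact int_const (f := fun t => δ (0, t) - ξ t) isPreconnected_Icc ((drow 0 h0).sub hξ)
      (fun t ht => rot_inj hN hv hvS (by
        rw [← hδe (0,t) ⟨h0, ht⟩, ← hξz t ht])) h1 h0
  have r0 : ∃ k : ℤ, δ (1,0) - 0 = 2 * Real.pi * k := rot_inj hN hv hvS (by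
    rw [← hδe (1,0) ⟨h1, h0⟩, rot3_zero]; exact ep 1 h1)
  obtain ⟨k, hk⟩ := r0
  refine ⟨z, hz, fun t => δ (1, t) - δ (1, 0), (drow 1 h1).sub continuousOn_const, by simp, ?_, η, hη, ?_, ?_⟩
  · intro t ht
    rw [ep 1 h1, hδe (1,t) ⟨h1, ht⟩, rot3, rot3]
    have : δ (1,0) = k * (2 * Real.pi) := by linarith
    rw [this, Real.cos_sub_int_mul_two_pi, Real.sin_sub_int_mul_two_pi]
  · rw [ep 1 h1, eq 1 h1]; exact hηz
  · simp only; rw [hκ, s1, s0]; linarith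

theorem fwd_wrap {deg : (V3 → V3) → ℤ} (hdeg : DegreeTheory deg) {s : V3} (hs : P.AdmissibleS s) {H : ℝ → V3 → V3}
    (hH : ContinuousOn (fun q : ℝ × V3 => H q.1 q.2) (Set.Icc (0:ℝ) 1 ×ˢ P.PhatSet))
    (hm : ∀ t ∈ Set.Icc (0:ℝ) 1, P.MemC0Phat (H t)) {a w} (h : P.HasWrap deg s a (H 0) w) :
    P.HasWrap deg s a (H 1) w := by
  obtain ⟨ctr, z, hc, hcb, hz, hr, hd⟩ := h
  refine ⟨ctr, z, hc, hcb, hz, hr, ?_⟩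
  rw [← hd]
  have h0 : (0:ℝ) ∈ Icc (0:ℝ) 1 := by simp
  have h1 : (1:ℝ) ∈ Icc (0:ℝ) 1 := by simp
  have hzb : ∀ φ, z φ ∈ P.bdChat a := fun φ => by rw [← hr]; exact mem_range_self φ
  obtain ⟨j1, j2, -⟩ := wrap_joint (T := Icc (0:ℝ) 1) isClosed_Icc (P.isCompact_Chat a) (P.convex_Chat a) hs.1
    (hH.mono (prod_mono_right (P.Chat_sub a))) (fun t ht x hx => (hm t ht).2.1 x (P.Chat_sub a hx)) hz.1 hz.2.1
    (fun φ => P.bdChat_sub a (hzb φ)) hc (fun t ht φ => P.ne_s hs (hm t ht) (hzb φ))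
  have cc : ∀ t ∈ Icc (0:ℝ) 1, ContinuousOn (wrapMap (H t) z ctr s) sphereS := fun t ht =>
    j1.comp (f := fun x : V3 => (t, x)) (by fun_prop) (fun x hx => ⟨ht, hx⟩)
  exact (hdeg.1 _ _ (cc 0 h0) (j2 0 h0) (cc 1 h1) (j2 1 h1)
    ⟨fun t => wrapMap (H t) z ctr s, j1, j2, fun _ _ => rfl, fun _ _ => rfl⟩).symm

theorem HomotopicPhat.symm {n n' : V3 → V3} (h : P.HomotopicPhat n n') : P.HomotopicPhat n' n := by
  obtain ⟨H, h1, h2, h3, h4⟩ := h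
  have hm : ∀ t ∈ Icc (0:ℝ) 1, 1 - t ∈ Icc (0:ℝ) 1 := fun t ht => ⟨by linarith [ht.2], by linarith [ht.1]⟩
  refine ⟨fun t => H (1 - t), ?_, fun t ht => h2 _ (hm t ht), fun x hx => ?_, fun x hx => ?_⟩
  · exact h1.comp (f := fun q : ℝ × V3 => (1 - q.1, q.2)) (by fun_prop) (fun q hq => ⟨hm _ hq.1, hq.2⟩)
  · simp only [sub_zero]; exact h4 x hx
  · simp only [sub_self]; exact h3 x hx

theorem HomotopicPhat.exact {n n' : V3 → V3} (h : P.HomotopicPhat n n') (hn : P.MemC0Phat n) (hn' : P.MemC0Phat n') :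
    ∃ H : ℝ → V3 → V3, ContinuousOn (fun q : ℝ × V3 => H q.1 q.2) (Set.Icc (0:ℝ) 1 ×ˢ P.PhatSet) ∧
    (∀ t ∈ Set.Icc (0:ℝ) 1, P.MemC0Phat (H t)) ∧ H 0 = n ∧ H 1 = n' := by
  obtain ⟨H, h1, h2, h3, h4⟩ := h
  refine ⟨fun t => if t = 0 then n else if t = 1 then n' else H t, ?_, ?_, by simp, by simp⟩
  · refine h1.congr fun q hq => ?_
    simp only
    split_ifs with e1 e2
    · rw [e1, h3 _ hq.2]
    · rw [e2, h4 _ hq.2]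
    · rfl
  · intro t ht
    simp only
    split_ifs with e1 e2
    · exact hn
    · exact hn'
    · exact h2 t ht

theorem forward {deg : (V3 → V3) → ℤ} (hdeg : DegreeTheory deg) {s : V3} (hs : P.AdmissibleS s) {n n' : V3 → V3}
    (hn : P.MemC0Phat n) (hn' : P.MemC0Phat n') (h : P.HomotopicPhat n n') : P.SameInv deg s n n' := by
  obtain ⟨H, h1, h2, rfl, rfl⟩ := HomotopicPhat.exact P h hn hn'
  obtain ⟨G, g1, g2, g0, g3⟩ := HomotopicPhat.exact P (HomotopicPhat.symm P h) hn' hn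
  refine ⟨fun b x hx => (P.fwd_edge h1 h2 hx (by simp)).symm, fun a c κ => ⟨P.fwd_kink h1 h2, fun h => ?_⟩,
    fun a w => ⟨P.fwd_wrap hdeg hs h1 h2, fun h => ?_⟩⟩
  · rw [← g3]; rw [← g0] at h; exact P.fwd_kink g1 g2 h
  · rw [← g3]; rw [← g0] at h; exact P.fwd_wrap hdeg hs g1 g2 h

end PolyCtx


theorem paste_finite {ι E W : Type*} [Finite ι] [TopologicalSpace E] [TopologicalSpace W] {A : ι → Set E}
    (hA : ∀ i, IsClosed (A i)) {f : E → W} (g : ι → E → W) (hg : ∀ i, ContinuousOn (g i) (A i))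
    (hfg : ∀ i, ∀ x ∈ A i, f x = g i x) : ContinuousOn f (⋃ i, A i) :=
  (locallyFinite_of_finite A).continuousOn_iUnion hA fun i => (hg i).congr (hfg i)

theorem rot_add {F v : V3} (hF : F ⬝ᵥ F = 1) (hv : v ⬝ᵥ F = 0) (α β : ℝ) :
    rot3 F α (rot3 F β v) = rot3 F (α + β) v := by
  obtain ⟨e₁, e₂, he⟩ := exists_frame hF
  have h1 := rot3_dot β hv
  refine he.cc_inj (rot3_dot _ h1) (rot3_dot _ hv) ?_
  rw [he.cc_rot h1, he.cc_rot hv, he.cc_rot hv, ← mul_assoc, ← Complex.exp_add]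
  congr 2
  push_cast; ring

theorem rot_int {F v : V3} (θ : ℝ) (k : ℤ) : rot3 F (θ - 2 * Real.pi * k) v = rot3 F θ v := by
  rw [rot3, rot3, show θ - 2 * Real.pi * k = θ - k * (2 * Real.pi) by ring, Real.cos_sub_int_mul_two_pi,
    Real.sin_sub_int_mul_two_pi]

namespace PolyCtx
variable (P : PolyCtx)

/-- kink number from an angle lift on the whole truncated face -/
theorem kink_formula {n : V3 → V3} {a c} {θ : V3 → ℝ} {v : V3} (hv : v ⬝ᵥ P.Fnormal c = 0) (hvS : v ∈ sphereS)
    (hθ : ContinuousOn θ (P.Fhat c)) (hn : ∀ x ∈ P.Fhat c, n x = rot3 (P.Fnormal c) (θ x) v) {z : ℝ → V3}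
    (hz : P.IsPosParamSeg a c z) {κ : ℤ} (h : IsKinkAlong (P.Fnormal c) n z κ) :
    ∃ η : ℝ, η ∈ Set.Ioo (-Real.pi) Real.pi ∧ n (z 1) = rot3 (P.Fnormal c) η (n (z 0)) ∧
      2 * Real.pi * (κ : ℝ) = θ (z 1) - θ (z 0) - η := by
  obtain ⟨ξ, hξ, hξ0, hξz, η, hη, hηz, hκ⟩ := h
  have h0 : (0:ℝ) ∈ Icc (0:ℝ) 1 := by simp
  have h1 : (1:ℝ) ∈ Icc (0:ℝ) 1 := by simp
  have hzF : ∀ t ∈ Icc (0:ℝ) 1, z t ∈ P.Fhat c := fun t ht =>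
    (show z t ∈ P.Bhat a c by rw [← hz.2.1]; exact mem_image_of_mem z ht).2
  refine ⟨η, hη, hηz, ?_⟩
  have hN := P.Fnormal_unit c
  have hcz : ContinuousOn (fun t => θ (z t)) (Icc 0 1) := hθ.comp hz.1 hzF
  have := int_const (f := fun t => θ (z t) - (ξ t + θ (z 0))) isPreconnected_Icc
    (hcz.sub (hξ.add continuousOn_const)) (fun t ht => rot_inj hN hv hvS (by
      rw [← hn _ (hzF t ht), hξz t ht, hn _ (hzF 0 h0), rot_add hN hv])) h1 h0
  rw [hκ]; linarith

theorem exists_eta {F u w : V3} (hF : F ⬝ᵥ F = 1) (hu : u ∈ sphereS) (hw : w ∈ sphereS) (huF : u ⬝ᵥ F = 0)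
    (hwF : w ⬝ᵥ F = 0) (hne : w ≠ -u) : ∃ η ∈ Ioo (-Real.pi) Real.pi, w = rot3 F η u := by
  obtain ⟨δ, -, hδ⟩ := rot_lift (E := ℝ) (X := {0}) isCompact_singleton (convex_singleton 0) hF
    (f := fun _ => u) (g := fun _ => w) continuousOn_const continuousOn_const (fun _ _ => hu) (fun _ _ => hw)
    (fun _ _ => huF) (fun _ _ => hwF)
  have hd := hδ 0 rfl
  have hp : (0:ℝ) < 2 * Real.pi := by positivity
  have hm := toIocMod_mem_Ioc hp (-Real.pi) (δ 0)
  have he : w = rot3 F (toIocMod hp (-Real.pi) (δ 0)) u := by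
    rw [hd, ← rot_int (δ 0) (toIocDiv hp (-Real.pi) (δ 0)), toIocMod]
    congr 1; rw [zsmul_eq_mul]; ring
  refine ⟨_, ⟨hm.1, lt_of_le_of_ne (by linarith [hm.2]) fun h => ?_⟩, he⟩
  rw [h] at he
  apply hne
  rw [he, rot3_perp _ huF]; simp

theorem kink_exists {n : V3 → V3} (hn : P.MemC0Phat n) (c i) : ∃ κ, P.HasKink (P.fvert c (i+1)) c n κ := by
  obtain ⟨p, q, hpq, hz, hall⟩ := P.Bparam c i
  set z : ℝ → V3 := fun t => p + t • (q - p) with hzdef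
  have h0 : (0:ℝ) ∈ Icc (0:ℝ) 1 := by simp
  have h1 : (1:ℝ) ∈ Icc (0:ℝ) 1 := by simp
  have hzF : ∀ t ∈ Icc (0:ℝ) 1, z t ∈ P.Fhat c := fun t ht =>
    (show z t ∈ P.Bhat (P.fvert c (i+1)) c by rw [← hz.2.1]; exact mem_image_of_mem z ht).2
  have hS : ∀ t ∈ Icc (0:ℝ) 1, n (z t) ∈ sphereS := fun t ht => hn.2.1 _ (P.Fhat_sub c (hzF t ht))
  have hT : ∀ t ∈ Icc (0:ℝ) 1, n (z t) ⬝ᵥ P.Fnormal c = 0 := fun t ht => hn.2.2 c _ (hzF t ht)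
  have hN := P.Fnormal_unit c
  have hcn : ContinuousOn (fun t => n (z t)) (Icc 0 1) := hn.1.comp hz.1 (fun t ht => P.Fhat_sub c (hzF t ht))
  obtain ⟨δ, hδ, hδe⟩ := rot_lift isCompact_Icc (convex_Icc (0:ℝ) 1) hN (f := fun _ => n (z 0)) continuousOn_const hcn
    (fun _ _ => hS 0 h0) hS (fun _ _ => hT 0 h0) hT
  obtain ⟨k, hk⟩ := rot_inj hN (hT 0 h0) (hS 0 h0) (θ := δ 0) (φ := 0) (by rw [← hδe 0 h0, rot3_zero])
  have hz0 : z 0 = p := by simp [hzdef]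
  have hz1 : z 1 = q := by simp [hzdef]
  have hne : n (z 1) ≠ - n (z 0) := by
    rw [hz0, hz1]
    rcases hpq with h | h
    · exact P.nonanti hn h.1 h.2
    · intro h'
      exact P.nonanti hn h.1 h.2 (by rw [h', neg_neg])
  obtain ⟨η, hη, hηe⟩ := exists_eta hN (hS 0 h0) (hS 1 h1) (hT 0 h0) (hT 1 h1) hne
  have hξ : ∀ t ∈ Icc (0:ℝ) 1, n (z t) = rot3 (P.Fnormal c) (δ t - 2 * Real.pi * k) (n (z 0)) := by
    intro t ht; rw [rot_int]; exact hδe t ht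
  obtain ⟨κ, hκ⟩ := rot_inj hN (hT 0 h0) (hS 0 h0) ((hξ 1 h1).symm.trans hηe)
  exact ⟨κ, z, hz, fun t => δ t - 2 * Real.pi * k, hδ.sub continuousOn_const, by simp only; linarith, hξ, η, hη, hηe,
    hκ.symm⟩

theorem Ehat_Fhat {c i x} (hx : x ∈ P.Ehat (P.fedge c i)) : x ∈ P.Fhat c := P.mem_Fhat_of_edge (P.fedge_sub c i) hx

theorem convex_Ehat (b) : Convex ℝ (P.Ehat b) := by
  rw [Ehat, P.edge_def]; exact (convex_segment _ _).inter P.convex_Rall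

theorem face_delta {n n' : V3 → V3} (hn : P.MemC0Phat n) (hn' : P.MemC0Phat n')
    (he : ∀ b : Fin P.ne, Set.EqOn n n' (P.Ehat b))
    (hk : ∀ a c, ∀ κ : ℤ, P.HasKink a c n κ ↔ P.HasKink a c n' κ) (c) :
    ∃ δ : V3 → ℝ, ContinuousOn δ (P.Fhat c) ∧ (∀ x ∈ P.Fhat c, n' x = rot3 (P.Fnormal c) (δ x) (n x)) ∧
      ∀ c', ∀ x ∈ P.Fhat c, x ∈ P.Fhat c' → crossProduct (P.Fnormal c) (P.Fnormal c') ≠ 0 → δ x = 0 := by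
  have hN := P.Fnormal_unit c
  have hS : ∀ x ∈ P.Fhat c, n x ∈ sphereS := fun x hx => hn.2.1 _ (P.Fhat_sub c hx)
  have hS' : ∀ x ∈ P.Fhat c, n' x ∈ sphereS := fun x hx => hn'.2.1 _ (P.Fhat_sub c hx)
  have hT := hn.2.2 c
  obtain ⟨δ, hδ, hδe⟩ := rot_lift (P.isCompact_Fhat c) (P.convex_Fhat c) hN (hn.1.mono (P.Fhat_sub c))
    (hn'.1.mono (P.Fhat_sub c)) hS hS' hT (hn'.2.2 c)
  obtain ⟨p0, q0, hp0, hq0, -⟩ := P.Bseg c 0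
  have hp0F := P.Ehat_Fhat hp0
  obtain ⟨θ, hθ, hθe⟩ := rot_lift (P.isCompact_Fhat c) (P.convex_Fhat c) hN (f := fun _ => n p0) continuousOn_const
    (hn.1.mono (P.Fhat_sub c)) (fun _ _ => hS p0 hp0F) hS (fun _ _ => hT p0 hp0F) hT
  have hθ'e : ∀ x ∈ P.Fhat c, n' x = rot3 (P.Fnormal c) (δ x + θ x) (n p0) := by
    intro x hx
    rw [hδe x hx, hθe x hx, rot_add hN (hT p0 hp0F)]
  have hkint : ∀ i, ∀ x ∈ P.Ehat (P.fedge c i), ∃ k : ℤ, δ x = 2 * Real.pi * k := by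
    intro i x hx
    have hxF := P.Ehat_Fhat hx
    obtain ⟨k, hk⟩ := rot_inj hN (hT x hxF) (hS x hxF) (θ := δ x) (φ := 0)
      (by rw [← hδe x hxF, rot3_zero]; exact (he _ hx).symm)
    exact ⟨k, by linarith⟩
  have hcon : ∀ i, ∀ x ∈ P.Ehat (P.fedge c i), ∀ y ∈ P.Ehat (P.fedge c i), δ x = δ y := fun i x hx y hy =>
    int_const (P.convex_Ehat _).isPreconnected (hδ.mono fun x hx => P.Ehat_Fhat hx) (hkint i) hx hy
  have hstep : ∀ i, ∃ x ∈ P.Ehat (P.fedge c i), ∃ y ∈ P.Ehat (P.fedge c (i+1)), δ x = δ y := by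
    intro i
    obtain ⟨p, q, hpq, -, hall⟩ := P.Bparam c i
    obtain ⟨κ, hκ⟩ := P.kink_exists hn c i
    have hκ' := (hk _ _ κ).1 hκ
    obtain ⟨z, hz, hzk⟩ := hκ
    obtain ⟨z', hz', hzk'⟩ := hκ'
    obtain ⟨η, hη, h1, h2⟩ := P.kink_formula (hT p0 hp0F) (hS p0 hp0F) hθ hθe hz hzk
    obtain ⟨η', hη', h1', h2'⟩ := P.kink_formula (hT p0 hp0F) (hS p0 hp0F) (hδ.add hθ) hθ'e hz' hzk'
    simp only [Pi.add_apply] at h2'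
    rw [(hall z hz).1, (hall z hz).2] at h1 h2
    rw [(hall z' hz').1, (hall z' hz').2] at h1' h2'
    have hpE : n p = n' p ∧ n q = n' q ∧ p ∈ P.Fhat c := by
      rcases hpq with h | h
      · exact ⟨he _ h.1, he _ h.2, P.Ehat_Fhat h.1⟩
      · exact ⟨he _ h.2, he _ h.1, P.Ehat_Fhat h.2⟩
    obtain ⟨j, hj⟩ := rot_inj hN (hT p hpE.2.2) (hS p hpE.2.2) (θ := η) (φ := η')
      (by rw [← h1, hpE.1, hpE.2.1, h1'])
    have hpi := Real.pi_pos
    have hj0 : j = 0 := by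
      have u1 : (j:ℝ) < 1 := by
        by_contra hh; push Not at hh
        nlinarith [hη.1, hη.2, hη'.1, hη'.2]
      have u2 : (-1:ℝ) < j := by
        by_contra hh; push Not at hh
        nlinarith [hη.1, hη.2, hη'.1, hη'.2]
      have v1 : j < 1 := by exact_mod_cast u1
      have v2 : -1 < j := by exact_mod_cast u2
      omega
    rw [hj0] at hj
    simp only [Int.cast_zero, mul_zero] at hj
    have hd : δ p = δ q := by linarith
    rcases hpq with h | h
    · exact ⟨p, h.1, q, h.2, hd⟩
    · exact ⟨q, h.1, p, h.2, hd.symm⟩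
  have hall0 : ∀ i, ∀ x ∈ P.Ehat (P.fedge c i), δ x = δ p0 := by
    intro i
    induction i with
    | zero => exact fun x hx => hcon 0 x hx p0 hp0
    | succ i ih =>
      intro x hx
      obtain ⟨u, hu, y, hy, e⟩ := hstep i
      rw [hcon _ x hx y hy, ← e, ih u hu]
  obtain ⟨k, hk0⟩ := hkint 0 p0 hp0
  refine ⟨fun x => δ x - 2 * Real.pi * k, hδ.sub continuousOn_const, fun x hx => ?_, fun c' x hx hx' hX => ?_⟩
  · rw [rot_int]; exact hδe x hx
  · obtain ⟨i, hi⟩ := P.edge_lemma hx.1 hx'.1 hX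
    have := hall0 i x ⟨hi, hx.2⟩
    simp only; rw [this, hk0]; ring

/-- allowed values of a tangent field at a point -/
def Tan (x : V3) : Set V3 := {v | v ∈ sphereS ∧ ∀ c, x ∈ P.Fhat c → v ⬝ᵥ P.Fnormal c = 0}

theorem mem_of_Tan {n : V3 → V3} (hc : ContinuousOn n P.PhatSet) (h : ∀ x ∈ P.PhatSet, n x ∈ P.Tan x) :
    P.MemC0Phat n := ⟨hc, fun x hx => (h x hx).1, fun c x hx => (h x (P.Fhat_sub c hx)).2 c hx⟩

theorem Tan_of_mem {n : V3 → V3} (h : P.MemC0Phat n) : ∀ x ∈ P.PhatSet, n x ∈ P.Tan x :=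
  fun x hx => ⟨h.2.1 x hx, fun c hc => h.2.2 c x hc⟩

theorem hom_of_Htp {n n' : V3 → V3} (h : Htp P.PhatSet P.Tan n n') : P.HomotopicPhat n n' := by
  obtain ⟨H, h1, h2, h3, h4⟩ := h
  exact ⟨H, h1, fun t ht => P.mem_of_Tan
    (h1.comp (f := fun x : V3 => (t, x)) (by fun_prop) (fun x hx => ⟨ht, hx⟩)) (h2 t ht), h3, h4⟩

theorem step1 {n n' : V3 → V3} (hn : P.MemC0Phat n) (hn' : P.MemC0Phat n')
    (he : ∀ b : Fin P.ne, Set.EqOn n n' (P.Ehat b))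
    (hk : ∀ a c, ∀ κ : ℤ, P.HasKink a c n κ ↔ P.HasKink a c n' κ) :
    ∃ n1, P.MemC0Phat n1 ∧ Htp P.PhatSet P.Tan n n1 ∧ ∀ c, ∀ x ∈ P.Fhat c, n1 x = n' x := by
  choose δ hδ hδe hδ0 using P.face_delta hn hn' he hk
  have hcons : ∀ c c', ∀ x ∈ P.Fhat c, x ∈ P.Fhat c' → ∀ t,
      rot3 (P.Fnormal c) (t * δ c x) (n x) = rot3 (P.Fnormal c') (t * δ c' x) (n x) := by
    intro c c' x hx hx' t
    by_cases hX : crossProduct (P.Fnormal c) (P.Fnormal c') = 0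
    · obtain ⟨hF, hf⟩ := P.par_faces hx.1 hx'.1 hX
      have hsame : P.Fhat c = P.Fhat c' := by rw [Fhat, Fhat, hf]
      obtain ⟨p0, q0, hp0, -⟩ := P.Bseg c 0
      obtain ⟨c'', h1, h2⟩ := P.edge_other c (P.fedge c 0)
      have hpF := P.Ehat_Fhat hp0
      have hp'' := P.mem_Fhat_of_edge h1 hp0
      have z1 := hδ0 c c'' p0 hpF hp'' h2
      have z2 := hδ0 c' c'' p0 (hsame ▸ hpF) hp'' (hF ▸ h2)
      have := int_const (f := fun x => δ c x - δ c' x) (P.convex_Fhat c).isPreconnected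
        ((hδ c).sub (hsame ▸ hδ c')) (fun y hy => rot_inj (P.Fnormal_unit c) (hn.2.2 c y hy)
          (hn.2.1 y (P.Fhat_sub c hy)) (by
            rw [← hδe c y hy, hδe c' y (hsame ▸ hy), hF])) hx hpF
      rw [hF, show δ c x = δ c' x by linarith]
    · rw [hδ0 c c' x hx hx' hX, hδ0 c' c x hx' hx (by
        rw [← cross_anticomm]; exact neg_ne_zero.2 hX)]
      simp [rot3_zero]
  let h : ℝ → V3 → V3 := fun t x => if hh : ∃ c, x ∈ P.Fhat c then
    rot3 (P.Fnormal hh.choose) (t * δ hh.choose x) (n x) else n x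
  have hh : ∀ c, ∀ x ∈ P.Fhat c, ∀ t, h t x = rot3 (P.Fnormal c) (t * δ c x) (n x) := by
    intro c x hx t
    have hex : ∃ c, x ∈ P.Fhat c := ⟨c, hx⟩
    simp only [h, dif_pos hex]
    exact hcons _ _ x hex.choose_spec hx t
  have hcl : ∀ c, IsClosed (P.Fhat c) := fun c => (P.isCompact_Fhat c).isClosed
  have hcont : ContinuousOn (fun q : ℝ × V3 => h q.1 q.2) (Icc (0:ℝ) 1 ×ˢ ⋃ c, P.Fhat c) := by
    rw [prod_iUnion]
    refine paste_finite (fun c => isClosed_Icc.prod (hcl c))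
      (fun c q => rot3 (P.Fnormal c) (q.1 * δ c q.2) (n q.2)) (fun c => ?_) (fun c q hq => hh c _ hq.2 _)
    have d1 : ContinuousOn (fun q : ℝ × V3 => q.1 * δ c q.2) (Icc (0:ℝ) 1 ×ˢ P.Fhat c) :=
      continuousOn_fst.mul ((hδ c).comp continuousOn_snd fun q hq => hq.2)
    have d2 : ContinuousOn (fun q : ℝ × V3 => n q.2) (Icc (0:ℝ) 1 ×ˢ P.Fhat c) :=
      hn.1.comp continuousOn_snd fun q hq => P.Fhat_sub c hq.2
    exact (continuous_rot3 (P.Fnormal c)).comp_continuousOn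
      (f := fun q : ℝ × V3 => (q.1 * δ c q.2, n q.2)) (d1.prodMk d2)
  have hval : ∀ t, ∀ c, ∀ x ∈ P.Fhat c, h t x ∈ sphereS ∧ h t x ⬝ᵥ P.Fnormal c = 0 := by
    intro t c x hx
    rw [hh c x hx]
    exact ⟨rot3_unit _ (P.Fnormal_unit c) (hn.2.2 c x hx) (hn.2.1 x (P.Fhat_sub c hx)), rot3_dot _ (hn.2.2 c x hx)⟩
  obtain ⟨H, H1, H2, H3, H4⟩ := hep P.isCompact_Phat.isClosed (isClosed_iUnion_of_finite hcl) hn.1 hn.2.1 hcont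
    (fun t _ x hx => by obtain ⟨c, hc⟩ := mem_iUnion.1 hx; exact (hval t c x hc).1)
    (fun x hx => by obtain ⟨c, hc⟩ := mem_iUnion.1 hx; rw [hh c x hc]; simp [rot3_zero])
  have hTan : ∀ t ∈ Icc (0:ℝ) 1, ∀ x ∈ P.PhatSet, H t x ∈ P.Tan x := fun t ht x hx =>
    ⟨H2 t ht x hx, fun c hc => by rw [H4 t ht x (mem_iUnion.2 ⟨c, hc⟩)]; exact (hval t c x hc).2⟩
  have h1 : (1:ℝ) ∈ Icc (0:ℝ) 1 := by simp
  refine ⟨H 1, P.mem_of_Tan (H1.comp (f := fun x : V3 => ((1:ℝ), x)) (by fun_prop) (fun x hx => ⟨h1, hx⟩))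
    (hTan 1 h1), ⟨H, H1, hTan, H3, fun _ _ => rfl⟩, fun c x hx => ?_⟩
  rw [H4 1 h1 x (mem_iUnion.2 ⟨c, hx⟩), hh c x hx, one_mul, hδe c x hx]

end PolyCtx


theorem qtrans {v w : V3} {G G' e : QQ} (hG : G ≠ 0) (he : e ≠ 0) (hG' : G' ≠ 0)
    (h1 : qv v * G = G * qI) (h2 : qv w * G' = G' * qI) (hc : e * qI = qI * e) :
    (G' * e * G⁻¹) * qv v * (G' * e * G⁻¹)⁻¹ = qv w := by
  have hh : G' * e * G⁻¹ ≠ 0 := mul_ne_zero (mul_ne_zero hG' he) (inv_ne_zero hG)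
  have hi : G⁻¹ * qv v = qI * G⁻¹ := by
    have : G⁻¹ * (qv v * G) * G⁻¹ = G⁻¹ * (G * qI) * G⁻¹ := by rw [h1]
    rwa [← mul_assoc, mul_assoc, mul_inv_cancel₀ hG, mul_one, ← mul_assoc, inv_mul_cancel₀ hG, one_mul] at this
  rw [mul_inv_eq_iff_eq_mul₀ hh]
  calc G' * e * G⁻¹ * qv v = G' * (e * qI) * G⁻¹ := by rw [mul_assoc, hi]; simp only [mul_assoc]
    _ = (G' * qI) * e * G⁻¹ := by rw [hc]; simp only [mul_assoc]
    _ = qv w * (G' * e * G⁻¹) := by rw [← h2]; simp only [mul_assoc]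

namespace PolyCtx
variable (P : PolyCtx)

theorem step2a {deg : (V3 → V3) → ℤ} (hdeg : DegreeTheory deg) {s : V3} (hs : P.AdmissibleS s)
    {n n' : V3 → V3} (hn : P.MemC0Phat n) (hn' : P.MemC0Phat n')
    (hK : ∀ c, ∀ x ∈ P.Fhat c, n x = n' x) (a)
    (hw : ∀ w : ℤ, P.HasWrap deg s a n w ↔ P.HasWrap deg s a n' w) :
    Htp (P.Chat a) (fun x => {v | v ∈ sphereS ∧ (x ∈ P.bdChat a → v = n' x)}) n n' := by
  obtain ⟨e₁, e₂, he⟩ := exists_frame (P.Cnormal_unit a)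
  obtain ⟨ctr, hci, hcC, hcb, z₀, hz₀, hz₀b, hz₀D, hloop, hrange⟩ := P.exists_loop a he
  have hs' : -s ∈ sphereS := by
    have := hs.1
    simp only [sphereS, mem_ofPred_eq] at this ⊢
    simpa using this
  obtain ⟨cs, hcs, hcs'⟩ := exists_lift_pt hs'
  have hK' : ∀ x ∈ P.bdChat a, n x = n' x := by
    intro x hx
    obtain ⟨c, hc⟩ := mem_iUnion.1 hx
    exact hK c x hc.2
  have hL : ∀ g, P.MemC0Phat g → ∀ x ∈ P.bdChat a, qstep (-s) (g x) * cs ≠ 0 ∧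
      qv (g x) * (qstep (-s) (g x) * cs) = (qstep (-s) (g x) * cs) * qI := by
    intro g hg x hx
    have hgS := hg.2.1 x (P.Chat_sub a (P.bdChat_sub a hx))
    have hns := P.ne_s hs hg hx
    exact ⟨mul_ne_zero (qstep_ne hgS fun h => hns.1 (neg_injective h).symm) hcs,
      by rw [← mul_assoc, qstep_spec hs' hgS, mul_assoc, hcs', mul_assoc]⟩
  have main : ∀ g, P.MemC0Phat g → ∀ G, IsLift g (P.Chat a) G → ∃ (m : ℤ) (ψ : ℂ → ℂ), ContinuousOn ψ {ζ | ‖ζ‖ = 1} ∧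
      (∀ ζ, ‖ζ‖ = 1 → qrat (qstep (-s) (g (z₀ ζ)) * cs) (G (z₀ ζ)) = Complex.exp (ψ ζ) * ζ ^ m) ∧
      P.HasWrap deg s a g (-m) := by
    intro g hg G hG
    have hzC : MapsTo z₀ {ζ | ‖ζ‖ = 1} (P.Chat a) := fun ζ hζ => P.bdChat_sub a (hz₀b ζ hζ)
    have c1 : ContinuousOn (fun ζ => g (z₀ ζ)) {ζ : ℂ | ‖ζ‖ = 1} :=
      hg.1.comp hz₀ fun ζ hζ => P.Chat_sub a (hzC hζ)
    have c2 : ContinuousOn (fun ζ => G (z₀ ζ)) {ζ : ℂ | ‖ζ‖ = 1} := hG.1.comp hz₀ hzC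
    have c3 : ContinuousOn (fun ζ => qstep (-s) (g (z₀ ζ))) {ζ : ℂ | ‖ζ‖ = 1} :=
      continuous_qstep.comp_continuousOn (f := fun ζ => (-s, g (z₀ ζ))) (continuousOn_const.prodMk c1)
    have c4 := qrat_continuousOn (c3.mul continuousOn_const) c2 (fun ζ hζ => (hL g hg _ (hz₀b ζ hζ)).1)
    obtain ⟨m, ψ, hψ, hm⟩ := winding_circle c4 (fun ζ hζ =>
      (qrat_spec (hL g hg _ (hz₀b ζ hζ)).1 (hG.2 _ (hzC hζ)).1 (hL g hg _ (hz₀b ζ hζ)).2 (hG.2 _ (hzC hζ)).2).2)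
    refine ⟨m, ψ, hψ, hm, ?_⟩
    have hex : P.HasWrap deg s a g (deg (wrapMap g (fun β => z₀ (Complex.exp (β * Complex.I))) ctr s)) :=
      ⟨ctr, _, hcC, hcb, hloop, hrange, rfl⟩
    have := P.wrap_winding hdeg hs hg he hcC hci hz₀D hG hcs hcs' hψ hm hex
    rwa [this] at hex
  obtain ⟨G, hG⟩ := lift_convex (P.isCompact_Chat a) (P.convex_Chat a) (hn.1.mono (P.Chat_sub a))
    (fun x hx => hn.2.1 x (P.Chat_sub a hx))
  obtain ⟨G', hG'⟩ := lift_convex (P.isCompact_Chat a) (P.convex_Chat a) (hn'.1.mono (P.Chat_sub a))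
    (fun x hx => hn'.2.1 x (P.Chat_sub a hx))
  obtain ⟨m, ψ, hψ, hm, hwm⟩ := main n hn G hG
  obtain ⟨m', ψ', hψ', hm', -⟩ := main n' hn' G' hG'
  have hmm : m = m' := by
    have := P.wrap_winding hdeg hs hn' he hcC hci hz₀D hG' hcs hcs' hψ' hm' ((hw _).1 hwm)
    omega
  subst hmm
  -- direction map
  have hcc : ∀ x ∈ P.bdChat a, cc e₁ e₂ (x - ctr) ≠ 0 := fun x hx =>
    he.cc_ne (P.Chat_diff (P.bdChat_sub a hx) hcC) (sub_ne_zero.2 fun h => hcb (h ▸ hx))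
  let D : V3 → ℂ := fun x => cc e₁ e₂ (x - ctr) / ‖cc e₁ e₂ (x - ctr)‖
  have hD1 : ∀ x ∈ P.bdChat a, ‖D x‖ = 1 := by
    intro x hx
    simp only [D, norm_div, Complex.norm_real, norm_norm]
    exact div_self (norm_ne_zero_iff.2 (hcc x hx))
  have hDc : ContinuousOn D (P.bdChat a) := by
    have k1 : Continuous (fun x : V3 => cc e₁ e₂ (x - ctr)) :=
      (continuous_cc e₁ e₂).comp (continuous_id.sub continuous_const)
    have k2 : Continuous (fun x : V3 => ((‖cc e₁ e₂ (x - ctr)‖ : ℝ) : ℂ)) := Complex.continuous_ofReal.comp k1.norm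
    exact k1.continuousOn.div k2.continuousOn fun x hx => by
      simpa using hcc x hx
  have hDψ : ContinuousOn (fun x => ψ' (D x) - ψ (D x)) (P.bdChat a) :=
    (hψ'.comp hDc fun x hx => hD1 x hx).sub (hψ.comp hDc fun x hx => hD1 x hx)
  obtain ⟨χ, hχ, hχe⟩ := tietze_fun (P.isCompact_bdChat a).isClosed hDψ
  let e : V3 → QQ := fun x => Quaternion.coeComplex (Complex.exp (-χ x))
  have hec : Continuous e := continuous_coeComplex.comp (Complex.continuous_exp.comp hχ.neg)
  have hcoe0 : ∀ c : ℂ, c ≠ 0 → Quaternion.coeComplex c ≠ 0 := by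
    intro c hc h
    apply hc
    have h1 := congrArg QuaternionAlgebra.re h
    have h2 := congrArg QuaternionAlgebra.imI h
    apply Complex.ext
    · simpa using h1
    · simpa using h2
  have he0 : ∀ x, e x ≠ 0 := fun x => hcoe0 _ (Complex.exp_ne_zero _)
  let h : V3 → QQ := fun x => G' x * e x * (G x)⁻¹
  have hh0 : ∀ x ∈ P.Chat a, h x ≠ 0 := fun x hx =>
    mul_ne_zero (mul_ne_zero (hG'.2 x hx).1 (he0 x)) (inv_ne_zero (hG.2 x hx).1)
  have hhc : ContinuousOn h (P.Chat a) :=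
    (hG'.1.mul hec.continuousOn).mul (hG.1.inv₀ fun x hx => (hG.2 x hx).1)
  have hhb : ∀ x ∈ P.bdChat a, h x = 1 := by
    intro x hx
    have hxC := P.bdChat_sub a hx
    have q1 := (qrat_spec (hL n hn x hx).1 (hG.2 x hxC).1 (hL n hn x hx).2 (hG.2 x hxC).2).1
    have q2 := (qrat_spec (hL n' hn' x hx).1 (hG'.2 x hxC).1 (hL n' hn' x hx).2 (hG'.2 x hxC).2).1
    have w1 := hm (D x) (hD1 x hx)
    have w2 := hm' (D x) (hD1 x hx)
    rw [hz₀D x hx] at w1 w2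
    rw [w1] at q1
    rw [w2, ← hK' x hx] at q2
    have : G' x * e x = G x := by
      rw [q1, q2, mul_assoc]
      congr 1
      simp only [e]
      rw [← Quaternion.coeComplex_mul, hχe x hx]
      congr 1
      rw [mul_right_comm, ← Complex.exp_add]
      congr 2; ring
    simp only [h]
    rw [this, mul_inv_cancel₀ (hG.2 x hxC).1]
  have hnull := (null_htp (P.isCompact_Chat a) (Φ := fun r : ℝ × ℝ => ctr + (r.1 • e₁ + r.2 • e₂)) (by fun_prop)
    (fun x hx => ⟨((cc e₁ e₂ (x - ctr)).re, (cc e₁ e₂ (x - ctr)).im), by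
      simp only
      rw [← he.decomp (P.Chat_diff hx hcC)]; simp⟩) hhc hh0).symm
  obtain ⟨Q, Q1, Q2, Q3, Q4⟩ := hnull
  refine ⟨fun t x => qact (Q t x) (n x), ?_, ?_, ?_, ?_⟩
  · have d : ContinuousOn (fun q : ℝ × V3 => n q.2) (Icc (0:ℝ) 1 ×ˢ P.Chat a) :=
      hn.1.comp continuousOn_snd fun q hq => P.Chat_sub a hq.2
    exact qact_continuousOn.comp (f := fun q : ℝ × V3 => (Q q.1 q.2, n q.2)) (Q1.prodMk d)
      (fun q hq => (Q2 _ hq.1 _ hq.2).1)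
  · intro t ht x hx
    refine ⟨(qact_spec (Q2 t ht x hx).1 (hn.2.1 x (P.Chat_sub a hx))).2, fun hb => ?_⟩
    simp only
    rw [(Q2 t ht x hx).2 (hhb x hb), qact_one, hK' x hb]
  · intro x hx
    simp only
    rw [Q3 x hx, qact_one]
  · intro x hx
    simp only
    rw [Q4 x hx, qact, qtrans (hG.2 x hx).1 (he0 x) (hG'.2 x hx).1 (hG.2 x hx).2 (hG'.2 x hx).2 (coeComplex_comm _),
      vq_qv]

theorem step2 {n n' : V3 → V3} (hn : P.MemC0Phat n) (hn' : P.MemC0Phat n')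
    (hK : ∀ c, ∀ x ∈ P.Fhat c, n x = n' x)
    (hw : ∀ a, Htp (P.Chat a) (fun x => {v | v ∈ sphereS ∧ (x ∈ P.bdChat a → v = n' x)}) n n') :
    ∃ n2, P.MemC0Phat n2 ∧ Htp P.PhatSet P.Tan n n2 ∧ (∀ c, ∀ x ∈ P.Fhat c, n2 x = n' x) ∧
      ∀ a, ∀ x ∈ P.Chat a, n2 x = n' x := by
  choose G G1 G2 G3 G4 using hw
  have h0 : (0:ℝ) ∈ Icc (0:ℝ) 1 := by simp
  have h1 : (1:ℝ) ∈ Icc (0:ℝ) 1 := by simp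
  let h : ℝ → V3 → V3 := fun t x => if hh : ∃ a, x ∈ P.Chat a then G hh.choose t x else n x
  have hC : ∀ a, ∀ x ∈ P.Chat a, ∀ t ∈ Icc (0:ℝ) 1, h t x = G a t x := by
    intro a x hx t ht
    have hex : ∃ a, x ∈ P.Chat a := ⟨a, hx⟩
    simp only [h, dif_pos hex]
    by_cases e : hex.choose = a
    · rw [e]
    · have hf := P.touching e hex.choose_spec hx
      rw [(G2 _ t ht x hex.choose_spec).2 (P.mem_bdChat.2 ⟨hex.choose_spec, hf⟩),
        (G2 a t ht x hx).2 (P.mem_bdChat.2 ⟨hx, hf⟩)]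
  have hF : ∀ c, ∀ x ∈ P.Fhat c, ∀ t ∈ Icc (0:ℝ) 1, h t x = n' x := by
    intro c x hx t ht
    by_cases hex : ∃ a, x ∈ P.Chat a
    · obtain ⟨a, ha⟩ := hex
      rw [hC a x ha t ht]
      exact (G2 a t ht x ha).2 (mem_iUnion.2 ⟨c, ha, hx⟩)
    · simp only [h, dif_neg hex]; exact hK c x hx
  let A : Fin P.nf ⊕ Fin P.nv → Set V3 := Sum.elim P.Fhat P.Chat
  have hAcl : ∀ i, IsClosed (A i) := by
    rintro (c | a)
    · exact (P.isCompact_Fhat c).isClosed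
    · exact (P.isCompact_Chat a).isClosed
  have hcont : ContinuousOn (fun q : ℝ × V3 => h q.1 q.2) (Icc (0:ℝ) 1 ×ˢ ⋃ i, A i) := by
    rw [prod_iUnion]
    refine paste_finite (fun i => isClosed_Icc.prod (hAcl i))
      (Sum.elim (fun c q => n' q.2) (fun a q => G a q.1 q.2)) ?_ ?_
    · rintro (c | a)
      · exact hn'.1.comp continuousOn_snd fun q hq => P.Fhat_sub c hq.2
      · exact G1 a
    · rintro (c | a) q hq
      · exact hF c _ hq.2 _ hq.1
      · exact hC a _ hq.2 _ hq.1
  obtain ⟨H, H1, H2, H3, H4⟩ := hep P.isCompact_Phat.isClosed (isClosed_iUnion_of_finite hAcl) hn.1 hn.2.1 hcont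
    (fun t ht x hx => by
      obtain ⟨c | a, hc⟩ := mem_iUnion.1 hx
      · rw [hF c x hc t ht]; exact hn'.2.1 x (P.Fhat_sub c hc)
      · rw [hC a x hc t ht]; exact (G2 a t ht x hc).1)
    (fun x hx => by
      obtain ⟨c | a, hc⟩ := mem_iUnion.1 hx
      · rw [hF c x hc 0 h0]; exact (hK c x hc).symm
      · rw [hC a x hc 0 h0]; exact G3 a x hc)
  have mF : ∀ c, ∀ x ∈ P.Fhat c, x ∈ ⋃ i, A i := fun c x hx => mem_iUnion.2 ⟨Sum.inl c, hx⟩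
  have hTan : ∀ t ∈ Icc (0:ℝ) 1, ∀ x ∈ P.PhatSet, H t x ∈ P.Tan x := fun t ht x hx =>
    ⟨H2 t ht x hx, fun c hc => by rw [H4 t ht x (mF c x hc), hF c x hc t ht]; exact hn'.2.2 c x hc⟩
  refine ⟨H 1, P.mem_of_Tan (H1.comp (f := fun x : V3 => ((1:ℝ), x)) (by fun_prop) (fun x hx => ⟨h1, hx⟩))
    (hTan 1 h1), ⟨H, H1, hTan, H3, fun _ _ => rfl⟩, fun c x hx => ?_, fun a x hx => ?_⟩
  · rw [H4 1 h1 x (mF c x hx), hF c x hx 1 h1]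
  · rw [H4 1 h1 x (mem_iUnion.2 ⟨Sum.inr a, hx⟩), hC a x hx 1 h1, G4 a x hx]

theorem ret_htp {g : V3 → V3} (hg : P.MemC0Phat g) {ret : V3 → V3} (hr : ContinuousOn ret P.PhatSet)
    (hm : ∀ x ∈ P.PhatSet, ret x ∈ P.PhatSet) (hF : ∀ c, ∀ x ∈ P.Fhat c, ret x = x) :
    Htp P.PhatSet P.Tan g (fun x => g (ret x)) := by
  have hmem : ∀ t ∈ Icc (0:ℝ) 1, ∀ x ∈ P.PhatSet, x + t • (ret x - x) ∈ P.PhatSet := fun t ht x hx =>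
    P.convex_Phat.segment_subset hx (hm x hx) (seg_mem x (ret x) ht.1 ht.2)
  refine ⟨fun t x => g (x + t • (ret x - x)), ?_, ?_, fun x hx => by simp, fun x hx => by simp⟩
  · have r : ContinuousOn (fun q : ℝ × V3 => ret q.2) (Icc (0:ℝ) 1 ×ˢ P.PhatSet) :=
      hr.comp continuousOn_snd fun q hq => hq.2
    refine hg.1.comp (f := fun q : ℝ × V3 => q.2 + q.1 • (ret q.2 - q.2)) ?_ (fun q hq => hmem _ hq.1 _ hq.2)
    exact continuousOn_snd.add (continuousOn_fst.smul (r.sub continuousOn_snd))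
  · intro t ht x hx
    refine ⟨hg.2.1 _ (hmem t ht x hx), fun c hc => ?_⟩
    simp only
    rw [hF c x hc]
    simpa using hg.2.2 c x hc

theorem step3 {n n' : V3 → V3} (hn : P.MemC0Phat n) (hn' : P.MemC0Phat n')
    (hF : ∀ c, ∀ x ∈ P.Fhat c, n x = n' x) (hC : ∀ a, ∀ x ∈ P.Chat a, n x = n' x) :
    Htp P.PhatSet P.Tan n n' := by
  obtain ⟨ret, r1, r2, r3⟩ := P.exists_ret
  have k1 := P.ret_htp hn r1 (fun x hx => (r2 x hx).1) r3
  have k2 := P.ret_htp hn' r1 (fun x hx => (r2 x hx).1) r3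
  refine (k1.trans (g := fun x => n (ret x)) (Htp.of_eqOn (g := fun x => n' (ret x)) ?_ ?_ ?_)).trans k2.symm
  · exact hn.1.comp r1 fun x hx => (r2 x hx).1
  · obtain ⟨H, H1, H2, H3, H4⟩ := k1
    intro x hx
    have := H2 1 (by simp) x hx
    rwa [H4 x hx] at this
  · intro x hx
    rcases (r2 x hx).2 with ⟨c, hc⟩ | ⟨a, ha⟩
    · exact hF c _ hc
    · exact hC a _ ha

theorem backward {deg : (V3 → V3) → ℤ} (hdeg : DegreeTheory deg) {s : V3} (hs : P.AdmissibleS s) {n n' : V3 → V3}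
    (hn : P.MemC0Phat n) (hn' : P.MemC0Phat n') (h : P.SameInv deg s n n') : P.HomotopicPhat n n' := by
  obtain ⟨he, hk, hw⟩ := h
  obtain ⟨n1, m1, t1, f1⟩ := P.step1 hn hn' he hk
  have w1 := (P.forward hdeg hs hn m1 (P.hom_of_Htp t1)).2.2
  obtain ⟨n2, m2, t2, f2, c2⟩ := P.step2 m1 hn' f1 (fun a =>
    P.step2a hdeg hs m1 hn' f1 a (fun w => (w1 a w).symm.trans (hw a w)))
  exact P.hom_of_Htp ((t1.trans t2).trans (P.step3 m2 hn' f2 c2))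

end PolyCtx


/-- Two fields `n̂, n̂' ∈ C⁰(P̂)` are homotopic if and only if they have
the same edge orientations, kink numbers and wrapping numbers. -/
theorem stmt_3 (P : PolyCtx) (deg : (V3 → V3) → ℤ) (hdeg : DegreeTheory deg)
    (s : V3) (hs : P.AdmissibleS s) (n n' : V3 → V3)
    (hn : P.MemC0Phat n) (hn' : P.MemC0Phat n') :
    P.HomotopicPhat n n' ↔ P.SameInv deg s n n' := by
  exact ⟨P.forward hdeg hs hn hn', P.backward hdeg hs hn hn'⟩
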